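/- Fix i ∈ {1,2}. There exist constants M ≥ 1 and ε₀ > 0, and for each ε ∈ (0,ε₀) a constant δ₁(ε) ∈ (0,1), such that the following holds for every ε ∈ (0,ε₀), every δ ∈ (0, δ₁(ε)], and every subset A ⊆ B^{𝔯ᵢ}_1(0): the set ℰ(A) = {u ∈ 𝖡₁ᵁ : there exists A' ⊆ A with |A'|_δ ≥ δ^ε·|A|_δ and |π^{(0)}_u(A')|_δ < δ^{Mε}·|A|_δ^{2/3}} satisfies m_U(ℰ(A)) ≤ δ^ε. -/

import Mathlib

open Matrix MeasureTheory
open scoped Classical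

noncomputable section

abbrev M4 : Type := Matrix (Fin 4) (Fin 4) ℝ

/-- trace inner product ⟨X,Y⟩ = tr(XYᵀ) -/
def tinner (X Y : M4) : ℝ := (X * Yᵀ).trace

/-- sup norm: maximum absolute value of entries -/
def mnorm (X : M4) : ℝ := ⨆ p : Fin 4 × Fin 4, |X p.1 p.2|

/-- Euclidean (Frobenius) norm -/
def mnorm2 (X : M4) : ℝ := Real.sqrt (tinner X X)

/-- Gram matrices Q₁ (i=0) and Q₂ (i=1) -/
def Qmat (i : Fin 2) : M4 :=
  if i = 0 then !![0,0,0,-(1/2); 0,0,1/2,0; 0,1/2,0,0; -(1/2),0,0,0]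
  else !![0,0,0,-1; 0,1,0,0; 0,0,1,0; -1,0,0,0]

/-- 𝔰𝔩₄(ℝ) as a submodule of 4×4 matrices -/
def sl4 : Submodule ℝ M4 where
  carrier := {X | X.trace = 0}
  add_mem' := by
    intro a b ha hb
    simp only [Set.mem_setOf_eq] at *
    simp [Matrix.trace_add, ha, hb]
  zero_mem' := by simp
  smul_mem' := by
    intro c x hx
    simp only [Set.mem_setOf_eq] at *
    simp [Matrix.trace_smul, hx]

/-- the involution σᵢ(X) = −QᵢXᵀQᵢ⁻¹ as a linear map -/
def sigmaMap (i : Fin 2) : M4 →ₗ[ℝ] M4 where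
  toFun X := -(Qmat i * Xᵀ * (Qmat i)⁻¹)
  map_add' X Y := by
    simp [Matrix.transpose_add, add_mul, mul_add]; abel
  map_smul' c X := by
    simp [Matrix.transpose_smul, Matrix.smul_mul, Matrix.mul_smul]

/-- 𝔯ᵢ = {X ∈ 𝔰𝔩₄ : σᵢ(X) = −X} -/
def rSpace (i : Fin 2) : Submodule ℝ M4 :=
  sl4 ⊓ LinearMap.ker (sigmaMap i + (LinearMap.id : M4 →ₗ[ℝ] M4))

/-- 𝔥ᵢ = {X ∈ 𝔰𝔩₄ : σᵢ(X) = X} -/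
def hSpace (i : Fin 2) : Submodule ℝ M4 :=
  sl4 ⊓ LinearMap.ker (sigmaMap i - (LinearMap.id : M4 →ₗ[ℝ] M4))

/-- 𝐚 = diag(1,0,0,−1) -/
def aWt : M4 := Matrix.diagonal ![1,0,0,-1]

/-- ad(𝐚) = [𝐚, ·] -/
def adA : M4 →ₗ[ℝ] M4 where
  toFun X := aWt * X - X * aWt
  map_add' X Y := by simp [mul_add, add_mul]; abel
  map_smul' c X := by simp [Matrix.mul_smul, Matrix.smul_mul, smul_sub]

/-- weight space (𝔯ᵢ)_λ -/
def wSpace (i : Fin 2) (lam : ℤ) : Submodule ℝ M4 :=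
  rSpace i ⊓ LinearMap.ker (adA - (lam : ℝ) • (LinearMap.id : M4 →ₗ[ℝ] M4))

/-- 𝔯ᵢ^{(λ)} = ⊕_{μ ≥ λ} (𝔯ᵢ)_μ -/
def rUp (i : Fin 2) (lam : ℤ) : Submodule ℝ M4 :=
  ⨆ (μ : ℤ) (_ : lam ≤ μ), wSpace i μ

/-- a_t = diag(e^t, 1, 1, e^{−t}) -/
def aMat (t : ℝ) : M4 := Matrix.diagonal ![Real.exp t, 1, 1, Real.exp (-t)]

/-- the unipotent elements u^{(i)}_{r,s} -/
def uMat (i : Fin 2) (r s : ℝ) : M4 :=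
  if i = 0 then !![1, r, s, s*r; 0,1,0,s; 0,0,1,r; 0,0,0,1]
  else !![1, r, s, (r^2+s^2)/2; 0,1,0,r; 0,0,1,s; 0,0,0,1]

/-- adjoint action g.X = gXg⁻¹ -/
def Adm (g X : M4) : M4 := g * X * g⁻¹

/-- adjoint action as a linear map -/
def AdLin (g : M4) : M4 →ₗ[ℝ] M4 where
  toFun X := g * X * g⁻¹
  map_add' X Y := by simp [mul_add, add_mul]
  map_smul' c X := by simp [Matrix.mul_smul, Matrix.smul_mul]

/-- the parameter square [−1,1]² -/
def uSq : Set (ℝ × ℝ) := Set.Icc (-1 : ℝ) 1 ×ˢ Set.Icc (-1 : ℝ) 1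

/-- m_U = (1/4)·(Lebesgue measure in the parameters) -/
def mU (S : Set (ℝ × ℝ)) : ENNReal := volume S / 4

/-- modified α-energy 𝒢^{(α)}_{F,δ}(w) -/
def energy (α δ : ℝ) (F : Finset M4) (w : M4) : ℝ :=
  ∑ w' ∈ F.erase w, (max (mnorm (w' - w)) δ) ^ (-α)

/-- φ(α) = (1/36)·min{(8/9)α, 1 − α/9} -/
def phiFn (α : ℝ) : ℝ := (1/36) * min ((8/9)*α) (1 - α/9)

/-- δ-covering number by closed balls for the sup norm -/
def covNum (δ : ℝ) (A : Set M4) : ℕ :=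
  sInf {n : ℕ | ∃ t : Finset M4, t.card = n ∧ A ⊆ ⋃ c ∈ t, {y : M4 | mnorm (y - c) ≤ δ}}

/-- orthonormal basis of a subspace, as a tuple -/
def IsONB {n : Type} [Fintype n] (v : n → M4) (V : Submodule ℝ M4) : Prop :=
  (∀ k, v k ∈ V) ∧ (∀ k l, tinner (v k) (v l) = if k = l then 1 else 0) ∧
    Submodule.span ℝ (Set.range v) = V

/-- Gram matrix of a tuple of vectors -/
def gram {n : Type} [Fintype n] (v : n → M4) : Matrix n n ℝ :=
  Matrix.of fun a b => tinner (v a) (v b)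

/-- weights λ₁,…,λ₅ = −2,…,2 -/
def lamOf : Fin 5 → ℤ := ![-2,-1,0,1,2]

/-- dimension differences 𝖽 = (1,2,3,2,1) -/
def dOf : Fin 5 → ℝ := ![1,2,3,2,1]

/-- Index of the atom of 𝒟^𝐫_ρ containing x, for an adapted orthonormal basis b with weights wt. -/
def atomIdx (b : Fin 9 → M4) (wt : Fin 9 → ℤ) (r : Fin 5 → ℝ) (ρ : ℝ) (x : M4) :
    Fin 5 → Fin 9 → ℤ :=
  fun j k => if lamOf j ≤ wt k then ⌊ tinner x (b k) / ρ ^ (r j) ⌋ else 0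

end

/-- Number of points of `s` in the fibre of `X` through `b`. -/
noncomputable def fiberCard {ι α : Type*} (s : Finset ι) (X : ι → α) (b : ι) : ℝ :=
  ((s.filter fun b' => X b' = X b).card : ℝ)

/-- `|s|` times the Shannon entropy of `X` at a uniformly distributed point of `s`. -/
noncomputable def ent {ι α : Type*} (s : Finset ι) (X : ι → α) : ℝ :=
  ∑ b ∈ s, Real.log (s.card / fiberCard s X b)

/-- Each fibre of `X` meets at most `K` fibres of `Y`. -/
def ApproxDet {ι α β : Type*} (s : Finset ι) (K : ℝ) (X : ι → α) (Y : ι → β) : Prop :=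
  ∀ b ∈ s, (((s.filter fun b' => X b' = X b).image Y).card : ℝ) ≤ K

theorem fiberCard_pos {ι α : Type*} {s : Finset ι} {X : ι → α} {b : ι} (hb : b ∈ s) :
    0 < fiberCard s X b := by
  unfold fiberCard
  exact_mod_cast Finset.card_pos.mpr ⟨b, by simp [hb]⟩

theorem fiberCard_congr {ι α : Type*} {s : Finset ι} {X : ι → α} {b c : ι} (h : X b = X c) :
    fiberCard s X b = fiberCard s X c := by
  simp [fiberCard, h]

theorem fiberCard_eq_sum {ι α : Type*} (s : Finset ι) (X : ι → α) (b : ι) :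
    fiberCard s X b = ∑ b' ∈ s, if X b' = X b then (1 : ℝ) else 0 := by
  simp [fiberCard]

/-- Jensen's inequality for `log`, unnormalised. -/
theorem sum_log_le {ι : Type*} {s : Finset ι} {f : ι → ℝ} {K : ℝ}
    (hs : s.Nonempty) (hf : ∀ b ∈ s, 0 < f b) (hK : ∑ b ∈ s, f b ≤ s.card * K) :
    ∑ b ∈ s, Real.log (f b) ≤ s.card * Real.log K := by
  have hN : (0 : ℝ) < s.card := by exact_mod_cast hs.card_pos
  have hK0 : 0 < K := by
    have : 0 < ∑ b ∈ s, f b := Finset.sum_pos hf hs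
    by_contra h
    nlinarith
  have h1 : ∀ b ∈ s, Real.log (f b) ≤ Real.log K + (f b / K - 1) := by
    intro b hb
    have := Real.log_le_sub_one_of_pos (div_pos (hf b hb) hK0)
    rw [Real.log_div (hf b hb).ne' hK0.ne'] at this
    linarith
  calc _ ≤ ∑ b ∈ s, (Real.log K + (f b / K - 1)) := Finset.sum_le_sum h1
    _ = s.card * Real.log K + ((∑ b ∈ s, f b) / K - s.card) := by
        simp [Finset.sum_add_distrib, Finset.sum_sub_distrib, Finset.sum_div]
    _ ≤ _ := by
        have : (∑ b ∈ s, f b) / K ≤ s.card := by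
          rw [div_le_iff₀ hK0]; exact hK
        linarith

theorem sum_div_fiberCard_le {ι α : Type*} (s : Finset ι) (X : ι → α) :
    ∑ b ∈ s, 1 / fiberCard s X b = (s.image X).card := by
  rw [Finset.card_eq_sum_ones, Nat.cast_sum,
    ← Finset.sum_fiberwise_of_maps_to (g := X) (t := s.image X)
      (fun b hb => Finset.mem_image_of_mem X hb)]
  refine Finset.sum_congr rfl fun a ha => ?_
  obtain ⟨c, hc, rfl⟩ := Finset.mem_image.mp ha
  have h : ∀ b ∈ s.filter (fun b => X b = X c), 1 / fiberCard s X b = 1 / fiberCard s X c := by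
    intro b hb
    rw [fiberCard_congr (Finset.mem_filter.mp hb).2]
  rw [Finset.sum_congr rfl h]
  have := (fiberCard_pos (X := X) hc).ne'
  rw [Finset.sum_const, nsmul_eq_mul]
  change fiberCard s X c * _ = _
  field_simp
  simp

theorem ent_le_log_card_image {ι α : Type*} {s : Finset ι} (hs : s.Nonempty) (X : ι → α) :
    ent s X ≤ s.card * Real.log (s.image X).card := by
  have hN : (0 : ℝ) < s.card := by exact_mod_cast hs.card_pos
  refine sum_log_le hs (fun b hb => div_pos hN (fiberCard_pos hb)) ?_
  rw [← sum_div_fiberCard_le, Finset.mul_sum]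
  simp [div_eq_mul_inv]

theorem ent_submod {ι α β γ κ : Type*} {s : Finset ι} (hs : s.Nonempty)
    {X : ι → α} {Y : ι → β} {U : ι → γ} {I : ι → κ}
    (hU : ∀ b ∈ s, ∀ b' ∈ s, X b = X b' → Y b = Y b' → U b = U b')
    (hX : ∀ b ∈ s, ∀ b' ∈ s, X b = X b' → I b = I b')
    (hY : ∀ b ∈ s, ∀ b' ∈ s, Y b = Y b' → I b = I b') :
    ent s U + ent s I ≤ ent s X + ent s Y := by
  have hN : (0 : ℝ) < s.card := by exact_mod_cast hs.card_pos
  have key : ∑ b ∈ s, (fiberCard s X b * fiberCard s Y b) / (fiberCard s U b * fiberCard s I b)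
      ≤ s.card * 1 := by
    have h1 : ∀ b ∈ s, (fiberCard s X b * fiberCard s Y b) / (fiberCard s U b * fiberCard s I b) =
        ∑ b' ∈ s, ∑ b'' ∈ s, (if X b' = X b ∧ Y b'' = Y b then
          1 / (fiberCard s U b * fiberCard s I b) else 0) := by
      intro b hb
      rw [fiberCard_eq_sum s X, fiberCard_eq_sum s Y, Finset.sum_mul_sum, Finset.sum_div]
      refine Finset.sum_congr rfl fun b' _ => ?_
      rw [Finset.sum_div]
      refine Finset.sum_congr rfl fun b'' _ => ?_
      by_cases h : X b' = X b <;> by_cases h' : Y b'' = Y b <;> simp [h, h']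
    rw [Finset.sum_congr rfl h1, Finset.sum_comm]
    have h2 : ∀ b' ∈ s, ∑ b ∈ s, ∑ b'' ∈ s, (if X b' = X b ∧ Y b'' = Y b then
          1 / (fiberCard s U b * fiberCard s I b) else 0) ≤ 1 := by
      intro b' hb'
      rw [Finset.sum_comm]
      have h3 : ∀ b'' ∈ s, ∑ b ∈ s, (if X b' = X b ∧ Y b'' = Y b then
          1 / (fiberCard s U b * fiberCard s I b) else 0) ≤
          if I b'' = I b' then 1 / fiberCard s I b' else 0 := by
        intro b'' hb''
        by_cases hne : ∃ c ∈ s, X b' = X c ∧ Y b'' = Y c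
        · obtain ⟨c, hc, hcX, hcY⟩ := hne
          have hI : I b' = I c := hX b' hb' c hc hcX
          have hI' : I b'' = I c := hY b'' hb'' c hc hcY
          rw [if_pos (hI'.trans hI.symm), fiberCard_congr hI]
          have hIp := fiberCard_pos (X := I) hc
          have hUp := fiberCard_pos (X := U) hc
          calc _ ≤ ∑ b ∈ s, (if U b = U c then (1 : ℝ) else 0) *
                (1 / (fiberCard s U c * fiberCard s I c)) := by
                refine Finset.sum_le_sum fun b hb => ?_
                split_ifs with h4 h5 h5
                · have : I b = I c := (hX b hb b' hb' h4.1.symm).trans hI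
                  rw [fiberCard_congr h5, fiberCard_congr this, one_mul]
                · exact absurd (hU b hb c hc (h4.1.symm.trans hcX) (h4.2.symm.trans hcY)) h5
                · positivity
                · simp
            _ = _ := by
                rw [← Finset.sum_mul, ← fiberCard_eq_sum]
                field_simp
        · push Not at hne
          rw [Finset.sum_eq_zero]
          · split_ifs
            · exact (one_div_pos.mpr (fiberCard_pos hb')).le
            · exact le_rfl
          · intro b hb
            rw [if_neg]
            exact fun h => hne b hb h.1 h.2
      refine (Finset.sum_le_sum h3).trans ?_
      have : ∀ b'' ∈ s, (if I b'' = I b' then 1 / fiberCard s I b' else 0) =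
          (if I b'' = I b' then (1 : ℝ) else 0) * (1 / fiberCard s I b') := by
        intros; split_ifs <;> simp
      rw [Finset.sum_congr rfl this, ← Finset.sum_mul, ← fiberCard_eq_sum]
      have := fiberCard_pos (X := I) hb'
      field_simp
      exact le_rfl
    calc _ ≤ ∑ b' ∈ s, (1 : ℝ) := Finset.sum_le_sum h2
      _ = _ := by simp
  have hpos : ∀ b ∈ s, 0 < (fiberCard s X b * fiberCard s Y b) /
      (fiberCard s U b * fiberCard s I b) := fun b hb =>
    div_pos (mul_pos (fiberCard_pos hb) (fiberCard_pos hb))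
      (mul_pos (fiberCard_pos hb) (fiberCard_pos hb))
  have := sum_log_le hs hpos key
  rw [Real.log_one, mul_zero] at this
  have h4 : ent s U + ent s I - (ent s X + ent s Y) = ∑ b ∈ s,
      Real.log ((fiberCard s X b * fiberCard s Y b) / (fiberCard s U b * fiberCard s I b)) := by
    unfold ent
    rw [← Finset.sum_add_distrib, ← Finset.sum_add_distrib, ← Finset.sum_sub_distrib]
    refine Finset.sum_congr rfl fun b hb => ?_
    have h1 := (fiberCard_pos (X := X) hb).ne'
    have h2 := (fiberCard_pos (X := Y) hb).ne'
    have h3 := (fiberCard_pos (X := U) hb).ne'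
    have h4 := (fiberCard_pos (X := I) hb).ne'
    rw [Real.log_div hN.ne' h1, Real.log_div hN.ne' h2, Real.log_div hN.ne' h3,
      Real.log_div hN.ne' h4, Real.log_div (mul_ne_zero h1 h2) (mul_ne_zero h3 h4),
      Real.log_mul h1 h2, Real.log_mul h3 h4]
    ring
  linarith

theorem ent_const {ι : Type*} (s : Finset ι) : ent s (fun _ => ()) = 0 := by
  unfold ent fiberCard
  refine Finset.sum_eq_zero fun b hb => ?_
  have : (s.card : ℝ) ≠ 0 := by
    exact_mod_cast (Finset.card_pos.mpr ⟨b, hb⟩).ne'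
  simp [this]

theorem ent_id {ι : Type*} (s : Finset ι) : ent s (fun b => b) = s.card * Real.log s.card := by
  unfold ent fiberCard
  rw [← nsmul_eq_mul, ← Finset.sum_const]
  refine Finset.sum_congr rfl fun b hb => ?_
  have : (s.filter fun b' => b' = b) = {b} := by
    ext b'
    simp only [Finset.mem_filter, Finset.mem_singleton]
    exact ⟨fun h => h.2, fun h => ⟨h ▸ hb, h⟩⟩
  simp [this]

theorem ent_mono {ι α β : Type*} {s : Finset ι} (hs : s.Nonempty) {X : ι → α} {Y : ι → β}
    (h : ∀ b ∈ s, ∀ b' ∈ s, X b = X b' → Y b = Y b') : ent s Y ≤ ent s X := by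
  have := ent_submod hs (X := X) (Y := fun _ => ()) (U := Y) (I := fun _ => ())
    (fun b hb b' hb' h1 _ => h b hb b' hb' h1) (by simp) (by simp)
  linarith

theorem ent_prod_le {ι α β : Type*} {s : Finset ι} (hs : s.Nonempty) {X : ι → α} {Y : ι → β}
    {K : ℝ} (h : ApproxDet s K X Y) :
    ent s (fun b => (X b, Y b)) ≤ ent s X + s.card * Real.log K := by
  have hN : (0 : ℝ) < s.card := by exact_mod_cast hs.card_pos
  have hpos : ∀ b ∈ s, 0 < fiberCard s X b / fiberCard s (fun b => (X b, Y b)) b := fun b hb =>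
    div_pos (fiberCard_pos hb) (fiberCard_pos hb)
  have key : ∑ b ∈ s, fiberCard s X b / fiberCard s (fun b => (X b, Y b)) b ≤ s.card * K := by
    have h1 : ∀ b ∈ s, fiberCard s X b / fiberCard s (fun b => (X b, Y b)) b =
        ∑ c ∈ s, if X b = X c then 1 / fiberCard s (fun b => (X b, Y b)) b else 0 := by
      intro b hb
      rw [fiberCard_eq_sum s X, Finset.sum_div]
      refine Finset.sum_congr rfl fun c hc => ?_
      by_cases h : X c = X b
      · simp [h]
      · simp [h, Ne.symm h]
    rw [Finset.sum_congr rfl h1, Finset.sum_comm, ← nsmul_eq_mul, ← Finset.sum_const]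
    refine Finset.sum_le_sum fun c hc => le_trans (le_of_eq ?_) (h c hc)
    rw [← Finset.sum_filter, ← sum_div_fiberCard_le]
    refine Finset.sum_congr rfl fun b hb => ?_
    rw [Finset.mem_filter] at hb
    unfold fiberCard
    rw [Finset.filter_filter]
    congr 3
    ext b'
    simp only [Finset.mem_filter, Prod.mk.injEq, hb.2]
  have := sum_log_le hs hpos key
  have h4 : ent s (fun b => (X b, Y b)) - ent s X = ∑ b ∈ s,
      Real.log (fiberCard s X b / fiberCard s (fun b => (X b, Y b)) b) := by
    unfold ent
    rw [← Finset.sum_sub_distrib]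
    refine Finset.sum_congr rfl fun b hb => ?_
    have h1 := (fiberCard_pos (X := X) hb).ne'
    have h2 := (fiberCard_pos (X := fun b => (X b, Y b)) hb).ne'
    rw [Real.log_div hN.ne' h1, Real.log_div hN.ne' h2, Real.log_div h1 h2]
    ring
  linarith

theorem ent_le_of_approxDet {ι α β : Type*} {s : Finset ι} (hs : s.Nonempty) {X : ι → α}
    {Y : ι → β} {K : ℝ} (h : ApproxDet s K X Y) :
    ent s Y ≤ ent s X + s.card * Real.log K := by
  have h1 : ent s Y ≤ ent s (fun b => (X b, Y b)) :=
    ent_mono hs fun _ _ _ _ h => (Prod.ext_iff.mp h).2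
  exact h1.trans (ent_prod_le hs h)

theorem ent_submod_approx {ι α β γ κ : Type*} {s : Finset ι} (hs : s.Nonempty) {K : ℝ}
    {X : ι → α} {Y : ι → β} {U : ι → γ} {I : ι → κ}
    (hU : ApproxDet s K (fun b => (X b, Y b)) U) (hX : ApproxDet s K X I)
    (hY : ApproxDet s K Y I) :
    ent s U + ent s I ≤ ent s X + ent s Y + 3 * (s.card * Real.log K) := by
  have h1 := ent_prod_le hs hX
  have h2 := ent_prod_le hs hY
  have h3 := ent_submod hs (X := fun b => (X b, I b)) (Y := fun b => (Y b, I b))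
    (U := fun b => (X b, Y b)) (I := I)
    (fun _ _ _ _ h h' => Prod.ext (Prod.ext_iff.mp h).1 (Prod.ext_iff.mp h').1)
    (fun _ _ _ _ h => (Prod.ext_iff.mp h).2) (fun _ _ _ _ h => (Prod.ext_iff.mp h).2)
  have h4 := ent_le_of_approxDet hs hU
  linarith

theorem ent_prod_le_add {ι α β : Type*} {s : Finset ι} (hs : s.Nonempty) (X : ι → α)
    (Y : ι → β) : ent s (fun b => (X b, Y b)) ≤ ent s X + ent s Y := by
  have := ent_submod hs (X := X) (Y := Y) (U := fun b => (X b, Y b)) (I := fun _ => ())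
    (fun _ _ _ _ h h' => Prod.ext h h') (by simp) (by simp)
  rw [ent_const] at this
  linarith

/-- Han's inequality, conditional on `L`. -/
theorem ent_han {ι α β : Type*} {s : Finset ι} (hs : s.Nonempty) {n : ℕ} (c : Fin n → ι → α)
    (L : ι → β) :
    n * ent s (fun b => (L b, fun k => c k b)) + ent s L ≤
      ∑ j, ent s (fun b => (L b, fun k : {k : Fin n // k ≠ j} => c k.1 b)) +
        ent s (fun b => (L b, fun k => c k b)) := by
  have step : ∀ m : ℕ, m ≤ n → m * ent s (fun b => (L b, fun k => c k b)) + ent s L ≤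
      ∑ j : Fin n with j.1 < m, ent s (fun b => (L b, fun k : {k : Fin n // k ≠ j} => c k.1 b)) +
        ent s (fun b => (L b, fun k : {k : Fin n // k.1 < m} => c k.1 b)) := by
    intro m
    induction m with
    | zero =>
      intro _
      have : ent s L ≤ ent s (fun b => (L b, fun k : {k : Fin n // k.1 < 0} => c k.1 b)) :=
        ent_mono hs fun _ _ _ _ h => (Prod.ext_iff.mp h).1
      simpa using this
    | succ m ih =>
      intro hm
      have h1 := ih (by omega)
      have h2 := ent_submod hs (X := fun b => (L b, fun k : {k : Fin n // k ≠ (⟨m, hm⟩ : Fin n)} => c k.1 b))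
        (Y := fun b => (L b, fun k : {k : Fin n // k.1 < m + 1} => c k.1 b))
        (U := fun b => (L b, fun k => c k b))
        (I := fun b => (L b, fun k : {k : Fin n // k.1 < m} => c k.1 b))
        (by
          intro b _ b' _ h h'
          rw [Prod.ext_iff] at h h' ⊢
          refine ⟨h.1, funext fun k => ?_⟩
          by_cases hk : k = ⟨m, hm⟩
          · exact congrFun h'.2 ⟨k, by simp [hk]⟩
          · exact congrFun h.2 ⟨k, hk⟩)
        (by
          intro b _ b' _ h
          rw [Prod.ext_iff] at h ⊢
          exact ⟨h.1, funext fun k => congrFun h.2 ⟨k.1, fun hk => by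
            have := k.2; rw [hk] at this; simp at this⟩⟩)
        (by
          intro b _ b' _ h
          rw [Prod.ext_iff] at h ⊢
          exact ⟨h.1, funext fun k => congrFun h.2 ⟨k.1, by have := k.2; omega⟩⟩)
      have h3 : (Finset.univ.filter fun j : Fin n => j.1 < m + 1) =
          insert (⟨m, hm⟩ : Fin n) (Finset.univ.filter fun j : Fin n => j.1 < m) := by
        ext j
        simp only [Finset.mem_filter, Finset.mem_univ, true_and, Finset.mem_insert, Fin.ext_iff]
        omega
      rw [h3, Finset.sum_insert (by simp)]
      push_cast
      linarith
  have h := step n le_rfl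
  have h5 : ent s (fun b => (L b, fun k : {k : Fin n // k.1 < n} => c k.1 b)) ≤
      ent s (fun b => (L b, fun k => c k b)) := by
    refine ent_mono hs fun b _ b' _ h => ?_
    rw [Prod.ext_iff] at h ⊢
    exact ⟨h.1, funext fun k => congrFun h.2 k.1⟩
  have h6 : (Finset.univ.filter fun j : Fin n => j.1 < n) = Finset.univ := by
    ext j; simp
  rw [h6] at h
  linarith

/-- `‖z‖ ≤ R ^ n * ρ`, as a relation stable under the ring operations when `2 ≤ R`. -/
def Bd (R ρ : ℝ) (n : ℕ) (z : ℂ) : Prop := ‖z‖ ≤ R ^ n * ρ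

namespace Bd

variable {R ρ : ℝ} {m n : ℕ} {z w c : ℂ}

theorem mono (hR : 2 ≤ R) (hρ : 0 ≤ ρ) (h : Bd R ρ n z) (hnm : n ≤ m) : Bd R ρ m z :=
  h.trans (mul_le_mul_of_nonneg_right (pow_le_pow_right₀ (by linarith) hnm) hρ)

theorem add (hR : 2 ≤ R) (hρ : 0 ≤ ρ) (hz : Bd R ρ n z) (hw : Bd R ρ m w) :
    Bd R ρ (max n m + 1) (z + w) := by
  have h1 := hz.mono hR hρ (le_max_left n m)
  have h2 := hw.mono hR hρ (le_max_right n m)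
  unfold Bd at *
  have h3 : 0 ≤ R ^ max n m * ρ := by positivity
  calc _ ≤ ‖z‖ + ‖w‖ := norm_add_le _ _
    _ ≤ R * (R ^ max n m * ρ) := by nlinarith
    _ = _ := by ring

theorem neg (hz : Bd R ρ n z) : Bd R ρ n (-z) := by
  unfold Bd at *
  rwa [norm_neg]

theorem sub (hR : 2 ≤ R) (hρ : 0 ≤ ρ) (hz : Bd R ρ n z) (hw : Bd R ρ m w) :
    Bd R ρ (max n m + 1) (z - w) := by
  rw [sub_eq_add_neg]
  exact hz.add hR hρ hw.neg

theorem mul (hR : 2 ≤ R) (hc : Bd R 1 m c) (hz : Bd R ρ n z) : Bd R ρ (m + n) (c * z) := by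
  unfold Bd at *
  rw [norm_mul]
  calc _ ≤ (R ^ m * 1) * (R ^ n * ρ) := by gcongr
    _ = _ := by ring

theorem of_mul {k : ℕ} (hc : 1 ≤ R ^ k * ‖c‖) (hz : Bd R ρ n (c * z)) (hR : 0 ≤ R) :
    Bd R ρ (n + k) z := by
  unfold Bd at *
  rw [norm_mul] at hz
  calc ‖z‖ = 1 * ‖z‖ := by ring
    _ ≤ (R ^ k * ‖c‖) * ‖z‖ := by gcongr
    _ = R ^ k * (‖c‖ * ‖z‖) := by ring
    _ ≤ R ^ k * (R ^ n * ρ) := by gcongr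
    _ = _ := by ring

theorem natCast (hR : 2 ≤ R) (k : ℕ) : Bd R 1 k (k : ℂ) := by
  unfold Bd
  rw [Complex.norm_natCast, mul_one]
  calc (k : ℝ) ≤ 2 ^ k := by exact_mod_cast Nat.lt_two_pow_self.le
    _ ≤ _ := by gcongr

theorem sum {ι : Type*} {s : Finset ι} {f : ι → ℂ} (hR : 2 ≤ R) (hρ : 0 ≤ ρ)
    (h : ∀ b ∈ s, Bd R ρ n (f b)) (hs : s.card ≤ 8) : Bd R ρ (n + 3) (∑ b ∈ s, f b) := by
  unfold Bd at *
  have h8 : (s.card : ℝ) ≤ R ^ 3 := by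
    calc (s.card : ℝ) ≤ 2 ^ 3 := by norm_num; exact_mod_cast hs
      _ ≤ _ := by gcongr
  calc _ ≤ ∑ b ∈ s, ‖f b‖ := norm_sum_le _ _
    _ ≤ ∑ b ∈ s, R ^ n * ρ := Finset.sum_le_sum h
    _ = s.card * (R ^ n * ρ) := by simp
    _ ≤ R ^ 3 * (R ^ n * ρ) := by gcongr
    _ = _ := by ring

theorem pow (hc : Bd R 1 m c) (k : ℕ) : Bd R 1 (m * k) (c ^ k) := by
  unfold Bd at *
  rw [norm_pow, pow_mul, mul_one]
  rw [mul_one] at hc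
  gcongr

theorem det {ι : Type*} [Fintype ι] [DecidableEq ι] {M : Matrix ι ι ℂ}
    (hR : 2 ≤ R) (hM : ∀ i j, Bd R 1 m (M i j)) (hι : Fintype.card ι ≤ 6) :
    Bd R 1 (10 + 6 * m) M.det := by
  unfold Bd at *
  have h := Matrix.det_le (A := M) (abv := NormedField.toAbsoluteValue ℂ) hM
  have hR1 : 1 ≤ R := by linarith
  have h1 : (Nat.factorial (Fintype.card ι) : ℝ) ≤ R ^ 10 := by
    calc (Nat.factorial (Fintype.card ι) : ℝ) ≤ (Nat.factorial 6 : ℕ) := by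
          exact_mod_cast Nat.factorial_le hι
      _ ≤ 2 ^ 10 := by norm_num [Nat.factorial]
      _ ≤ _ := by gcongr
  have h2 : (R ^ m * 1) ^ Fintype.card ι ≤ R ^ (6 * m) := by
    rw [mul_one, ← pow_mul]
    exact pow_le_pow_right₀ hR1 (by nlinarith)
  refine (show ‖M.det‖ ≤ _ from h).trans ?_
  rw [nsmul_eq_mul, mul_one (R ^ (_ + _)), pow_add]
  exact mul_le_mul h1 h2 (by positivity) (by positivity)

theorem adjugate {ι : Type*} [Fintype ι] [DecidableEq ι] {M : Matrix ι ι ℂ}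
    (hR : 2 ≤ R) (hM : ∀ i j, Bd R 1 m (M i j)) (hι : Fintype.card ι ≤ 6) (i j : ι) :
    Bd R 1 (10 + 6 * m) (M.adjugate i j) := by
  rw [Matrix.adjugate_apply]
  refine Bd.det hR (fun k l => ?_) hι
  by_cases hk : k = j
  · subst hk
    rw [Matrix.updateRow_self]
    have : ‖(Pi.single i (1 : ℂ) : ι → ℂ) l‖ ≤ 1 := by
      by_cases hl : l = i
      · subst hl; simp
      · simp [hl]
    unfold Bd
    rw [mul_one]
    exact this.trans (one_le_pow₀ (by linarith))
  · rw [Matrix.updateRow_ne hk]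
    exact hM k l

theorem of_mulVec {ι : Type*} [Fintype ι] [DecidableEq ι] {M : Matrix ι ι ℂ} {v : ι → ℂ}
    (hR : 2 ≤ R) (hρ : 0 ≤ ρ) (hM : ∀ i j, Bd R 1 m (M i j)) (hι : Fintype.card ι ≤ 6)
    {k : ℕ} (hdet : 1 ≤ R ^ k * ‖M.det‖) (hv : ∀ i, Bd R ρ n (M.mulVec v i)) (i : ι) :
    Bd R ρ (6 * m + n + 13 + k) (v i) := by
  have h1 : M.det * v i = ∑ j, M.adjugate i j * M.mulVec v j := by
    have : M.adjugate.mulVec (M.mulVec v) = M.det • v := by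
      rw [Matrix.mulVec_mulVec, Matrix.adjugate_mul, Matrix.smul_mulVec, Matrix.one_mulVec]
    have := congrFun this i
    simpa [Matrix.mulVec, dotProduct] using this.symm
  have h2 : Bd R ρ (10 + 6 * m + n + 3) (M.det * v i) := by
    rw [h1]
    exact Bd.sum hR hρ (fun j _ => Bd.mul hR (Bd.adjugate hR hM hι i j) (hv j))
      (by rw [Finset.card_univ]; omega)
  exact (Bd.of_mul hdet h2 (by linarith)).mono hR hρ (by omega)

end Bd

/-- The linear functional `p ⊗ q` on biquadratic polynomials with coefficients `D`. -/
def tensorFun (p q : Fin 3 → ℂ) (D : Fin 3 → Fin 3 → ℂ) : ℂ := ∑ a, ∑ b, p a * q b * D a b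

/-- Taylor coefficients at `x` of a quadratic polynomial. -/
def jetVec (x : ℂ) : Fin 3 → Fin 3 → ℂ := ![![1, x, x ^ 2], ![0, 1, 2 * x], ![0, 0, 1]]

/-- Taylor coefficients of order at most two, at `(x, y)`, of a biquadratic polynomial. -/
def jet (x y : ℂ) (D : Fin 3 → Fin 3 → ℂ) : Fin 3 × Fin 3 → ℂ := fun ij =>
  if ij.1.1 + ij.2.1 ≤ 2 then tensorFun (jetVec x ij.1) (jetVec y ij.2) D else 0

/-- The polarised values of a quadratic polynomial at `(x₀, x₀)`, `(x₀, x₁)`, `(x₁, x₁)`. -/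
noncomputable def polVec (x₀ x₁ : ℂ) : Fin 3 → Fin 3 → ℂ :=
  ![![1, x₀, x₀ ^ 2], ![1, (x₀ + x₁) / 2, x₀ * x₁], ![1, x₁, x₁ ^ 2]]

/-- Polarised values of a biquadratic polynomial. -/
noncomputable def pol (x₀ x₁ y₀ y₁ : ℂ) (D : Fin 3 → Fin 3 → ℂ) (i k : Fin 3) : ℂ :=
  tensorFun (polVec x₀ x₁ i) (polVec y₀ y₁ k) D

/-- The polarised values of weight zero. -/
noncomputable def polMid (x₀ x₁ y₀ y₁ : ℂ) (D : Fin 3 → Fin 3 → ℂ) : Fin 3 → ℂ :=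
  ![pol x₀ x₁ y₀ y₁ D 0 2, 2 * pol x₀ x₁ y₀ y₁ D 1 1, pol x₀ x₁ y₀ y₁ D 2 0]

/-- The polarised values of nonzero weight. -/
noncomputable def polOff (x₀ x₁ y₀ y₁ : ℂ) (D : Fin 3 → Fin 3 → ℂ) : Fin 6 → ℂ :=
  ![pol x₀ x₁ y₀ y₁ D 2 2, 2 * pol x₀ x₁ y₀ y₁ D 1 2, 2 * pol x₀ x₁ y₀ y₁ D 2 1,
    2 * pol x₀ x₁ y₀ y₁ D 1 0, 2 * pol x₀ x₁ y₀ y₁ D 0 1, pol x₀ x₁ y₀ y₁ D 0 0]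

/-- Coefficients, on the polarised values of weight zero, of the common functional of three jets. -/
def midVec {S : Type*} [CommRing S] (l m l' m' : S) : Fin 3 → S :=
  ![(l * m') ^ 2, -((m * l') * (l * m')), (m * l') ^ 2]

/-- The direction on which the jet at a third point and the values of weight zero vanish. -/
def offVec {S : Type*} [CommRing S] (l m l' m' : S) : Fin 6 → S :=
  ![l ^ 2 * l' ^ 2, -(l * m * l' ^ 2), -(l ^ 2 * l' * m'), l * m * m' ^ 2, m ^ 2 * l' * m',
    -(m ^ 2 * m' ^ 2)]

theorem tensorFun_sub (p q : Fin 3 → ℂ) (D D' : Fin 3 → Fin 3 → ℂ) :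
    tensorFun p q (D - D') = tensorFun p q D - tensorFun p q D' := by
  simp [tensorFun, mul_sub, Finset.sum_sub_distrib]

theorem jet_sub (x y : ℂ) (D D' : Fin 3 → Fin 3 → ℂ) :
    jet x y (D - D') = jet x y D - jet x y D' := by
  ext ij
  simp only [jet, Pi.sub_apply, tensorFun_sub]
  split_ifs <;> simp

theorem pol_sub (x₀ x₁ y₀ y₁ : ℂ) (D D' : Fin 3 → Fin 3 → ℂ) (i k : Fin 3) :
    pol x₀ x₁ y₀ y₁ (D - D') i k = pol x₀ x₁ y₀ y₁ D i k - pol x₀ x₁ y₀ y₁ D' i k :=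
  tensorFun_sub _ _ _ _

theorem polMid_sub (x₀ x₁ y₀ y₁ : ℂ) (D D' : Fin 3 → Fin 3 → ℂ) :
    polMid x₀ x₁ y₀ y₁ (D - D') = polMid x₀ x₁ y₀ y₁ D - polMid x₀ x₁ y₀ y₁ D' := by
  ext i
  fin_cases i <;> simp [polMid, pol_sub] <;> ring

theorem polOff_sub (x₀ x₁ y₀ y₁ : ℂ) (D D' : Fin 3 → Fin 3 → ℂ) :
    polOff x₀ x₁ y₀ y₁ (D - D') = polOff x₀ x₁ y₀ y₁ D - polOff x₀ x₁ y₀ y₁ D' := by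
  ext i
  fin_cases i <;> simp [polOff, pol_sub] <;> ring

theorem pol_swap (x₀ x₁ y₀ y₁ : ℂ) (D : Fin 3 → Fin 3 → ℂ) (i k : Fin 3) :
    pol x₀ x₁ y₀ y₁ D i k = pol x₁ x₀ y₁ y₀ D i.rev k.rev := by
  fin_cases i <;> fin_cases k <;>
    simp [pol, tensorFun, polVec, Fin.sum_univ_three, Fin.rev] <;> ring

section
variable {R ρ : ℝ} {n : ℕ} {x₀ x₁ y₀ y₁ x y : ℂ} {D : Fin 3 → Fin 3 → ℂ}

theorem Bd.half {m : ℕ} {z : ℂ} (h : Bd R ρ m z) : Bd R ρ m (z / 2) := by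
  unfold Bd at *
  rw [norm_div, Complex.norm_ofNat]
  linarith [norm_nonneg z]

theorem bd_pol_of_jet_left (hR : 2 ≤ R) (hρ : 0 ≤ ρ) (hx : Bd R 1 2 (x₁ - x₀))
    (hy : Bd R 1 2 (y₁ - y₀)) (hJ : ∀ ij, Bd R ρ n (jet x₀ y₀ D ij)) {i k : Fin 3}
    (hik : i.1 + k.1 ≤ 2) : Bd R ρ (n + 8) (pol x₀ x₁ y₀ y₁ D i k) := by
  have h1 : (0 : ℝ) ≤ 1 := zero_le_one
  have hx2 := hx.half
  have hy2 := hy.half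
  have e00 : pol x₀ x₁ y₀ y₁ D 0 0 = jet x₀ y₀ D (0, 0) := by
    simp [pol, jet, tensorFun, polVec, jetVec, Fin.sum_univ_three]
  have e10 : pol x₀ x₁ y₀ y₁ D 1 0 =
      jet x₀ y₀ D (0, 0) + (x₁ - x₀) / 2 * jet x₀ y₀ D (1, 0) := by
    simp [pol, jet, tensorFun, polVec, jetVec, Fin.sum_univ_three]; ring
  have e01 : pol x₀ x₁ y₀ y₁ D 0 1 =
      jet x₀ y₀ D (0, 0) + (y₁ - y₀) / 2 * jet x₀ y₀ D (0, 1) := by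
    simp [pol, jet, tensorFun, polVec, jetVec, Fin.sum_univ_three]; ring
  have e20 : pol x₀ x₁ y₀ y₁ D 2 0 = jet x₀ y₀ D (0, 0) +
      ((x₁ - x₀) * jet x₀ y₀ D (1, 0) + (x₁ - x₀) * ((x₁ - x₀) * jet x₀ y₀ D (2, 0))) := by
    simp [pol, jet, tensorFun, polVec, jetVec, Fin.sum_univ_three]; ring
  have e02 : pol x₀ x₁ y₀ y₁ D 0 2 = jet x₀ y₀ D (0, 0) +
      ((y₁ - y₀) * jet x₀ y₀ D (0, 1) + (y₁ - y₀) * ((y₁ - y₀) * jet x₀ y₀ D (0, 2))) := by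
    simp [pol, jet, tensorFun, polVec, jetVec, Fin.sum_univ_three]; ring
  have e11 : pol x₀ x₁ y₀ y₁ D 1 1 = (jet x₀ y₀ D (0, 0) +
      (x₁ - x₀) / 2 * jet x₀ y₀ D (1, 0)) + ((y₁ - y₀) / 2 * jet x₀ y₀ D (0, 1) +
        (x₁ - x₀) / 2 * ((y₁ - y₀) / 2 * jet x₀ y₀ D (1, 1))) := by
    simp [pol, jet, tensorFun, polVec, jetVec, Fin.sum_univ_three]; ring
  fin_cases i <;> fin_cases k <;> simp only [Fin.zero_eta, Fin.mk_one, Fin.reduceFinMk] at * <;>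
    first | (exfalso; revert hik; decide) | skip
  · rw [e00]; exact (hJ _).mono hR hρ (by omega)
  · rw [e01]; exact ((hJ _).add hR hρ (hy2.mul hR (hJ _))).mono hR hρ (by omega)
  · rw [e02]
    exact ((hJ _).add hR hρ ((hy.mul hR (hJ _)).add hR hρ
      (hy.mul hR (hy.mul hR (hJ _))))).mono hR hρ (by omega)
  · rw [e10]; exact ((hJ _).add hR hρ (hx2.mul hR (hJ _))).mono hR hρ (by omega)
  · rw [e11]
    exact (((hJ _).add hR hρ (hx2.mul hR (hJ _))).add hR hρ ((hy2.mul hR (hJ _)).add hR hρ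
      (hx2.mul hR (hy2.mul hR (hJ _))))).mono hR hρ (by omega)
  · rw [e20]
    exact ((hJ _).add hR hρ ((hx.mul hR (hJ _)).add hR hρ
      (hx.mul hR (hx.mul hR (hJ _))))).mono hR hρ (by omega)

theorem bd_pol_of_jet_right (hR : 2 ≤ R) (hρ : 0 ≤ ρ) (hx : Bd R 1 2 (x₁ - x₀))
    (hy : Bd R 1 2 (y₁ - y₀)) (hJ : ∀ ij, Bd R ρ n (jet x₁ y₁ D ij)) {i k : Fin 3}
    (hik : 2 ≤ i.1 + k.1) : Bd R ρ (n + 8) (pol x₀ x₁ y₀ y₁ D i k) := by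
  rw [pol_swap]
  refine bd_pol_of_jet_left hR hρ (by simpa using hx.neg) (by simpa using hy.neg) hJ ?_
  simp only [Fin.val_rev]
  omega

theorem bd_of_polVec (hR : 2 ≤ R) (hρ : 0 ≤ ρ) (hx₀ : Bd R 1 1 x₀) (hx₁ : Bd R 1 1 x₁)
    (hx : 1 ≤ R * ‖x₁ - x₀‖) {v : Fin 3 → ℂ}
    (hv : ∀ i, Bd R ρ n ((Matrix.of (polVec x₀ x₁)).mulVec v i)) (i : Fin 3) :
    Bd R ρ (n + 29) (v i) := by
  have h1 : (0 : ℝ) ≤ 1 := zero_le_one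
  have hone : Bd R 1 0 1 := by simp [Bd]
  have hdet : 1 ≤ R ^ 4 * ‖(Matrix.of (polVec x₀ x₁)).det‖ := by
    have : (Matrix.of (polVec x₀ x₁)).det = (x₁ - x₀) ^ 3 / 2 := by
      rw [Matrix.det_fin_three]; simp [polVec]; ring
    rw [this, norm_div, norm_pow, Complex.norm_ofNat]
    have h3 : 1 ≤ (R * ‖x₁ - x₀‖) ^ 3 := one_le_pow₀ hx
    rw [mul_pow] at h3
    calc (1 : ℝ) ≤ R ^ 3 * ‖x₁ - x₀‖ ^ 3 * (R / 2) := by nlinarith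
      _ = _ := by ring
  refine (Bd.of_mulVec (m := 2) hR hρ (fun a b => ?_) (by simp) hdet hv i).mono hR hρ (by omega)
  have hxx := (hx₀.mul hR hx₁)
  fin_cases a <;> fin_cases b <;> simp only [Matrix.of_apply, polVec] <;>
    simp only [Fin.zero_eta, Fin.mk_one, Fin.reduceFinMk, Matrix.cons_val]
  · exact hone.mono hR h1 (by omega)
  · exact hx₀.mono hR h1 (by omega)
  · exact (hx₀.pow 2).mono hR h1 (by omega)
  · exact hone.mono hR h1 (by omega)
  · exact ((hx₀.add hR h1 hx₁).half).mono hR h1 (by omega)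
  · exact (hx₀.mul hR hx₁).mono hR h1 (by omega)
  · exact hone.mono hR h1 (by omega)
  · exact hx₁.mono hR h1 (by omega)
  · exact (hx₁.pow 2).mono hR h1 (by omega)

theorem bd_of_pol (hR : 2 ≤ R) (hρ : 0 ≤ ρ) (hx₀ : Bd R 1 1 x₀) (hx₁ : Bd R 1 1 x₁)
    (hy₀ : Bd R 1 1 y₀) (hy₁ : Bd R 1 1 y₁)
    (hx : 1 ≤ R * ‖x₁ - x₀‖) (hy : 1 ≤ R * ‖y₁ - y₀‖)
    (hm : ∀ i k, Bd R ρ n (pol x₀ x₁ y₀ y₁ D i k)) (a b : Fin 3) : Bd R ρ (n + 58) (D a b) := by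
  have h1 : ∀ k a, Bd R ρ (n + 29) ((Matrix.of (polVec y₀ y₁)).mulVec (D a) k) := by
    intro k
    refine bd_of_polVec hR hρ hx₀ hx₁ hx (v := fun a => (Matrix.of (polVec y₀ y₁)).mulVec (D a) k)
      fun i => ?_
    convert hm i k using 1
    simp only [Matrix.mulVec, dotProduct, pol, tensorFun, Finset.mul_sum, Matrix.of_apply, mul_assoc]
  exact bd_of_polVec hR hρ hy₀ hy₁ hy (fun k => h1 k a) b

theorem bd_of_jets (hR : 2 ≤ R) (hρ : 0 ≤ ρ) (hx₀ : Bd R 1 1 x₀) (hx₁ : Bd R 1 1 x₁)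
    (hy₀ : Bd R 1 1 y₀) (hy₁ : Bd R 1 1 y₁)
    (hx : 1 ≤ R * ‖x₁ - x₀‖) (hy : 1 ≤ R * ‖y₁ - y₀‖)
    (hJ₀ : ∀ ij, Bd R ρ n (jet x₀ y₀ D ij)) (hJ₁ : ∀ ij, Bd R ρ n (jet x₁ y₁ D ij))
    (a b : Fin 3) : Bd R ρ (n + 66) (D a b) := by
  have h1 : (0 : ℝ) ≤ 1 := zero_le_one
  refine bd_of_pol (n := n + 8) hR hρ hx₀ hx₁ hy₀ hy₁ hx hy (fun i k => ?_) a b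
  rcases le_total (i.1 + k.1) 2 with h | h
  · exact bd_pol_of_jet_left hR hρ (hx₁.sub hR h1 hx₀) (hy₁.sub hR h1 hy₀) hJ₀ h
  · exact bd_pol_of_jet_right hR hρ (hx₁.sub hR h1 hx₀) (hy₁.sub hR h1 hy₀) hJ₁ h

theorem bd_polMid_left (hR : 2 ≤ R) (hρ : 0 ≤ ρ) (hx : Bd R 1 2 (x₁ - x₀))
    (hy : Bd R 1 2 (y₁ - y₀)) (hJ : ∀ ij, Bd R ρ n (jet x₀ y₀ D ij)) (i : Fin 3) :
    Bd R ρ (n + 10) (polMid x₀ x₁ y₀ y₁ D i) := by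
  fin_cases i
  · exact (bd_pol_of_jet_left hR hρ hx hy hJ (i := 0) (k := 2) (by simp)).mono hR hρ (by omega)
  · have := (Bd.natCast hR 2).mul hR
      (bd_pol_of_jet_left hR hρ hx hy hJ (i := 1) (k := 1) (by simp))
    exact this.mono hR hρ (by omega)
  · exact (bd_pol_of_jet_left hR hρ hx hy hJ (i := 2) (k := 0) (by simp)).mono hR hρ (by omega)

theorem bd_polMid_right (hR : 2 ≤ R) (hρ : 0 ≤ ρ) (hx : Bd R 1 2 (x₁ - x₀))
    (hy : Bd R 1 2 (y₁ - y₀)) (hJ : ∀ ij, Bd R ρ n (jet x₁ y₁ D ij)) (i : Fin 3) :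
    Bd R ρ (n + 10) (polMid x₀ x₁ y₀ y₁ D i) := by
  fin_cases i
  · exact (bd_pol_of_jet_right hR hρ hx hy hJ (i := 0) (k := 2) (by simp)).mono hR hρ (by omega)
  · have := (Bd.natCast hR 2).mul hR
      (bd_pol_of_jet_right hR hρ hx hy hJ (i := 1) (k := 1) (by simp))
    exact this.mono hR hρ (by omega)
  · exact (bd_pol_of_jet_right hR hρ hx hy hJ (i := 2) (k := 0) (by simp)).mono hR hρ (by omega)

end

section
variable {R ρ : ℝ} {n : ℕ} {x₀ x₁ y₀ y₁ x y : ℂ} {D : Fin 3 → Fin 3 → ℂ}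

theorem Bd.congr {z w : ℂ} (h : Bd R ρ n z) (hzw : z = w) : Bd R ρ n w := hzw ▸ h

theorem bd_row (hR : 2 ≤ R) (hρ : 0 ≤ ρ) (hx₀ : Bd R 1 1 x₀) (hx₁ : Bd R 1 1 x₁)
    (hy₀ : Bd R 1 1 y₀) (hy₁ : Bd R 1 1 y₁) (hy : Bd R 1 1 y)
    (hJ : ∀ ij, Bd R ρ n (jet x y D ij)) (k : Fin 3) :
    Bd R ρ (n + 10) ((x₁ - x) ^ 2 * pol x₀ x₁ y₀ y₁ D 0 k +
      2 * ((x₁ - x) * (x - x₀)) * pol x₀ x₁ y₀ y₁ D 1 k +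
      (x - x₀) ^ 2 * pol x₀ x₁ y₀ y₁ D 2 k) := by
  have h1 : (0 : ℝ) ≤ 1 := zero_le_one
  have hh := hx₁.sub hR h1 hx₀
  have ha := hy₀.sub hR h1 hy
  have hb := hy₁.sub hR h1 hy
  have key : ∀ {a b : ℂ}, Bd R 1 3 a → Bd R 1 4 b → Bd R ρ (n + 10)
      ((x₁ - x₀) * ((x₁ - x₀) * (jet x y D (0, 0) +
        (a * jet x y D (0, 1) + b * jet x y D (0, 2))))) := fun ha hb =>
    (hh.mul hR (hh.mul hR ((hJ _).add hR hρ ((ha.mul hR (hJ _)).add hR hρ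
      (hb.mul hR (hJ _)))))).mono hR hρ (by omega)
  fin_cases k
  · convert key (ha.mono hR h1 (by omega)) (ha.mul hR ha) using 1
    simp [pol, jet, tensorFun, polVec, jetVec, Fin.sum_univ_three]; ring
  · convert key (a := (y₀ - y) / 2 + (y₁ - y) / 2)
      (ha.half.add hR h1 hb.half) (ha.mul hR hb) using 1
    simp [pol, jet, tensorFun, polVec, jetVec, Fin.sum_univ_three]; ring
  · convert key (hb.mono hR h1 (by omega)) (hb.mul hR hb) using 1
    simp [pol, jet, tensorFun, polVec, jetVec, Fin.sum_univ_three]; ring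

theorem bd_col (hR : 2 ≤ R) (hρ : 0 ≤ ρ) (hx₀ : Bd R 1 1 x₀) (hx₁ : Bd R 1 1 x₁)
    (hy₀ : Bd R 1 1 y₀) (hy₁ : Bd R 1 1 y₁) (hx : Bd R 1 1 x)
    (hJ : ∀ ij, Bd R ρ n (jet x y D ij)) (i : Fin 3) :
    Bd R ρ (n + 10) ((y₁ - y) ^ 2 * pol x₀ x₁ y₀ y₁ D i 0 +
      2 * ((y₁ - y) * (y - y₀)) * pol x₀ x₁ y₀ y₁ D i 1 +
      (y - y₀) ^ 2 * pol x₀ x₁ y₀ y₁ D i 2) := by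
  have e : ∀ i k, pol x₀ x₁ y₀ y₁ D i k = pol y₀ y₁ x₀ x₁ (fun a b => D b a) k i := by
    intro i k
    simp only [pol, tensorFun]
    rw [Finset.sum_comm]
    simp only [mul_comm]
  have hJ' : ∀ ij, Bd R ρ n (jet y x (fun a b => D b a) ij) := by
    intro ij
    convert hJ (ij.2, ij.1) using 1
    simp only [jet, tensorFun, add_comm]
    rw [Finset.sum_comm]
    simp only [mul_comm]
  simp only [e]
  exact bd_row hR hρ hy₀ hy₁ hx₀ hx₁ hx hJ' i

theorem bd_midVec (hR : 2 ≤ R) (hρ : 0 ≤ ρ) (hx₀ : Bd R 1 1 x₀) (hx₁ : Bd R 1 1 x₁)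
    (hy₀ : Bd R 1 1 y₀) (hy₁ : Bd R 1 1 y₁) (hx : Bd R 1 1 x) (hy : Bd R 1 1 y)
    (hJ : ∀ ij, Bd R ρ n (jet x y D ij)) :
    Bd R ρ (n + 20) (midVec (x₁ - x) (x - x₀) (y₁ - y) (y - y₀) ⬝ᵥ polMid x₀ x₁ y₀ y₁ D) := by
  have h1 : (0 : ℝ) ≤ 1 := zero_le_one
  have hh := hx₁.sub hR h1 hx₀
  have hh' := hy₁.sub hR h1 hy₀
  have hl := hx₁.sub hR h1 hx
  have hl' := hy₁.sub hR h1 hy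
  have ha := (hx₀.sub hR h1 hx).half
  have hb := (hy₀.sub hR h1 hy).half
  have hB : Bd R ρ (n + 10) ((x₁ - x₀) * ((y₁ - y₀) * ((jet x y D (0, 0) +
      (x₀ - x) / 2 * jet x y D (1, 0)) + ((y₀ - y) / 2 * jet x y D (0, 1) +
        (x₀ - x) / 2 * ((y₀ - y) / 2 * jet x y D (1, 1)))))) :=
    (hh.mul hR (hh'.mul hR (((hJ _).add hR hρ (ha.mul hR (hJ _))).add hR hρ
      ((hb.mul hR (hJ _)).add hR hρ (ha.mul hR (hb.mul hR (hJ _))))))).mono hR hρ (by omega)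
  have hr := bd_row hR hρ hx₀ hx₁ hy₀ hy₁ hy hJ 0
  have hc := bd_col hR hρ hx₀ hx₁ hy₀ hy₁ hx hJ 0
  have key := (((hl'.pow 2).mul hR hr).add hR hρ ((hl.pow 2).mul hR hc)).sub hR hρ
    ((Bd.natCast hR 2).mul hR (hl.mul hR (hl'.mul hR hB)))
  convert key.mono hR hρ (m := n + 20) (by omega) using 1
  simp [midVec, polMid, dotProduct, pol, jet, tensorFun, polVec, jetVec, Fin.sum_univ_three]
  ring

theorem bd_midVec_of_polMid (hR : 2 ≤ R) (hρ : 0 ≤ ρ) (hx₀ : Bd R 1 1 x₀) (hx₁ : Bd R 1 1 x₁)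
    (hy₀ : Bd R 1 1 y₀) (hy₁ : Bd R 1 1 y₁) (hx : Bd R 1 1 x) (hy : Bd R 1 1 y)
    (hL : ∀ i, Bd R ρ n (polMid x₀ x₁ y₀ y₁ D i)) :
    Bd R ρ (n + 20) (midVec (x₁ - x) (x - x₀) (y₁ - y) (y - y₀) ⬝ᵥ polMid x₀ x₁ y₀ y₁ D) := by
  have h1 : (0 : ℝ) ≤ 1 := zero_le_one
  have hl := hx₁.sub hR h1 hx
  have hl' := hy₁.sub hR h1 hy
  have hm := hx.sub hR h1 hx₀
  have hm' := hy.sub hR h1 hy₀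
  have key := ((((hl.mul hR hm').pow 2).mul hR (hL 0)).sub hR hρ
    (((hm.mul hR hl').mul hR (hl.mul hR hm')).mul hR (hL 1))).add hR hρ
    (((hm.mul hR hl').pow 2).mul hR (hL 2))
  convert key.mono hR hρ (m := n + 20) (by omega) using 1
  simp [midVec, dotProduct, Fin.sum_univ_three]
  ring

theorem bd_polOff (hR : 2 ≤ R) (hρ : 0 ≤ ρ) (hx₀ : Bd R 1 1 x₀) (hx₁ : Bd R 1 1 x₁)
    (hy₀ : Bd R 1 1 y₀) (hy₁ : Bd R 1 1 y₁) (hx : Bd R 1 1 x) (hy : Bd R 1 1 y)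
    (hl0 : 1 ≤ R * ‖x₁ - x‖) (hm0 : 1 ≤ R * ‖x - x₀‖) (hm0' : 1 ≤ R * ‖y - y₀‖)
    (hJ : ∀ ij, Bd R ρ n (jet x y D ij)) (hL : ∀ i, Bd R ρ n (polMid x₀ x₁ y₀ y₁ D i))
    (e : Fin 6) :
    Bd R ρ (n + 60) ((x₁ - x) ^ 2 * (y₁ - y) ^ 2 * polOff x₀ x₁ y₀ y₁ D e -
      polOff x₀ x₁ y₀ y₁ D 0 * offVec (x₁ - x) (x - x₀) (y₁ - y) (y - y₀) e) := by
  have h1 : (0 : ℝ) ≤ 1 := zero_le_one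
  have hR0 : 0 ≤ R := by linarith
  have hl := hx₁.sub hR h1 hx
  have hl' := hy₁.sub hR h1 hy
  have hm := hx.sub hR h1 hx₀
  have hm' := hy.sub hR h1 hy₀
  have hr := bd_row hR hρ hx₀ hx₁ hy₀ hy₁ hy hJ
  have hc := bd_col hR hρ hx₀ hx₁ hy₀ hy₁ hx hJ
  have hone : Bd R 1 0 1 := by simp [Bd]
  have h2 : Bd R 1 2 2 := by simpa using Bd.natCast hR 2
  have hL0 : Bd R ρ n (pol x₀ x₁ y₀ y₁ D 0 2) := hL 0
  have hL1 : Bd R ρ n (2 * pol x₀ x₁ y₀ y₁ D 1 1) := hL 1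
  have hL2 : Bd R ρ n (pol x₀ x₁ y₀ y₁ D 2 0) := hL 2
  set l := x₁ - x
  set m := x - x₀
  set l' := y₁ - y
  set m' := y - y₀
  set q := pol x₀ x₁ y₀ y₁ D
  have hr2 := hr 2
  have hc2 := hc 2
  have hr1 := hr 1
  have hc1 := hc 1
  have hr0 := hr 0
  have k1 : Bd R ρ (n + 12) (2 * l * q 1 2 + m * q 2 2) := by
    refine Bd.of_mul (k := 1) (n := n + 11) (c := m) (by simpa using hm0) ?_ hR0
    · convert (hr2.sub hR hρ ((hl.pow 2).mul hR hL0)).mono hR hρ (m := n + 11) (by omega) using 1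
      ring
  have k2 : Bd R ρ (n + 12) (2 * l' * q 2 1 + m' * q 2 2) := by
    refine Bd.of_mul (k := 1) (n := n + 11) (c := m') (by simpa using hm0') ?_ hR0
    · convert (hc2.sub hR hρ ((hl'.pow 2).mul hR hL2)).mono hR hρ (m := n + 11) (by omega) using 1
      ring
  have n01 : Bd R ρ (n + 20) (l ^ 2 * l' ^ 2 * q 0 1 - m ^ 2 * l' * m' * q 2 2 / 2) := by
    convert (((hl'.pow 2).mul hR (hr1.sub hR hρ ((hl.mul hR hm).mul hR hL1))).sub hR hρ
      ((hl'.mul hR (hm.pow 2)).half.mul hR k2)).mono hR hρ (m := n + 20) (by omega) using 1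
    ring
  have n10 : Bd R ρ (n + 20) (l ^ 2 * l' ^ 2 * q 1 0 - l * m * m' ^ 2 * q 2 2 / 2) := by
    convert (((hl.pow 2).mul hR (hc1.sub hR hρ ((hl'.mul hR hm').mul hR hL1))).sub hR hρ
      ((hl.mul hR (hm'.pow 2)).half.mul hR k1)).mono hR hρ (m := n + 20) (by omega) using 1
    ring
  have k3 : Bd R ρ (n + 12) (l * q 0 0 + 2 * m * q 1 0) := by
    refine Bd.of_mul (k := 1) (n := n + 11) (c := l) (by simpa using hl0) ?_ hR0
    · convert (hr0.sub hR hρ ((hm.pow 2).mul hR hL2)).mono hR hρ (m := n + 11) (by omega) using 1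
      ring
  have n00 : Bd R ρ (n + 30) (l ^ 2 * l' ^ 2 * q 0 0 + m ^ 2 * m' ^ 2 * q 2 2) := by
    refine Bd.of_mul (k := 1) (n := n + 29) (c := l) (by simpa using hl0) ?_ hR0
    · convert (((hl.mul hR hl').pow 2).mul hR k3 |>.sub hR hρ
        ((h2.mul hR hm).mul hR n10)).mono hR hρ (m := n + 29) (by omega) using 1
      ring
  fin_cases e
  · refine (show Bd R ρ n 0 by simp only [Bd, norm_zero]; positivity).mono hR hρ
      (m := n + 60) (by omega) |>.congr ?_
    simp [polOff, offVec]; ring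
  · refine ((hl.mul hR (hl'.pow 2)).mul hR k1).mono hR hρ (m := n + 60) (by omega) |>.congr ?_
    simp [polOff, offVec]; ring
  · refine (((hl.pow 2).mul hR hl').mul hR k2).mono hR hρ (m := n + 60) (by omega) |>.congr ?_
    simp [polOff, offVec]; ring
  · refine (h2.mul hR n10).mono hR hρ (m := n + 60) (by omega) |>.congr ?_
    simp [polOff, offVec]; ring
  · refine (h2.mul hR n01).mono hR hρ (m := n + 60) (by omega) |>.congr ?_
    simp [polOff, offVec]; ring
  · refine n00.mono hR hρ (m := n + 60) (by omega) |>.congr ?_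
    simp [polOff, offVec]; ring

end

/-- The matrix of off-weight directions at six points. -/
def offMat {S : Type*} [CommRing S] (x₀ x₁ y₀ y₁ : S) (x y : Fin 6 → S) :
    Matrix (Fin 6) (Fin 6) S :=
  Matrix.of fun e j => offVec (x₁ - x j) (x j - x₀) (y₁ - y j) (y j - y₀) e

/-- The matrix of weight-zero functionals at three points. -/
def midMat {S : Type*} [CommRing S] (x₀ x₁ y₀ y₁ : S) (x y : Fin 3 → S) :
    Matrix (Fin 3) (Fin 3) S :=
  Matrix.of fun j => midVec (x₁ - x j) (x j - x₀) (y₁ - y j) (y j - y₀)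

/-- Coordinates of the values of nonzero weight along the off-weight directions. -/
noncomputable def offCoord (x₀ x₁ y₀ y₁ : ℂ) (x y : Fin 6 → ℂ) (D : Fin 3 → Fin 3 → ℂ) :
    Fin 6 → ℂ :=
  (offMat x₀ x₁ y₀ y₁ x y).adjugate.mulVec (polOff x₀ x₁ y₀ y₁ D)

/-- Quantitative general position of two base points and six further points. -/
structure GenPos (R : ℝ) (x₀ x₁ y₀ y₁ : ℂ) (x y : Fin 6 → ℂ) : Prop where
  two_le : 2 ≤ R
  hx₀ : Bd R 1 1 x₀
  hx₁ : Bd R 1 1 x₁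
  hy₀ : Bd R 1 1 y₀
  hy₁ : Bd R 1 1 y₁
  hx : ∀ j, Bd R 1 1 (x j)
  hy : ∀ j, Bd R 1 1 (y j)
  base_x : 1 ≤ R * ‖x₁ - x₀‖
  base_y : 1 ≤ R * ‖y₁ - y₀‖
  left_x : ∀ j, 1 ≤ R * ‖x j - x₀‖
  left_y : ∀ j, 1 ≤ R * ‖y j - y₀‖
  right_x : ∀ j, 1 ≤ R * ‖x₁ - x j‖
  right_y : ∀ j, 1 ≤ R * ‖y₁ - y j‖
  mid₀ : 1 ≤ R * ‖(midMat x₀ x₁ y₀ y₁ (fun k => x (Fin.castAdd 3 k))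
    (fun k => y (Fin.castAdd 3 k))).det‖
  mid₁ : 1 ≤ R * ‖(midMat x₀ x₁ y₀ y₁ (fun k => x (Fin.natAdd 3 k))
    (fun k => y (Fin.natAdd 3 k))).det‖
  off : 1 ≤ R * ‖(offMat x₀ x₁ y₀ y₁ x y).det‖

section
variable {R ρ : ℝ} {n : ℕ} {x₀ x₁ y₀ y₁ : ℂ} {D : Fin 3 → Fin 3 → ℂ}

theorem offCoord_sub (x₀ x₁ y₀ y₁ : ℂ) (x y : Fin 6 → ℂ) (D D' : Fin 3 → Fin 3 → ℂ) :
    offCoord x₀ x₁ y₀ y₁ x y (D - D') =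
      offCoord x₀ x₁ y₀ y₁ x y D - offCoord x₀ x₁ y₀ y₁ x y D' := by
  simp only [offCoord, polOff_sub, Matrix.mulVec_sub]

theorem bd_polMid_of_midVec {x y : Fin 3 → ℂ} (hR : 2 ≤ R) (hρ : 0 ≤ ρ) (hx₀ : Bd R 1 1 x₀)
    (hx₁ : Bd R 1 1 x₁) (hy₀ : Bd R 1 1 y₀) (hy₁ : Bd R 1 1 y₁) (hx : ∀ j, Bd R 1 1 (x j))
    (hy : ∀ j, Bd R 1 1 (y j)) (hdet : 1 ≤ R * ‖(midMat x₀ x₁ y₀ y₁ x y).det‖)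
    (h : ∀ j, Bd R ρ n (midVec (x₁ - x j) (x j - x₀) (y₁ - y j) (y j - y₀) ⬝ᵥ
      polMid x₀ x₁ y₀ y₁ D)) (i : Fin 3) :
    Bd R ρ (n + 70) (polMid x₀ x₁ y₀ y₁ D i) := by
  have h1 : (0 : ℝ) ≤ 1 := zero_le_one
  refine (Bd.of_mulVec (m := 8) (k := 1) hR hρ (fun j b => ?_) (by simp) (by rwa [pow_one]) h
    i).mono hR hρ (by omega)
  have hl := hx₁.sub hR h1 (hx j)
  have hl' := hy₁.sub hR h1 (hy j)
  have hm := (hx j).sub hR h1 hx₀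
  have hm' := (hy j).sub hR h1 hy₀
  fin_cases b
  · exact (hl.mul hR hm').pow 2
  · exact ((hm.mul hR hl').mul hR (hl.mul hR hm')).neg
  · exact (hm.mul hR hl').pow 2

theorem GenPos.bd_offMat {x y : Fin 6 → ℂ} (hg : GenPos R x₀ x₁ y₀ y₁ x y) (e j : Fin 6) :
    Bd R 1 8 (offMat x₀ x₁ y₀ y₁ x y e j) := by
  have h1 : (0 : ℝ) ≤ 1 := zero_le_one
  have hR := hg.two_le
  have hl := hg.hx₁.sub hR h1 (hg.hx j)
  have hl' := hg.hy₁.sub hR h1 (hg.hy j)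
  have hm := (hg.hx j).sub hR h1 hg.hx₀
  have hm' := (hg.hy j).sub hR h1 hg.hy₀
  fin_cases e
  · exact (hl.pow 2).mul hR (hl'.pow 2)
  · exact ((hl.mul hR hm).mul hR (hl'.pow 2)).neg
  · exact (((hl.pow 2).mul hR hl').mul hR hm').neg
  · exact (hl.mul hR hm).mul hR (hm'.pow 2)
  · exact ((hm.pow 2).mul hR hl').mul hR hm'
  · exact ((hm.pow 2).mul hR (hm'.pow 2)).neg

theorem GenPos.bd_offCoord {x y : Fin 6 → ℂ} (hg : GenPos R x₀ x₁ y₀ y₁ x y) (hρ : 0 ≤ ρ)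
    {j : Fin 6} (hJ : ∀ ij, Bd R ρ n (jet (x j) (y j) D ij))
    (hL : ∀ i, Bd R ρ n (polMid x₀ x₁ y₀ y₁ D i)) {b : Fin 6} (hb : b ≠ j) :
    Bd R ρ (n + 125) (offCoord x₀ x₁ y₀ y₁ x y D b) := by
  have hR := hg.two_le
  have hR0 : 0 ≤ R := by linarith
  have h := bd_polOff hR hρ hg.hx₀ hg.hx₁ hg.hy₀ hg.hy₁ (hg.hx j) (hg.hy j) (hg.right_x j)
    (hg.left_x j) (hg.left_y j) hJ hL
  refine Bd.of_mul (k := 4) (n := n + 121) (c := (x₁ - x j) ^ 2 * (y₁ - y j) ^ 2) ?_ ?_ hR0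
  · rw [norm_mul, norm_pow, norm_pow]
    have h2 := one_le_pow₀ (n := 2) (hg.right_x j)
    have h3 := one_le_pow₀ (n := 2) (hg.right_y j)
    calc (1 : ℝ) ≤ (R * ‖x₁ - x j‖) ^ 2 * (R * ‖y₁ - y j‖) ^ 2 := one_le_mul_of_one_le_of_one_le h2 h3
      _ = _ := by ring
  · have e1 := congrFun (congrFun (Matrix.adjugate_mul (offMat x₀ x₁ y₀ y₁ x y)) b) j
    rw [Matrix.smul_apply, Matrix.one_apply_ne hb, smul_zero, Matrix.mul_apply] at e1
    have key := Bd.sum (s := Finset.univ) hR hρ (fun e _ => (Bd.adjugate hR hg.bd_offMat (by simp) b e).mul hR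
      (h e)) (by simp)
    refine (key.mono hR hρ (m := n + 121) (by omega)).congr ?_
    simp only [mul_sub, Finset.sum_sub_distrib, offCoord, Matrix.mulVec, dotProduct, Finset.mul_sum]
    have e2 : ∑ e, (offMat x₀ x₁ y₀ y₁ x y).adjugate b e * (polOff x₀ x₁ y₀ y₁ D 0 *
        offVec (x₁ - x j) (x j - x₀) (y₁ - y j) (y j - y₀) e) = 0 := by
      have : ∀ e, (offMat x₀ x₁ y₀ y₁ x y).adjugate b e * (polOff x₀ x₁ y₀ y₁ D 0 *
        offVec (x₁ - x j) (x j - x₀) (y₁ - y j) (y j - y₀) e) = polOff x₀ x₁ y₀ y₁ D 0 *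
        ((offMat x₀ x₁ y₀ y₁ x y).adjugate b e * offMat x₀ x₁ y₀ y₁ x y e j) := fun e => by
        rw [offMat, Matrix.of_apply]; ring
      simp only [this, ← Finset.mul_sum, e1, mul_zero]
    rw [e2, sub_zero]
    exact Finset.sum_congr rfl fun e _ => by ring

theorem GenPos.bd_of_offCoord {x y : Fin 6 → ℂ} (hg : GenPos R x₀ x₁ y₀ y₁ x y) (hρ : 0 ≤ ρ)
    (hL : ∀ i, Bd R ρ n (polMid x₀ x₁ y₀ y₁ D i))
    (hc : ∀ b, Bd R ρ n (offCoord x₀ x₁ y₀ y₁ x y D b)) (a b : Fin 3) :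
    Bd R ρ (n + 70) (D a b) := by
  have hR := hg.two_le
  have hR0 : 0 ≤ R := by linarith
  have hy : ∀ e, Bd R ρ (n + 12) (polOff x₀ x₁ y₀ y₁ D e) := by
    intro e
    refine Bd.of_mul (k := 1) (n := n + 11) (c := (offMat x₀ x₁ y₀ y₁ x y).det)
      (by simpa using hg.off) ?_ hR0
    have key := Bd.sum (s := Finset.univ) hR hρ (fun b _ => (hg.bd_offMat e b).mul hR (hc b)) (by simp)
    refine (key.mono hR hρ (m := n + 11) (by omega)).congr ?_
    have : (offMat x₀ x₁ y₀ y₁ x y).mulVec (offCoord x₀ x₁ y₀ y₁ x y D) =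
        (offMat x₀ x₁ y₀ y₁ x y).det • polOff x₀ x₁ y₀ y₁ D := by
      rw [offCoord, Matrix.mulVec_mulVec, Matrix.mul_adjugate, Matrix.smul_mulVec,
        Matrix.one_mulVec]
    simpa [Matrix.mulVec, dotProduct] using congrFun this e
  have hhalf : ∀ z : ℂ, 2 * z / 2 = z := fun z => by ring
  refine bd_of_pol (n := n + 12) hR hρ hg.hx₀ hg.hx₁ hg.hy₀ hg.hy₁ hg.base_x hg.base_y
    (fun i k => ?_) a b
  fin_cases i <;> fin_cases k
  · exact hy 5
  · exact (hy 4).half.congr (hhalf _)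
  · exact (hL 0).mono hR hρ (by omega)
  · exact (hy 3).half.congr (hhalf _)
  · exact ((hL 1).half.congr (hhalf _)).mono hR hρ (by omega)
  · exact (hy 1).half.congr (hhalf _)
  · exact (hL 2).mono hR hρ (by omega)
  · exact (hy 2).half.congr (hhalf _)
  · exact hy 0

end

/-- The square of side `δ` containing a complex number. -/
noncomputable def gridIdx (δ : ℝ) (z : ℂ) : ℤ × ℤ := (⌊z.re / δ⌋, ⌊z.im / δ⌋)

/-- Componentwise `gridIdx`. -/
noncomputable def gridVec {κ : Type*} (δ : ℝ) (v : κ → ℂ) : κ → ℤ × ℤ := fun k => gridIdx δ (v k)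

theorem abs_sub_le_of_floor_div_eq {δ a b : ℝ} (hδ : 0 < δ) (h : ⌊a / δ⌋ = ⌊b / δ⌋) :
    |a - b| ≤ δ := by
  have h1 := Int.abs_sub_lt_one_of_floor_eq_floor h
  rw [← sub_div, abs_div, abs_of_pos hδ, div_lt_one hδ] at h1
  exact h1.le

theorem norm_sub_le_of_gridIdx_eq {δ : ℝ} {z w : ℂ} (hδ : 0 < δ) (h : gridIdx δ z = gridIdx δ w) :
    ‖z - w‖ ≤ 2 * δ := by
  obtain ⟨h1, h2⟩ := Prod.ext_iff.mp h
  have h3 := abs_sub_le_of_floor_div_eq hδ h1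
  have h4 := abs_sub_le_of_floor_div_eq hδ h2
  calc ‖z - w‖ ≤ |(z - w).re| + |(z - w).im| := Complex.norm_le_abs_re_add_abs_im _
    _ ≤ _ := by simp only [Complex.sub_re, Complex.sub_im]; linarith

theorem floor_sub_floor_mem {δ Λ a b : ℝ} (hδ : 0 < δ) (h : |a - b| ≤ Λ * δ) :
    ⌊a / δ⌋ ∈ Finset.Icc (⌊b / δ⌋ - ⌊Λ + 1⌋) (⌊b / δ⌋ + ⌊Λ + 1⌋) := by
  have h1 : |a / δ - b / δ| ≤ Λ := by
    rw [← sub_div, abs_div, abs_of_pos hδ, div_le_iff₀ hδ]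
    exact h
  have h2 := abs_le.mp h1
  have e1 := Int.floor_le (a / δ)
  have e2 := Int.lt_floor_add_one (a / δ)
  have e3 := Int.floor_le (b / δ)
  have e4 := Int.lt_floor_add_one (b / δ)
  rw [Finset.mem_Icc]
  constructor
  · have : ⌊b / δ⌋ - ⌊a / δ⌋ ≤ ⌊Λ + 1⌋ := Int.le_floor.mpr (by push_cast; linarith)
    linarith
  · have : ⌊a / δ⌋ - ⌊b / δ⌋ ≤ ⌊Λ + 1⌋ := Int.le_floor.mpr (by push_cast; linarith)
    linarith

theorem card_Icc_floor_le {Λ : ℝ} (hΛ : 1 ≤ Λ) (m : ℤ) :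
    ((Finset.Icc (m - ⌊Λ + 1⌋) (m + ⌊Λ + 1⌋)).card : ℝ) ≤ 5 * Λ := by
  rw [Int.card_Icc]
  have h0 : 0 ≤ ⌊Λ + 1⌋ := Int.floor_nonneg.mpr (by linarith)
  have h1 := Int.floor_le (Λ + 1)
  have : (((m + ⌊Λ + 1⌋ + 1 - (m - ⌊Λ + 1⌋)).toNat : ℤ) : ℝ) = 2 * ⌊Λ + 1⌋ + 1 := by
    rw [Int.toNat_of_nonneg (by linarith)]
    push_cast
    ring
  rw [← Int.cast_natCast, this]
  linarith

theorem ApproxDet.mono {ι α β : Type*} {s : Finset ι} {K K' : ℝ} {X : ι → α} {Y : ι → β}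
    (h : ApproxDet s K X Y) (hK : K ≤ K') : ApproxDet s K' X Y := fun b hb => (h b hb).trans hK

theorem ApproxDet.of_eq {ι α β : Type*} {s : Finset ι} {K : ℝ} {X : ι → α} {Y : ι → β}
    (hK : 1 ≤ K) (h : ∀ b ∈ s, ∀ b' ∈ s, X b = X b' → Y b = Y b') : ApproxDet s K X Y := by
  intro b _
  refine le_trans ?_ hK
  norm_cast
  rw [Finset.card_le_one]
  simp only [Finset.mem_image, Finset.mem_filter]
  rintro _ ⟨c, ⟨hc, hcb⟩, rfl⟩ _ ⟨d, ⟨hd, hdb⟩, rfl⟩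
  exact h c hc d hd (hcb.trans hdb.symm)

theorem approxDet_gridVec {ι α κ : Type*} [Fintype κ] {s : Finset ι} {X : ι → α}
    {G : ι → κ → ℂ} {δ Λ : ℝ} (hδ : 0 < δ) (hΛ : 1 ≤ Λ)
    (h : ∀ b ∈ s, ∀ b' ∈ s, X b = X b' → ∀ k, ‖G b k - G b' k‖ ≤ Λ * δ) :
    ApproxDet s ((5 * Λ) ^ (2 * Fintype.card κ)) X (fun b => gridVec δ (G b)) := by
  intro b hb
  let I : ℝ → Finset ℤ := fun a => Finset.Icc (⌊a / δ⌋ - ⌊Λ + 1⌋) (⌊a / δ⌋ + ⌊Λ + 1⌋)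
  have hsub : (s.filter fun b' => X b' = X b).image (fun b => gridVec δ (G b)) ⊆
      Fintype.piFinset fun k => I (G b k).re ×ˢ I (G b k).im := by
    intro v hv
    simp only [Finset.mem_image, Finset.mem_filter] at hv
    obtain ⟨b', ⟨hb', hX⟩, rfl⟩ := hv
    rw [Fintype.mem_piFinset]
    intro k
    have hk := h b' hb' b hb hX k
    rw [Finset.mem_product]
    refine ⟨floor_sub_floor_mem hδ ?_, floor_sub_floor_mem hδ ?_⟩
    · rw [← Complex.sub_re]; exact (Complex.abs_re_le_norm _).trans hk
    · rw [← Complex.sub_im]; exact (Complex.abs_im_le_norm _).trans hk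
  have hcard : ((Fintype.piFinset fun k => I (G b k).re ×ˢ I (G b k).im).card : ℝ) ≤
      (5 * Λ) ^ (2 * Fintype.card κ) := by
    rw [Fintype.card_piFinset, pow_mul, ← Finset.card_univ, ← Finset.prod_const]
    push_cast
    refine Finset.prod_le_prod (fun _ _ => by positivity) fun k _ => ?_
    rw [Finset.card_product, pow_two]
    push_cast
    exact mul_le_mul (card_Icc_floor_le hΛ _) (card_Icc_floor_le hΛ _) (by positivity)
      (by positivity)
  refine le_trans (Nat.cast_le.mpr (Finset.card_le_card ?_)) hcard
  convert hsub

/-- `approxDet_gridVec` with a bound of the form used for configurations in general position. -/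
theorem approxDet_of_bd {ι α κ : Type*} [Fintype κ] {s : Finset ι} {X : ι → α}
    {G : ι → κ → ℂ} {δ R : ℝ} {n : ℕ} (hδ : 0 < δ) (hR : 2 ≤ R) (hκ : Fintype.card κ ≤ 6)
    (hn : n ≤ 150)
    (h : ∀ b ∈ s, ∀ b' ∈ s, X b = X b' → ∀ k, Bd R (2 * δ) n (G b k - G b' k)) :
    ApproxDet s (R ^ 2000) X (fun b => gridVec δ (G b)) := by
  have hR1 : 1 ≤ R := by linarith
  refine (approxDet_gridVec (Λ := R ^ (n + 1)) hδ (one_le_pow₀ hR1) fun b hb b' hb' hX k =>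
    (h b hb b' hb' hX k).trans ?_).mono ?_
  · rw [pow_succ]
    have : 0 ≤ R ^ n * δ := by positivity
    nlinarith
  · have h5 : 5 * R ^ (n + 1) ≤ R ^ (n + 4) := by
      have e : R ^ (n + 4) = R ^ 3 * R ^ (n + 1) := by ring
      rw [e]
      have : (2 : ℝ) ^ 3 ≤ R ^ 3 := by gcongr
      exact mul_le_mul_of_nonneg_right (by linarith) (by positivity)
    calc (5 * R ^ (n + 1)) ^ (2 * Fintype.card κ) ≤ (R ^ (n + 4)) ^ (2 * Fintype.card κ) := by
          gcongr
      _ = R ^ ((n + 4) * (2 * Fintype.card κ)) := (pow_mul _ _ _).symm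
      _ ≤ R ^ 2000 := pow_le_pow_right₀ hR1 (by nlinarith)

theorem approxDet_id {ι α : Type*} {s : Finset ι} {X : ι → α} {F : ι → Fin 3 → Fin 3 → ℂ}
    {δ R : ℝ} {n : ℕ} (hR : 2 ≤ R) (hδ : 0 < δ) (hn : n ≤ 100)
    (hsep : ∀ b ∈ s, ∀ ρ : ℝ, 1 ≤ ρ →
      ((s.filter fun b' => ∀ a c, ‖F b' a c - F b a c‖ ≤ ρ * δ).card : ℝ) ≤ (R * ρ) ^ 18)
    (h : ∀ b ∈ s, ∀ b' ∈ s, X b = X b' → ∀ a c, Bd R (2 * δ) n ((F b - F b') a c)) :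
    ApproxDet s (R ^ 2000) X (fun b => b) := by
  have hR1 : 1 ≤ R := by linarith
  intro b hb
  rw [Finset.image_id']
  have hsub : (s.filter fun b' => X b' = X b) ⊆
      s.filter fun b' => ∀ a c, ‖F b' a c - F b a c‖ ≤ R ^ (n + 1) * δ := by
    intro b' hb'
    rw [Finset.mem_filter] at hb' ⊢
    refine ⟨hb'.1, fun a c => (h b' hb'.1 b hb hb'.2 a c).trans ?_⟩
    rw [pow_succ]
    have : 0 ≤ R ^ n * δ := by positivity
    nlinarith
  calc _ ≤ _ := by exact_mod_cast Finset.card_le_card hsub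
    _ ≤ (R * R ^ (n + 1)) ^ 18 := hsep b hb _ (one_le_pow₀ hR1)
    _ = R ^ ((n + 2) * 18) := by rw [← pow_succ', ← pow_mul]
    _ ≤ _ := pow_le_pow_right₀ hR1 (by omega)

/-- Jets of biquadratic polynomials at eight points in general position distinguish the
polynomials as well as an eighth power of the cardinality would suggest. -/
theorem log_card_le_of_genPos {ι : Type*} {s : Finset ι} (hs : s.Nonempty)
    {F : ι → Fin 3 → Fin 3 → ℂ} {δ R : ℝ} {x₀ x₁ y₀ y₁ : ℂ} {x y : Fin 6 → ℂ}
    (hg : GenPos R x₀ x₁ y₀ y₁ x y) (hδ : 0 < δ)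
    (hsep : ∀ b ∈ s, ∀ ρ : ℝ, 1 ≤ ρ →
      ((s.filter fun b' => ∀ a c, ‖F b' a c - F b a c‖ ≤ ρ * δ).card : ℝ) ≤ (R * ρ) ^ 18)
    {n : ℝ} (h₀ : ((s.image fun b => gridVec δ (jet x₀ y₀ (F b))).card : ℝ) ≤ n)
    (h₁ : ((s.image fun b => gridVec δ (jet x₁ y₁ (F b))).card : ℝ) ≤ n)
    (h : ∀ j, ((s.image fun b => gridVec δ (jet (x j) (y j) (F b))).card : ℝ) ≤ n) :
    8 * Real.log s.card ≤ 12 * Real.log n + 40 * Real.log (R ^ 2000) := by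
  have hR := hg.two_le
  have h1 : (0 : ℝ) ≤ 1 := zero_le_one
  have hK : 1 ≤ R ^ 2000 := one_le_pow₀ (by linarith)
  have hρ : 0 ≤ 2 * δ := by linarith
  have hN : (0 : ℝ) < s.card := by exact_mod_cast hs.card_pos
  set K := R ^ 2000
  set V₀ : ι → _ := fun b => gridVec δ (jet x₀ y₀ (F b)) with hV₀
  set V₁ : ι → _ := fun b => gridVec δ (jet x₁ y₁ (F b)) with hV₁
  set V : Fin 6 → ι → _ := fun j b => gridVec δ (jet (x j) (y j) (F b)) with hV
  set L : ι → _ := fun b => gridVec δ (polMid x₀ x₁ y₀ y₁ (F b)) with hLdef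
  set ℓ : Fin 6 → ι → ℂ := fun j b => midVec (x₁ - x j) (x j - x₀) (y₁ - y j) (y j - y₀) ⬝ᵥ
    polMid x₀ x₁ y₀ y₁ (F b) with hℓ
  set Q : Fin 6 → ι → (Unit → ℤ × ℤ) := fun j b => gridVec δ (fun _ => ℓ j b) with hQ
  set c : Fin 6 → ι → ℤ × ℤ := fun k b => gridIdx δ (offCoord x₀ x₁ y₀ y₁ x y (F b) k) with hc
  have grid : ∀ {κ : Type} {v w : κ → ℂ}, gridVec δ v = gridVec δ w →
      ∀ k, Bd R (2 * δ) 0 (v k - w k) := fun h k => by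
    simpa [Bd] using norm_sub_le_of_gridIdx_eq hδ (congrFun h k)
  have jet' : ∀ {a d : ℂ} {b b' : ι}, gridVec δ (jet a d (F b)) = gridVec δ (jet a d (F b')) →
      ∀ ij, Bd R (2 * δ) 0 (jet a d (F b - F b') ij) := fun h ij => by
    rw [jet_sub]; exact grid h ij
  have mid' : ∀ {b b' : ι}, L b = L b' → ∀ i, Bd R (2 * δ) 0 (polMid x₀ x₁ y₀ y₁ (F b - F b') i) :=
    fun h i => by rw [polMid_sub]; exact grid h i
  have ell_sub : ∀ j b b', ℓ j b - ℓ j b' = midVec (x₁ - x j) (x j - x₀) (y₁ - y j) (y j - y₀) ⬝ᵥ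
      polMid x₀ x₁ y₀ y₁ (F b - F b') := fun j b b' => by
    rw [polMid_sub, dotProduct_sub]
  have hx := hg.hx₁.sub hR h1 hg.hx₀
  have hy := hg.hy₁.sub hR h1 hg.hy₀
  have sA : ent s (fun b => b) + ent s L ≤ ent s V₀ + ent s V₁ + 3 * (s.card * Real.log K) := by
    refine ent_submod_approx hs ?_ ?_ ?_
    · exact approxDet_id hR hδ (n := 66) (by norm_num) hsep fun b _ b' _ hb a c =>
        (bd_of_jets hR hρ hg.hx₀ hg.hx₁ hg.hy₀ hg.hy₁ hg.base_x hg.base_y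
          (jet' (Prod.ext_iff.mp hb).1) (jet' (Prod.ext_iff.mp hb).2) a c)
    · refine approxDet_of_bd hδ hR (by simp) (n := 10) (by norm_num) fun b _ b' _ hb k => ?_
      have := bd_polMid_left hR hρ hx hy (jet' hb) k
      rwa [polMid_sub] at this
    · refine approxDet_of_bd hδ hR (by simp) (n := 10) (by norm_num) fun b _ b' _ hb k => ?_
      have := bd_polMid_right hR hρ hx hy (jet' hb) k
      rwa [polMid_sub] at this
  have sB : ∀ j, ent s (fun b => (V j b, L b)) + ent s (Q j) ≤
      ent s (V j) + ent s L + 3 * (s.card * Real.log K) := by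
    intro j
    refine ent_submod_approx hs (ApproxDet.of_eq hK fun _ _ _ _ h => h) ?_ ?_
    · refine approxDet_of_bd hδ hR (by simp) (n := 20) (by norm_num) fun b _ b' _ hb _ => ?_
      rw [ell_sub]
      exact bd_midVec hR hρ hg.hx₀ hg.hx₁ hg.hy₀ hg.hy₁ (hg.hx j) (hg.hy j) (jet' hb)
    · refine approxDet_of_bd hδ hR (by simp) (n := 20) (by norm_num) fun b _ b' _ hb _ => ?_
      rw [ell_sub]
      exact bd_midVec_of_polMid hR hρ hg.hx₀ hg.hx₁ hg.hy₀ hg.hy₁ (hg.hx j) (hg.hy j) (mid' hb)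
  have sC : ∀ σ : Fin 3 → Fin 6,
      1 ≤ R * ‖(midMat x₀ x₁ y₀ y₁ (fun k => x (σ k)) (fun k => y (σ k))).det‖ →
      ent s L ≤ ent s (Q (σ 0)) + (ent s (Q (σ 1)) + ent s (Q (σ 2))) + s.card * Real.log K := by
    intro σ hσ
    have e1 := ent_prod_le_add hs (Q (σ 0)) (fun b => (Q (σ 1) b, Q (σ 2) b))
    have e2 := ent_prod_le_add hs (Q (σ 1)) (Q (σ 2))
    have e3 : ent s L ≤ ent s (fun b => (Q (σ 0) b, (Q (σ 1) b, Q (σ 2) b))) +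
        s.card * Real.log K := by
      refine ent_le_of_approxDet hs (approxDet_of_bd hδ hR (by simp) (n := 70) (by norm_num)
        fun b _ b' _ hb k => ?_)
      obtain ⟨hb0, hb12⟩ := Prod.ext_iff.mp hb
      obtain ⟨hb1, hb2⟩ := Prod.ext_iff.mp hb12
      have := bd_polMid_of_midVec (D := F b - F b') (n := 0) hR hρ hg.hx₀ hg.hx₁ hg.hy₀ hg.hy₁
        (fun j => hg.hx (σ j)) (fun j => hg.hy (σ j)) hσ (fun j => ?_) k
      · rwa [polMid_sub] at this
      · rw [← ell_sub]
        fin_cases j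
        · exact grid hb0 ()
        · exact grid hb1 ()
        · exact grid hb2 ()
    linarith
  have sD : ∀ j, ent s (fun b => (L b, fun k : {k : Fin 6 // k ≠ j} => c k.1 b)) ≤
      ent s (fun b => (V j b, L b)) + s.card * Real.log K := by
    intro j
    have e1 : ApproxDet s K (fun b => (V j b, L b)) (fun b => gridVec δ
        (fun k : {k : Fin 6 // k ≠ j} => offCoord x₀ x₁ y₀ y₁ x y (F b) k.1)) := by
      refine approxDet_of_bd hδ hR ((Fintype.card_subtype_le _).trans (by simp)) (n := 125)
        (by norm_num) fun b _ b' _ hb k => ?_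
      obtain ⟨hb1, hb2⟩ := Prod.ext_iff.mp hb
      have := hg.bd_offCoord hρ (jet' hb1) (mid' hb2) k.2
      rw [offCoord_sub] at this
      simpa using this
    refine (ent_mono hs fun b _ b' _ hb => ?_).trans (ent_prod_le hs e1)
    obtain ⟨hb1, hb2⟩ := Prod.ext_iff.mp hb
    exact Prod.ext (Prod.ext_iff.mp hb1).2 hb2
  have sE := ent_han hs c L
  have sF : ent s (fun b => b) ≤ ent s (fun b => (L b, fun k => c k b)) + s.card * Real.log K := by
    refine ent_le_of_approxDet hs (approxDet_id hR hδ (n := 70) (by norm_num) hsep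
      fun b _ b' _ hb a d => ?_)
    obtain ⟨hb1, hb2⟩ := Prod.ext_iff.mp hb
    have h2 : gridVec δ (offCoord x₀ x₁ y₀ y₁ x y (F b)) =
      gridVec δ (offCoord x₀ x₁ y₀ y₁ x y (F b')) := hb2
    refine hg.bd_of_offCoord hρ (mid' hb1) (fun k => ?_) a d
    rw [offCoord_sub]
    exact grid h2 k
  have img : ∀ {κ : Type} (X : ι → κ), ((s.image X).card : ℝ) ≤ n →
      ent s X ≤ s.card * Real.log n := fun X hX =>
    (ent_le_log_card_image hs X).trans (mul_le_mul_of_nonneg_left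
      (Real.log_le_log (by exact_mod_cast (hs.image X).card_pos) hX) hN.le)
  have i₀ := img V₀ (by convert h₀)
  have i₁ := img V₁ (by convert h₁)
  have iV := fun j => img (V j) (by convert h j)
  have hid := ent_id s
  have c0 : ent s L ≤ ent s (Q 0) + (ent s (Q 1) + ent s (Q 2)) + s.card * Real.log K :=
    sC (Fin.castAdd 3) hg.mid₀
  have c1 : ent s L ≤ ent s (Q 3) + (ent s (Q 4) + ent s (Q 5)) + s.card * Real.log K :=
    sC (Fin.natAdd 3) hg.mid₁
  have sumB := Finset.sum_le_sum fun j (_ : j ∈ Finset.univ) => sB j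
  have sumD := Finset.sum_le_sum fun j (_ : j ∈ Finset.univ) => sD j
  have sumV := Finset.sum_le_sum fun j (_ : j ∈ Finset.univ) => iV j
  have hQsum := Fin.sum_univ_six fun j => ent s (Q j)
  simp only [Finset.sum_add_distrib, Finset.sum_const, Finset.card_univ, Fintype.card_fin,
    nsmul_eq_mul] at sumB sumD sumV
  rw [hQsum] at sumB
  push_cast at sumB sumD sumV sE
  have hNlK : 0 ≤ s.card * Real.log K := mul_nonneg hN.le (Real.log_nonneg hK)
  have final : s.card * (8 * Real.log s.card) ≤
      s.card * (12 * Real.log n + 40 * Real.log K) := by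
    rw [mul_add, ← mul_assoc, mul_comm (s.card : ℝ) 8, ← mul_assoc, mul_comm (s.card : ℝ) 12,
      ← mul_assoc, mul_comm (s.card : ℝ) 40, mul_assoc, mul_assoc, mul_assoc, ← hid]
    linarith
  exact le_of_mul_le_mul_left final hN

theorem volume_polynomial_sublevel_le {q : Polynomial ℂ} {d : ℕ} (hd : q.natDegree ≤ d) {κ : ℝ}
    (hκ : 0 < κ) (hκ1 : κ ≤ 1) (hq : κ ^ (1 / 2 : ℝ) < ‖q.leadingCoeff‖) :
    volume {t : ℝ | ‖q.eval (t : ℂ)‖ ≤ κ} ≤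
      ENNReal.ofReal (2 * d * κ ^ (1 / (2 * (d + 1)) : ℝ)) := by
  set η : ℝ := κ ^ (1 / (2 * (d + 1)) : ℝ) with hη
  have hη0 : 0 < η := Real.rpow_pos_of_pos hκ _
  have hη1 : η ≤ 1 := Real.rpow_le_one hκ.le hκ1 (by positivity)
  have hcard : q.roots.card ≤ d := (Polynomial.card_roots' q).trans hd
  have hsub : {t : ℝ | ‖q.eval (t : ℂ)‖ ≤ κ} ⊆
      ⋃ r ∈ q.roots.toFinset, Set.Icc (r.re - η) (r.re + η) := by
    intro t ht
    by_contra hnot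
    simp only [Set.mem_iUnion, not_exists, Multiset.mem_toFinset] at hnot
    have hfar : ∀ r ∈ q.roots, η ≤ ‖(t : ℂ) - r‖ := by
      intro r hr
      by_contra hlt
      push Not at hlt
      have h1 := (Complex.abs_re_le_norm ((t : ℂ) - r)).trans hlt.le
      rw [Complex.sub_re, Complex.ofReal_re, abs_le] at h1
      exact hnot r hr ⟨by linarith, by linarith⟩
    have hprod : η ^ d ≤ ‖(q.roots.map fun r => (t : ℂ) - r).prod‖ := by
      have e : ‖(q.roots.map fun r => (t : ℂ) - r).prod‖ =
          (q.roots.map fun r => ‖(t : ℂ) - r‖).prod := by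
        refine Multiset.induction_on q.roots (by simp) fun a m ih => ?_
        simp only [Multiset.map_cons, Multiset.prod_cons, norm_mul, ih]
      rw [e]
      calc η ^ d ≤ η ^ q.roots.card := pow_le_pow_of_le_one hη0.le hη1 hcard
        _ = (q.roots.map fun _ => η).prod := by simp
        _ ≤ _ := Multiset.prod_map_le_prod_map₀ _ _ (fun _ _ => hη0.le) hfar
    have hηd : κ ^ (1 / 2 : ℝ) ≤ η ^ d := by
      rw [hη, ← Real.rpow_natCast, ← Real.rpow_mul hκ.le]
      refine Real.rpow_le_rpow_of_exponent_ge hκ hκ1 ?_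
      rw [div_mul_eq_mul_div, one_mul, div_le_div_iff₀ (by positivity) (by positivity)]
      linarith
    have hlt : κ < ‖q.eval (t : ℂ)‖ := by
      rw [(IsAlgClosed.splits q).eval_eq_prod_roots, norm_mul]
      have hs : 0 < κ ^ (1 / 2 : ℝ) := Real.rpow_pos_of_pos hκ _
      calc κ = κ ^ (1 / 2 : ℝ) * κ ^ (1 / 2 : ℝ) := by
            rw [← Real.rpow_add hκ]; norm_num
        _ < ‖q.leadingCoeff‖ * κ ^ (1 / 2 : ℝ) := mul_lt_mul_of_pos_right hq hs
        _ ≤ _ := mul_le_mul_of_nonneg_left (hηd.trans hprod) (norm_nonneg _)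
    exact absurd ht (not_le.mpr hlt)
  calc _ ≤ _ := measure_mono hsub
    _ ≤ ∑ r ∈ q.roots.toFinset, volume (Set.Icc (r.re - η) (r.re + η)) :=
      measure_biUnion_finset_le _ _
    _ = ∑ r ∈ q.roots.toFinset, ENNReal.ofReal (2 * η) := by
      refine Finset.sum_congr rfl fun r _ => ?_
      rw [Real.volume_Icc]
      ring_nf
    _ = ENNReal.ofReal (q.roots.toFinset.card * (2 * η)) := by
      rw [Finset.sum_const, nsmul_eq_mul,
        ENNReal.ofReal_mul (p := (q.roots.toFinset.card : ℝ)) (by positivity),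
        ENNReal.ofReal_natCast]
    _ ≤ _ := by
      refine ENNReal.ofReal_le_ofReal ?_
      have : (q.roots.toFinset.card : ℝ) ≤ d := by
        exact_mod_cast (Multiset.toFinset_card_le _).trans hcard
      nlinarith

/-- Sublevel sets of a nonzero polynomial have polynomially small volume in the unit cube. -/
theorem exists_volume_sublevel_le {n : ℕ} {P : MvPolynomial (Fin n) ℂ} (hP : P ≠ 0) :
    ∃ C c : ℝ, 0 < C ∧ 0 < c ∧ ∀ κ : ℝ, 0 < κ → κ ≤ 1 →
      volume {x : Fin n → ℝ | (∀ k, |x k| ≤ 1) ∧ ‖MvPolynomial.eval (fun k => (x k : ℂ)) P‖ ≤ κ} ≤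
        ENNReal.ofReal (C * κ ^ c) := by
  induction n with
  | zero =>
    obtain ⟨a, rfl⟩ := MvPolynomial.C_surjective (Fin 0) P
    have ha : 0 < ‖a‖ := norm_pos_iff.mpr fun h => hP (by simp [h])
    refine ⟨1 / ‖a‖, 1, by positivity, one_pos, fun κ hκ hκ1 => ?_⟩
    by_cases h : ‖a‖ ≤ κ
    · calc _ ≤ volume (Set.univ : Set (Fin 0 → ℝ)) := measure_mono (Set.subset_univ _)
        _ = ENNReal.ofReal 1 := by simp [volume_pi]
        _ ≤ _ := ENNReal.ofReal_le_ofReal (by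
          rw [Real.rpow_one, div_mul_eq_mul_div, one_mul, le_div_iff₀ ha]; linarith)
    · simp [h]
  | succ n ih =>
    set p := MvPolynomial.finSuccEquiv ℂ n P with hp
    have hp0 : p ≠ 0 := by simpa [hp] using hP
    obtain ⟨C, c, hC, hc, hbad⟩ := ih (P := p.leadingCoeff) (by simpa using hp0)
    set d := p.natDegree
    set e : ℝ := 1 / (2 * (d + 1)) with he
    have he0 : 0 < e := by positivity
    refine ⟨2 * C + 2 * d * 2 ^ n, min (c / 2) e, by positivity, by positivity,
      fun κ hκ hκ1 => ?_⟩
    set S := {x : Fin (n + 1) → ℝ | (∀ k, |x k| ≤ 1) ∧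
      ‖MvPolynomial.eval (fun k => (x k : ℂ)) P‖ ≤ κ} with hS
    set Bad := {x : Fin n → ℝ | (∀ k, |x k| ≤ 1) ∧
      ‖MvPolynomial.eval (fun k => (x k : ℂ)) p.leadingCoeff‖ ≤ κ ^ (1 / 2 : ℝ)} with hBad
    set Box : Set (Fin n → ℝ) := Set.Icc (fun _ => -1) (fun _ => 1) with hBox
    have hclosed : ∀ {m : ℕ} (Q : MvPolynomial (Fin m) ℂ) (a : ℝ),
        MeasurableSet {x : Fin m → ℝ | (∀ k, |x k| ≤ 1) ∧
          ‖MvPolynomial.eval (fun k => (x k : ℂ)) Q‖ ≤ a} := by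
      intro m Q a
      refine IsClosed.measurableSet (IsClosed.and ?_ ?_)
      · have : {x : Fin m → ℝ | ∀ k, |x k| ≤ 1} = ⋂ k, {x : Fin m → ℝ | |x k| ≤ 1} := by
          ext x
          simp
        exact this ▸ isClosed_iInter fun k => isClosed_le (by fun_prop) continuous_const
      · refine isClosed_le (((MvPolynomial.continuous_eval Q).comp ?_).norm) continuous_const
        fun_prop
    set E := MeasurableEquiv.piFinSuccAbove (fun _ : Fin (n + 1) => ℝ) 0
    have hE : MeasurePreserving E.symm volume volume :=
      (volume_preserving_piFinSuccAbove (fun _ : Fin (n + 1) => ℝ) 0).symm E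
    have hSm : MeasurableSet S := hclosed P κ
    have hslice : ∀ x : Fin n → ℝ, volume ((fun t : ℝ => (t, x)) ⁻¹' (E.symm ⁻¹' S)) ≤
        Bad.indicator (fun _ => ENNReal.ofReal 2) x +
          Box.indicator (fun _ => ENNReal.ofReal (2 * d * κ ^ e)) x := by
      intro x
      have hmem : ∀ t : ℝ, t ∈ (fun t : ℝ => (t, x)) ⁻¹' (E.symm ⁻¹' S) ↔
          (|t| ≤ 1 ∧ ∀ k, |x k| ≤ 1) ∧ ‖(p.map (MvPolynomial.eval fun k => (x k : ℂ))).eval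
            (t : ℂ)‖ ≤ κ := by
        intro t
        have e1 : E.symm (t, x) = (Fin.cons t x : Fin (n + 1) → ℝ) := Fin.insertNth_zero' t x
        have e2 : (fun k => ((Fin.cons t x : Fin (n + 1) → ℝ) k : ℂ)) =
            (Fin.cons (t : ℂ) (fun k => (x k : ℂ)) : Fin (n + 1) → ℂ) := by
          funext k
          refine Fin.cases ?_ (fun k => ?_) k <;> simp
        rw [Set.mem_preimage, Set.mem_preimage, e1, hS, Set.mem_ofPred_eq, e2,
          MvPolynomial.eval_eq_eval_mv_eval', Fin.forall_fin_succ]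
        simp [hp]
      by_cases hx : ∀ k, |x k| ≤ 1
      · by_cases hb : ‖MvPolynomial.eval (fun k => (x k : ℂ)) p.leadingCoeff‖ ≤ κ ^ (1 / 2 : ℝ)
        · rw [Set.indicator_of_mem (show x ∈ Bad from ⟨hx, hb⟩)]
          refine le_trans ?_ le_self_add
          calc _ ≤ volume (Set.Icc (-1 : ℝ) 1) := measure_mono fun t ht =>
                abs_le.mp ((hmem t).mp ht).1.1
            _ = _ := by rw [Real.volume_Icc]; norm_num
        · rw [Set.indicator_of_mem (s := Box)
            (show x ∈ Box from ⟨fun k => (abs_le.mp (hx k)).1, fun k => (abs_le.mp (hx k)).2⟩)]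
          refine le_trans ?_ le_add_self
          push Not at hb
          have hne : MvPolynomial.eval (fun k => (x k : ℂ)) p.leadingCoeff ≠ 0 := by
            intro h0
            rw [h0, norm_zero] at hb
            exact absurd hb (not_lt.mpr (Real.rpow_nonneg hκ.le _))
          refine (measure_mono fun t ht => ((hmem t).mp ht).2).trans
            (volume_polynomial_sublevel_le Polynomial.natDegree_map_le hκ hκ1 ?_)
          rwa [Polynomial.leadingCoeff_map_of_leadingCoeff_ne_zero _ hne]
      · have : (fun t : ℝ => (t, x)) ⁻¹' (E.symm ⁻¹' S) = ∅ :=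
          Set.eq_empty_of_forall_notMem fun t ht => hx ((hmem t).mp ht).1.2
        rw [this, measure_empty]
        exact zero_le
    have hκ2 : κ ^ (1 / 2 : ℝ) ≤ 1 := Real.rpow_le_one hκ.le hκ1 (by norm_num)
    have hbox : volume Box = ENNReal.ofReal (2 ^ n) := by
      rw [hBox, Real.volume_Icc_pi, Finset.prod_const, Finset.card_univ, Fintype.card_fin,
        ENNReal.ofReal_pow (by norm_num)]
      norm_num
    calc volume S = volume (E.symm ⁻¹' S) := (hE.measure_preimage hSm.nullMeasurableSet).symm
      _ = ∫⁻ x, volume ((fun t : ℝ => (t, x)) ⁻¹' (E.symm ⁻¹' S)) :=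
        Measure.prod_apply_symm (E.symm.measurable hSm)
      _ ≤ ∫⁻ x, (Bad.indicator (fun _ => ENNReal.ofReal 2) x +
          Box.indicator (fun _ => ENNReal.ofReal (2 * d * κ ^ e)) x) := lintegral_mono hslice
      _ = ENNReal.ofReal 2 * volume Bad + ENNReal.ofReal (2 * d * κ ^ e) * volume Box := by
        rw [lintegral_add_left (measurable_const.indicator (hclosed _ _)),
          lintegral_indicator_const (hclosed _ _), lintegral_indicator_const measurableSet_Icc]
      _ ≤ ENNReal.ofReal 2 * ENNReal.ofReal (C * (κ ^ (1 / 2 : ℝ)) ^ c) +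
          ENNReal.ofReal (2 * d * κ ^ e) * ENNReal.ofReal (2 ^ n) := by
        rw [hbox]
        gcongr
        exact hbad _ (Real.rpow_pos_of_pos hκ _) hκ2
      _ = ENNReal.ofReal (2 * (C * (κ ^ (1 / 2 : ℝ)) ^ c) + 2 * d * κ ^ e * 2 ^ n) := by
        rw [ENNReal.ofReal_add (by positivity) (by positivity),
          ENNReal.ofReal_mul (p := 2) (q := C * _) (by positivity),
          ENNReal.ofReal_mul (p := 2 * d * κ ^ e) (by positivity)]
      _ ≤ _ := by
        refine ENNReal.ofReal_le_ofReal ?_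
        have h1 : (κ ^ (1 / 2 : ℝ)) ^ c ≤ κ ^ min (c / 2) e := by
          rw [← Real.rpow_mul hκ.le]
          exact Real.rpow_le_rpow_of_exponent_ge hκ hκ1 ((min_le_left _ _).trans (by linarith))
        have h2 : κ ^ e ≤ κ ^ min (c / 2) e :=
          Real.rpow_le_rpow_of_exponent_ge hκ hκ1 (min_le_right _ _)
        calc _ ≤ 2 * (C * κ ^ min (c / 2) e) + 2 * d * κ ^ min (c / 2) e * 2 ^ n := by gcongr
          _ = _ := by ring

/-- The first null coordinate of a point of the plane on which `f_X` is biquadratic. -/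
noncomputable def ptX {S : Type*} [CommRing S] [Algebra ℂ S] (i : Fin 2) (r s : S) : S :=
  if i = 0 then r else r + algebraMap ℂ S Complex.I * s

/-- The second null coordinate. -/
noncomputable def ptY {S : Type*} [CommRing S] [Algebra ℂ S] (i : Fin 2) (r s : S) : S :=
  if i = 0 then s else r - algebraMap ℂ S Complex.I * s

/-- The quantities that must not vanish for two base points and six further points to be in
general position. -/
def genFactor {S : Type*} [CommRing S] (x y : Fin 8 → S) :
    Fin 2 ⊕ (Fin 4 × Fin 6) ⊕ Fin 3 → S
  | .inl a => ![x 1 - x 0, y 1 - y 0] a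
  | .inr (.inl (a, j)) => ![x (Fin.natAdd 2 j) - x 0, y (Fin.natAdd 2 j) - y 0,
      x 1 - x (Fin.natAdd 2 j), y 1 - y (Fin.natAdd 2 j)] a
  | .inr (.inr a) => ![
      (midMat (x 0) (x 1) (y 0) (y 1) ![x 2, x 3, x 4] ![y 2, y 3, y 4]).det,
      (midMat (x 0) (x 1) (y 0) (y 1) ![x 5, x 6, x 7] ![y 5, y 6, y 7]).det,
      (offMat (x 0) (x 1) (y 0) (y 1) ![x 2, x 3, x 4, x 5, x 6, x 7]
        ![y 2, y 3, y 4, y 5, y 6, y 7]).det] a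

theorem map_genFactor {S T : Type*} [CommRing S] [CommRing T] (f : S →+* T) (x y : Fin 8 → S) (k) :
    f (genFactor x y k) = genFactor (fun j => f (x j)) (fun j => f (y j)) k := by
  rcases k with a | ⟨a, j⟩ | a
  · fin_cases a <;> simp [genFactor]
  · fin_cases a <;> simp [genFactor]
  · fin_cases a
    all_goals
      simp only [genFactor, Fin.zero_eta, Fin.mk_one, Fin.reduceFinMk, Matrix.cons_val,
        RingHom.map_det]
      congr 1
      ext e j
      fin_cases e <;> fin_cases j <;> simp [offMat, offVec, midMat, midVec]

theorem exists_genFactor_ne_zero (k) : ∃ x y : Fin 8 → ℂ, genFactor x y k ≠ 0 := by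
  rcases k with a | ⟨a, j⟩ | a
  · refine ⟨![0, 1, 0, 0, 0, 0, 0, 0], ![0, 1, 0, 0, 0, 0, 0, 0], ?_⟩
    fin_cases a <;> simp [genFactor]
  · refine ⟨![0, 2, 1, 1, 1, 1, 1, 1], ![0, 2, 1, 1, 1, 1, 1, 1], ?_⟩
    fin_cases a <;> fin_cases j <;> simp [genFactor, Fin.natAdd] <;> norm_num
  · fin_cases a
    · refine ⟨![0, 1, 0, 1, 2, 0, 0, 0], ![0, 1, 1, 0, 2, 0, 0, 0], ?_⟩
      simp [genFactor, midMat, midVec, Matrix.det_fin_three]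
      norm_num
    · refine ⟨![0, 1, 0, 0, 0, 0, 1, 2], ![0, 1, 0, 0, 0, 1, 0, 2], ?_⟩
      simp [genFactor, midMat, midVec, Matrix.det_fin_three]
      norm_num
    · refine ⟨![0, 1, 0, 2, 0, 2, 1, 1], ![0, 1, 0, 0, 2, 1, 2, 1], ?_⟩
      simp [genFactor, offMat, offVec, Matrix.det_succ_row_zero, Fin.sum_univ_succ,
        Fin.succAbove]
      norm_num

theorem genPos_of_genFactor {R : ℝ} (hR : 2 ≤ R) {x y : Fin 8 → ℂ} (hx : ∀ k, ‖x k‖ ≤ R)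
    (hy : ∀ k, ‖y k‖ ≤ R) (h : ∀ k, 1 ≤ R * ‖genFactor x y k‖) :
    GenPos R (x 0) (x 1) (y 0) (y 1) (fun j => x (Fin.natAdd 2 j))
      (fun j => y (Fin.natAdd 2 j)) := by
  have hb : ∀ z : ℂ, ‖z‖ ≤ R → Bd R 1 1 z := fun z hz => by
    unfold Bd
    linarith
  have e0 : ∀ z : Fin 8 → ℂ, (fun k => z (Fin.natAdd 2 (Fin.castAdd 3 k))) =
      ![z 2, z 3, z 4] := fun z => by
    funext k
    fin_cases k <;> rfl
  have e1 : ∀ z : Fin 8 → ℂ, (fun k => z (Fin.natAdd 2 (Fin.natAdd 3 k))) =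
      ![z 5, z 6, z 7] := fun z => by
    funext k
    fin_cases k <;> rfl
  have e2 : ∀ z : Fin 8 → ℂ, (fun k => z (Fin.natAdd 2 k)) =
      ![z 2, z 3, z 4, z 5, z 6, z 7] := fun z => by
    funext k
    fin_cases k <;> rfl
  exact {
    two_le := hR
    hx₀ := hb _ (hx _)
    hx₁ := hb _ (hx _)
    hy₀ := hb _ (hy _)
    hy₁ := hb _ (hy _)
    hx := fun j => hb _ (hx _)
    hy := fun j => hb _ (hy _)
    base_x := h (.inl 0)
    base_y := h (.inl 1)
    left_x := fun j => h (.inr (.inl (0, j)))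
    left_y := fun j => h (.inr (.inl (1, j)))
    right_x := fun j => h (.inr (.inl (2, j)))
    right_y := fun j => h (.inr (.inl (3, j)))
    mid₀ := by rw [e0 x, e0 y]; exact h (.inr (.inr 0))
    mid₁ := by rw [e1 x, e1 y]; exact h (.inr (.inr 1))
    off := by rw [e2 x, e2 y]; simpa only [genFactor, Matrix.cons_val] using h (.inr (.inr 2)) }

theorem map_ptX {S T : Type*} [CommRing S] [Algebra ℂ S] [CommRing T] [Algebra ℂ T] (i : Fin 2)
    (f : S →ₐ[ℂ] T) (r s : S) : f (ptX i r s) = ptX i (f r) (f s) := by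
  unfold ptX
  split_ifs <;> simp

theorem map_ptY {S T : Type*} [CommRing S] [Algebra ℂ S] [CommRing T] [Algebra ℂ T] (i : Fin 2)
    (f : S →ₐ[ℂ] T) (r s : S) : f (ptY i r s) = ptY i (f r) (f s) := by
  unfold ptY
  split_ifs <;> simp

theorem exists_pt_eq (i : Fin 2) (x y : ℂ) : ∃ r s : ℂ, ptX i r s = x ∧ ptY i r s = y := by
  by_cases h : i = 0
  · exact ⟨x, y, by simp [ptX, h], by simp [ptY, h]⟩
  · refine ⟨(x + y) / 2, -Complex.I * ((x - y) / 2), ?_, ?_⟩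
    · simp only [ptX, h, if_false, Algebra.algebraMap_self, RingHom.id_apply]
      linear_combination (-(x - y) / 2) * Complex.I_sq
    · simp only [ptY, h, if_false, Algebra.algebraMap_self, RingHom.id_apply]
      linear_combination ((x - y) / 2) * Complex.I_sq

theorem norm_ptX_le (i : Fin 2) {r s : ℝ} (hr : |r| ≤ 1) (hs : |s| ≤ 1) :
    ‖ptX i (r : ℂ) s‖ ≤ 2 := by
  unfold ptX
  split_ifs
  · rw [Complex.norm_real, Real.norm_eq_abs]; linarith
  · refine (norm_add_le _ _).trans ?_
    simp only [Algebra.algebraMap_self, RingHom.id_apply, norm_mul, Complex.norm_I,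
      Complex.norm_real, Real.norm_eq_abs]
    linarith

theorem norm_ptY_le (i : Fin 2) {r s : ℝ} (hr : |r| ≤ 1) (hs : |s| ≤ 1) :
    ‖ptY i (r : ℂ) s‖ ≤ 2 := by
  unfold ptY
  split_ifs
  · rw [Complex.norm_real, Real.norm_eq_abs]; linarith
  · refine (norm_sub_le _ _).trans ?_
    simp only [Algebra.algebraMap_self, RingHom.id_apply, norm_mul, Complex.norm_I,
      Complex.norm_real, Real.norm_eq_abs]
    linarith

/-- The family `genFactor` as polynomials in the parameters of the eight points. -/
noncomputable def genPoly (i : Fin 2) (k : Fin 2 ⊕ (Fin 4 × Fin 6) ⊕ Fin 3) :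
    MvPolynomial (Fin 8 ⊕ Fin 8) ℂ :=
  genFactor (fun j => ptX i (MvPolynomial.X (.inl j)) (MvPolynomial.X (.inr j)))
    (fun j => ptY i (MvPolynomial.X (.inl j)) (MvPolynomial.X (.inr j))) k

theorem eval_genPoly (i : Fin 2) (k) (z : Fin 8 ⊕ Fin 8 → ℂ) :
    MvPolynomial.eval z (genPoly i k) = genFactor (fun j => ptX i (z (.inl j)) (z (.inr j)))
      (fun j => ptY i (z (.inl j)) (z (.inr j))) k := by
  rw [genPoly, ← MvPolynomial.coe_aeval_eq_eval]
  refine (map_genFactor (MvPolynomial.aeval z : _ →ₐ[ℂ] ℂ).toRingHom _ _ k).trans ?_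
  simp only [AlgHom.toRingHom_eq_coe, RingHom.coe_coe, map_ptX, map_ptY, MvPolynomial.aeval_X]

theorem genPoly_ne_zero (i : Fin 2) (k) : genPoly i k ≠ 0 := by
  obtain ⟨x, y, hxy⟩ := exists_genFactor_ne_zero k
  choose r s hr hs using fun j => exists_pt_eq i (x j) (y j)
  intro h
  have h1 := eval_genPoly i k (Sum.elim r s)
  rw [h, map_zero] at h1
  simp only [Sum.elim_inl, Sum.elim_inr, hr, hs] at h1
  exact hxy h1.symm

theorem exists_volume_sublevel_prod_le {m : ℕ} {P : MvPolynomial (Fin m ⊕ Fin m) ℂ} (hP : P ≠ 0) :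
    ∃ C c : ℝ, 0 < C ∧ 0 < c ∧ ∀ κ : ℝ, 0 < κ → κ ≤ 1 →
      volume {v : Fin m → ℝ × ℝ | (∀ j, |(v j).1| ≤ 1 ∧ |(v j).2| ≤ 1) ∧
        ‖MvPolynomial.eval (Sum.elim (fun j => ((v j).1 : ℂ)) fun j => ((v j).2 : ℂ)) P‖ ≤ κ} ≤
        ENNReal.ofReal (C * κ ^ c) := by
  set e : Fin m ⊕ Fin m ≃ Fin (m + m) := finSumFinEquiv
  have hP' : MvPolynomial.rename e P ≠ 0 := fun h =>
    hP (MvPolynomial.rename_injective e e.injective (by rw [h, map_zero]))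
  obtain ⟨C, c, hC, hc, h⟩ := exists_volume_sublevel_le hP'
  refine ⟨C, c, hC, hc, fun κ hκ hκ1 => le_trans (le_of_eq ?_) (h κ hκ hκ1)⟩
  have m1 := volume_measurePreserving_arrowProdEquivProdArrow ℝ ℝ (Fin m)
  have m2 := (volume_measurePreserving_sumPiEquivProdPi (fun _ : Fin m ⊕ Fin m => ℝ)).symm
  have m3 := volume_measurePreserving_piCongrLeft (fun _ : Fin (m + m) => ℝ) e
  rw [← m3.measure_preimage_equiv, ← m2.measure_preimage_equiv]
  refine Eq.trans ?_ (m1.measure_preimage_equiv _)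
  congr 1
  ext v
  set w := MeasurableEquiv.piCongrLeft (fun _ : Fin (m + m) => ℝ) e
    ((MeasurableEquiv.sumPiEquivProdPi (fun _ : Fin m ⊕ Fin m => ℝ)).symm
      (MeasurableEquiv.arrowProdEquivProdArrow ℝ ℝ (Fin m) v)) with hw
  have hwe : ∀ k, w (e k) = Sum.elim (fun j => (v j).1) (fun j => (v j).2) k := by
    intro k
    rw [hw, MeasurableEquiv.coe_piCongrLeft, Equiv.piCongrLeft_apply_apply]
    cases k <;> rfl
  change _ ↔ (∀ k, |w k| ≤ 1) ∧ ‖MvPolynomial.eval (fun k => (w k : ℂ))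
    (MvPolynomial.rename e P)‖ ≤ κ
  rw [MvPolynomial.eval_rename, ← e.forall_congr_right, Set.mem_ofPred_eq]
  have e2 : (fun k => (w k : ℂ)) ∘ e =
      Sum.elim (fun j => ((v j).1 : ℂ)) fun j => ((v j).2 : ℂ) := by
    funext k
    rw [Function.comp_apply, hwe]
    cases k <;> rfl
  rw [e2]
  simp only [hwe, Sum.forall, Sum.elim_inl, Sum.elim_inr, forall_and]

/-- Eight points of the square are in quantitative general position off a small set. -/
theorem exists_volume_not_genPos_le (i : Fin 2) :
    ∃ C c : ℝ, 0 < C ∧ 0 < c ∧ ∀ κ : ℝ, 0 < κ → κ ≤ 1 / 2 →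
      volume {v : Fin 8 → ℝ × ℝ | (∀ j, |(v j).1| ≤ 1 ∧ |(v j).2| ≤ 1) ∧
        ¬ GenPos κ⁻¹ (ptX i ((v 0).1 : ℂ) (v 0).2) (ptX i ((v 1).1 : ℂ) (v 1).2)
          (ptY i ((v 0).1 : ℂ) (v 0).2) (ptY i ((v 1).1 : ℂ) (v 1).2)
          (fun j => ptX i ((v (Fin.natAdd 2 j)).1 : ℂ) (v (Fin.natAdd 2 j)).2)
          (fun j => ptY i ((v (Fin.natAdd 2 j)).1 : ℂ) (v (Fin.natAdd 2 j)).2)} ≤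
        ENNReal.ofReal (C * κ ^ c) := by
  choose C c hC hc h using fun k => exists_volume_sublevel_prod_le (genPoly_ne_zero i k)
  obtain ⟨c₀, hc₀, hcc⟩ : ∃ c₀ : ℝ, 0 < c₀ ∧ ∀ k, c₀ ≤ c k := by
    obtain ⟨k, hk⟩ := Finite.exists_min c
    exact ⟨c k, hc k, hk⟩
  refine ⟨∑ k, C k, c₀, Finset.sum_pos (fun k _ => hC k) Finset.univ_nonempty, hc₀,
    fun κ hκ hκ1 => ?_⟩
  set T := fun k => {v : Fin 8 → ℝ × ℝ | (∀ j, |(v j).1| ≤ 1 ∧ |(v j).2| ≤ 1) ∧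
        ‖MvPolynomial.eval (Sum.elim (fun j => ((v j).1 : ℂ)) fun j => ((v j).2 : ℂ))
          (genPoly i k)‖ ≤ κ}
  calc _ ≤ volume (⋃ k, T k) := by
        refine measure_mono fun v hv => ?_
        by_contra hnot
        refine hv.2 (genPos_of_genFactor
          (x := fun j => ptX i ((v j).1 : ℂ) (v j).2) (y := fun j => ptY i ((v j).1 : ℂ) (v j).2)
          ?_ (fun j => ?_) (fun j => ?_) fun k => ?_)
        · rw [le_inv_comm₀ two_pos hκ]; linarith
        · refine (norm_ptX_le i (hv.1 j).1 (hv.1 j).2).trans ?_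
          rw [le_inv_comm₀ two_pos hκ]; linarith
        · refine (norm_ptY_le i (hv.1 j).1 (hv.1 j).2).trans ?_
          rw [le_inv_comm₀ two_pos hκ]; linarith
        · have h1 : ¬ v ∈ T k := fun hk => hnot (Set.mem_iUnion.mpr ⟨k, hk⟩)
          have h2 : κ < ‖MvPolynomial.eval (Sum.elim (fun j => ((v j).1 : ℂ))
              fun j => ((v j).2 : ℂ)) (genPoly i k)‖ := by
            by_contra h3
            exact h1 ⟨hv.1, not_lt.mp h3⟩
          rw [eval_genPoly] at h2
          simp only [Sum.elim_inl, Sum.elim_inr] at h2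
          rw [inv_mul_eq_div, le_div_iff₀ hκ]
          linarith
    _ ≤ ∑ k, volume (T k) := measure_iUnion_fintype_le _ _
    _ ≤ ∑ k, ENNReal.ofReal (C k * κ ^ c₀) := by
        refine Finset.sum_le_sum fun k _ => (h k κ hκ (by linarith)).trans ?_
        refine ENNReal.ofReal_le_ofReal (mul_le_mul_of_nonneg_left ?_ (hC k).le)
        exact Real.rpow_le_rpow_of_exponent_ge hκ (by linarith) (hcc k)
    _ = _ := by
        rw [← ENNReal.ofReal_sum_of_nonneg fun k _ => mul_nonneg (hC k).le
          (Real.rpow_nonneg hκ.le _), Finset.sum_mul]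

theorem sum_indicator_one_eq_card {U ι : Type*} (T : Finset ι) (S : ι → Set U) (u : U) :
    ∑ x ∈ T, (S x).indicator (1 : U → ENNReal) u =
      ENNReal.ofReal ((T.filter fun x => u ∈ S x).card : ℝ) := by
  simp only [Set.indicator_apply, Pi.one_apply, Finset.sum_boole, ENNReal.ofReal_natCast]

/-- If every `u ∈ F` selects a proportion `θ` of a finite set, then some tuple outside a set of
small measure has a large common selection. -/
theorem exists_tuple_card_inter_ge {U ι : Type*} [MeasureSpace U]
    [SigmaFinite (volume : Measure U)] {T : Finset ι} (hT : T.Nonempty) {F : Set U}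
    (hF : MeasurableSet F) (hfin : volume F ≠ ⊤) (G : U → Finset ι)
    (hG : ∀ x ∈ T, MeasurableSet {u | u ∈ F ∧ x ∈ G u}) {θ : ℝ} (hθ : 0 < θ)
    (hcard : ∀ u ∈ F, θ * T.card ≤ ((T.filter fun x => x ∈ G u).card : ℝ))
    {Bad : Set (Fin 8 → U)}
    (hBad : volume Bad < ENNReal.ofReal (θ ^ 8 / 2 * (volume F).toReal ^ 8)) :
    ∃ v : Fin 8 → U, (∀ j, v j ∈ F) ∧ v ∉ Bad ∧
      θ ^ 8 / 2 * T.card ≤ ((T.filter fun x => ∀ j, x ∈ G (v j)).card : ℝ) := by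
  by_contra hnot
  push Not at hnot
  set V := (volume F).toReal with hV
  have hN : (0 : ℝ) < T.card := by exact_mod_cast hT.card_pos
  have hV0 : 0 ≤ V := ENNReal.toReal_nonneg
  have hθN : 0 ≤ θ * T.card := mul_nonneg hθ.le hN.le
  have hθ8 : 0 ≤ θ ^ 8 / 2 := by positivity
  set S : ι → Set U := fun x => {u | u ∈ F ∧ x ∈ G u} with hS
  have hSfin : ∀ x, volume (S x) ≠ ⊤ := fun x =>
    ne_top_of_le_ne_top hfin (measure_mono fun u hu => hu.1)
  have hFV : volume F = ENNReal.ofReal V := (ENNReal.ofReal_toReal hfin).symm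
  have hmean : θ * T.card * V ≤ ∑ x ∈ T, (volume (S x)).toReal := by
    rw [← ENNReal.toReal_sum fun x _ => hSfin x]
    refine (ENNReal.ofReal_le_iff_le_toReal (ENNReal.sum_ne_top.mpr fun x _ => hSfin x)).mp ?_
    calc ENNReal.ofReal (θ * T.card * V)
        = ∫⁻ u, F.indicator (fun _ => ENNReal.ofReal (θ * T.card)) u := by
          rw [lintegral_indicator_const hF, ENNReal.ofReal_mul hθN, hFV]
      _ ≤ ∫⁻ u, ∑ x ∈ T, (S x).indicator (1 : U → ENNReal) u := by
          refine lintegral_mono fun u => ?_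
          by_cases hu : u ∈ F
          · rw [Set.indicator_of_mem hu, sum_indicator_one_eq_card]
            refine ENNReal.ofReal_le_ofReal ((hcard u hu).trans (le_of_eq ?_))
            simp only [hS, Set.mem_ofPred_eq, hu, true_and]
          · rw [Set.indicator_of_notMem hu]
            exact zero_le
      _ = ∑ x ∈ T, volume (S x) := by
          rw [lintegral_finsetSum' _ fun x hx => (measurable_one.indicator (hG x hx)).aemeasurable]
          exact Finset.sum_congr rfl fun x hx => lintegral_indicator_one (hG x hx)
  have hpow : θ ^ 8 * T.card * V ^ 8 ≤ ∑ x ∈ T, (volume (S x)).toReal ^ 8 := by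
    refine le_trans ?_ (pow_sum_div_card_le_sum_pow (fun x _ => ENNReal.toReal_nonneg) 7)
    rw [le_div_iff₀ (pow_pos hN _)]
    calc _ = (θ * T.card * V) ^ 8 := by ring
      _ ≤ _ := pow_le_pow_left₀ (mul_nonneg hθN hV0) hmean 8
  have hprod : ∑ x ∈ T, (volume (S x)) ^ 8 ≤
      ENNReal.ofReal (θ ^ 8 / 2 * T.card * V ^ 8) + T.card * volume Bad := by
    have hpi : ∀ x ∈ T, MeasurableSet (Set.univ.pi fun _ : Fin 8 => S x) := fun x hx =>
      MeasurableSet.univ_pi fun _ => hG x hx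
    have hpiF : MeasurableSet (Set.univ.pi fun _ : Fin 8 => F) := MeasurableSet.univ_pi fun _ => hF
    have hmB := measurableSet_toMeasurable (volume : Measure (Fin 8 → U)) Bad
    calc ∑ x ∈ T, (volume (S x)) ^ 8
        = ∫⁻ v, ∑ x ∈ T, (Set.univ.pi fun _ : Fin 8 => S x).indicator 1 v := by
          rw [lintegral_finsetSum' _ fun x hx => (measurable_one.indicator (hpi x hx)).aemeasurable]
          refine Finset.sum_congr rfl fun x hx => ?_
          rw [lintegral_indicator_one (hpi x hx), volume_pi_pi]
          simp
      _ ≤ ∫⁻ v, ((Set.univ.pi fun _ : Fin 8 => F).indicator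
            (fun _ => ENNReal.ofReal (θ ^ 8 / 2 * T.card)) v +
            (toMeasurable volume Bad).indicator (fun _ => (T.card : ENNReal)) v) := by
          refine lintegral_mono fun v => ?_
          rw [sum_indicator_one_eq_card]
          by_cases hv : ∀ j, v j ∈ F
          · by_cases hb : v ∈ Bad
            · rw [Set.indicator_of_mem (subset_toMeasurable _ _ hb)]
              refine le_trans ?_ le_add_self
              rw [ENNReal.ofReal_natCast]
              exact_mod_cast Finset.card_filter_le _ _
            · rw [Set.indicator_of_mem (Set.mem_univ_pi.mpr hv)]
              refine le_trans (ENNReal.ofReal_le_ofReal ?_) le_self_add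
              refine le_trans (le_of_eq ?_) (hnot v hv hb).le
              simp only [Set.mem_univ_pi, hS, Set.mem_ofPred_eq, hv, true_and]
          · have : (T.filter fun x => v ∈ Set.univ.pi fun _ : Fin 8 => S x) = ∅ :=
              Finset.filter_eq_empty_iff.mpr fun x _ h => hv fun j => (Set.mem_univ_pi.mp h j).1
            rw [this]
            simp
      _ = _ := by
          rw [lintegral_add_left (measurable_const.indicator hpiF),
            lintegral_indicator_const hpiF, lintegral_indicator_const hmB, measure_toMeasurable,
            volume_pi_pi, ENNReal.ofReal_mul (p := θ ^ 8 / 2 * T.card) (mul_nonneg hθ8 hN.le),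
            ENNReal.ofReal_pow ENNReal.toReal_nonneg, ← hFV]
          simp
  have hlt : ENNReal.ofReal (θ ^ 8 / 2 * T.card * V ^ 8) + T.card * volume Bad <
      ENNReal.ofReal (θ ^ 8 * T.card * V ^ 8) := by
    have e : θ ^ 8 * T.card * V ^ 8 = θ ^ 8 / 2 * T.card * V ^ 8 +
      T.card * (θ ^ 8 / 2 * V ^ 8) := by ring
    rw [e, ENNReal.ofReal_add (mul_nonneg (mul_nonneg hθ8 hN.le) (pow_nonneg hV0 _))
      (mul_nonneg hN.le (mul_nonneg hθ8 (pow_nonneg hV0 _))),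
      ENNReal.ofReal_mul (p := (T.card : ℝ)) hN.le, ENNReal.ofReal_natCast]
    refine ENNReal.add_lt_add_left ENNReal.ofReal_ne_top ?_
    exact ENNReal.mul_lt_mul_right (by exact_mod_cast hT.card_pos.ne') (by simp) hBad
  refine absurd (hprod.trans_lt hlt) (not_lt.mpr ?_)
  calc _ ≤ ENNReal.ofReal (∑ x ∈ T, (volume (S x)).toReal ^ 8) := ENNReal.ofReal_le_ofReal hpow
    _ = ∑ x ∈ T, (volume (S x)) ^ 8 := by
      rw [ENNReal.ofReal_sum_of_nonneg fun x _ => by positivity]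
      refine Finset.sum_congr rfl fun x _ => ?_
      rw [ENNReal.ofReal_pow ENNReal.toReal_nonneg, ENNReal.ofReal_toReal (hSfin x)]

theorem mem_rSpace_iff (i : Fin 2) (X : M4) :
    X ∈ rSpace i ↔ X.trace = 0 ∧ X * Qmat i = Qmat i * Xᵀ := by
  have hQ : IsUnit (Qmat i).det := by
    fin_cases i
    · simp [Qmat, Matrix.det_succ_row_zero, Fin.sum_univ_succ, Fin.succAbove]
    · simp [Qmat, Matrix.det_succ_row_zero, Fin.sum_univ_succ, Fin.succAbove]
  have h : X ∈ rSpace i ↔ X.trace = 0 ∧ -(Qmat i * Xᵀ * (Qmat i)⁻¹) + X = 0 := Iff.rfl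
  rw [h, neg_add_eq_zero]
  refine and_congr_right fun _ => ⟨fun e => ?_, fun e => ?_⟩
  · conv_lhs => rw [← e]
    rw [Matrix.mul_assoc, Matrix.nonsing_inv_mul _ hQ, Matrix.mul_one]
  · rw [← e, Matrix.mul_assoc, Matrix.mul_nonsing_inv _ hQ, Matrix.mul_one]

/-- The elements of `rSpace i` in coordinates. -/
def rMat (i : Fin 2) (a b c d e f g h k : ℝ) : M4 :=
  if i = 0 then !![a, b, c, d; e, -a, f, -c; g, h, -a, -b; k, -g, -e, a]
  else !![a, b, c, d; e, f, g, -b; h, g, -2 * a - f, -c; k, -e, -h, a]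

theorem exists_rMat_eq {i : Fin 2} {X : M4} (hX : X ∈ rSpace i) :
    ∃ a b c d e f g h k, X = rMat i a b c d e f g h k := by
  obtain ⟨htr, hQ⟩ := (mem_rSpace_iff i X).mp hX
  have hQ' : ∀ p q, (X * Qmat i) p q = (Qmat i * Xᵀ) p q := fun p q => by rw [hQ]
  simp only [Matrix.trace, Matrix.diag, Fin.sum_univ_four] at htr
  fin_cases i
  · have h00 := hQ' 0 3
    have h01 := hQ' 0 1
    have h02 := hQ' 0 2
    have h12 := hQ' 1 2
    have h13 := hQ' 1 3
    have h23 := hQ' 2 3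
    simp [Qmat, Matrix.mul_apply, Fin.sum_univ_four] at h00 h01 h02 h12 h13 h23
    refine ⟨X 0 0, X 0 1, X 0 2, X 0 3, X 1 0, X 1 2, X 2 0, X 2 1, X 3 0, ?_⟩
    ext p q
    fin_cases p <;> fin_cases q <;> simp [rMat] <;> linarith
  · have h00 := hQ' 0 3
    have h01 := hQ' 0 1
    have h02 := hQ' 0 2
    have h12 := hQ' 1 2
    have h13 := hQ' 1 3
    have h23 := hQ' 2 3
    simp [Qmat, Matrix.mul_apply, Fin.sum_univ_four] at h00 h01 h02 h12 h13 h23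
    refine ⟨X 0 0, X 0 1, X 0 2, X 0 3, X 1 0, X 1 1, X 1 2, X 2 0, X 3 0, ?_⟩
    ext p q
    fin_cases p <;> fin_cases q <;> simp [rMat] <;> linarith

theorem uMat_mul_uMat_neg (i : Fin 2) (r s : ℝ) : uMat i r s * uMat i (-r) (-s) = 1 := by
  ext p q
  fin_cases i <;> fin_cases p <;> fin_cases q <;>
    simp [uMat, Matrix.mul_apply, Fin.sum_univ_four] <;> ring

theorem uMat_inv (i : Fin 2) (r s : ℝ) : (uMat i r s)⁻¹ = uMat i (-r) (-s) :=
  Matrix.inv_eq_right_inv (uMat_mul_uMat_neg i r s)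

theorem uMat_mul_Qmat (i : Fin 2) (r s : ℝ) :
    uMat i r s * Qmat i * (uMat i r s)ᵀ = Qmat i := by
  ext p q
  fin_cases i <;> fin_cases p <;> fin_cases q <;>
    simp [uMat, Qmat, Matrix.mul_apply, Fin.sum_univ_four] <;> ring

theorem Qmat_transpose (i : Fin 2) : (Qmat i)ᵀ = Qmat i := by
  ext p q
  fin_cases i <;> fin_cases p <;> fin_cases q <;> simp [Qmat]

theorem Adm_mem_rSpace {i : Fin 2} (r s : ℝ) {X : M4} (hX : X ∈ rSpace i) :
    Adm (uMat i r s) X ∈ rSpace i := by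
  rw [mem_rSpace_iff] at hX ⊢
  obtain ⟨htr, hQ⟩ := hX
  have h1 := uMat_mul_uMat_neg i r s
  have h2 : uMat i (-r) (-s) * uMat i r s = 1 := mul_eq_one_comm.mp h1
  unfold Adm
  rw [uMat_inv]
  refine ⟨by rw [Matrix.trace_mul_comm, ← Matrix.mul_assoc, h2, Matrix.one_mul, htr], ?_⟩
  have e : uMat i (-r) (-s) * Qmat i = Qmat i * (uMat i r s)ᵀ := by
    conv_lhs => rw [← uMat_mul_Qmat i r s]
    rw [← Matrix.mul_assoc, ← Matrix.mul_assoc, h2, Matrix.one_mul]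
  have e' : Qmat i * (uMat i (-r) (-s))ᵀ = uMat i r s * Qmat i := by
    simpa [Matrix.transpose_mul, Qmat_transpose] using congrArg Matrix.transpose e
  rw [Matrix.mul_assoc, e, Matrix.transpose_mul, Matrix.transpose_mul, ← Matrix.mul_assoc,
    ← Matrix.mul_assoc (Qmat i), e',
    Matrix.mul_assoc (uMat i r s) X, hQ]
  simp only [Matrix.mul_assoc]

/-- The coefficients of the biquadratic polynomial attached to an element of `rSpace i`. -/
noncomputable def coef (i : Fin 2) (X : M4) : Fin 3 → Fin 3 → ℂ :=
  if i = 0 then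
    ![![(X 0 3 : ℂ), -2 * (X 0 1 : ℂ), -(X 2 1 : ℂ)],
      ![-2 * (X 0 2 : ℂ), 4 * (X 0 0 : ℂ), 2 * (X 2 0 : ℂ)],
      ![-(X 1 2 : ℂ), 2 * (X 1 0 : ℂ), (X 3 0 : ℂ)]]
  else
    ![![⟨X 0 3, 0⟩, ⟨-X 0 1, -X 0 2⟩, ⟨(X 2 2 - X 1 1) / 4, -X 1 2 / 2⟩],
      ![⟨-X 0 1, X 0 2⟩, ⟨2 * X 0 0, 0⟩, ⟨X 1 0 / 2, X 2 0 / 2⟩],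
      ![⟨(X 2 2 - X 1 1) / 4, X 1 2 / 2⟩, ⟨X 1 0 / 2, -X 2 0 / 2⟩, ⟨X 3 0 / 4, 0⟩]]

theorem coef_sub (i : Fin 2) (X Y : M4) : coef i (X - Y) = coef i X - coef i Y := by
  funext a c
  fin_cases i <;> fin_cases a <;> fin_cases c <;> apply Complex.ext <;> simp [coef] <;> ring

set_option maxHeartbeats 4000000 in
theorem jet_coef_eq {i : Fin 2} {X : M4} (hX : X ∈ rSpace i) (r s : ℝ) {ab : Fin 3 × Fin 3}
    (hab : (ab.1 : ℕ) + ab.2 ≤ 2) :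
    jet (ptX i (r : ℂ) s) (ptY i (r : ℂ) s) (coef i X) ab =
      coef i (Adm (uMat i r s) X) ab.1 ab.2 := by
  obtain ⟨a, b, c, d, e, f, g, h, k, rfl⟩ := exists_rMat_eq hX
  obtain ⟨p, q⟩ := ab
  unfold Adm
  rw [uMat_inv, jet]
  fin_cases i <;> fin_cases p <;> fin_cases q <;> simp at hab <;> apply Complex.ext <;>
    simp [coef, rMat, uMat, tensorFun, jetVec, ptX, ptY, Matrix.mul_apply, Fin.sum_univ_four,
      Fin.sum_univ_three, pow_two] <;> ring

theorem abs_apply_le_mnorm (X : M4) (p q : Fin 4) : |X p q| ≤ mnorm X :=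
  le_ciSup (f := fun p : Fin 4 × Fin 4 => |X p.1 p.2|) (Set.finite_range _).bddAbove (p, q)

theorem mnorm_le_iff {X : M4} {t : ℝ} : mnorm X ≤ t ↔ ∀ p q, |X p q| ≤ t :=
  ⟨fun h p q => (abs_apply_le_mnorm X p q).trans h, fun h => ciSup_le fun p => h p.1 p.2⟩

theorem tinner_eq_sum (X Y : M4) : tinner X Y = ∑ p, ∑ q, X p q * Y p q := by
  simp [tinner, Matrix.trace, Matrix.mul_apply]

theorem tinner_sub_left (X X' Y : M4) : tinner (X - X') Y = tinner X Y - tinner X' Y := by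
  simp [tinner_eq_sum, sub_mul, Finset.sum_sub_distrib]

theorem abs_tinner_le {X Y : M4} {s t : ℝ} (hX : mnorm X ≤ s) (hY : mnorm Y ≤ t) :
    |tinner X Y| ≤ 16 * (s * t) := by
  rw [mnorm_le_iff] at hX hY
  have hs : 0 ≤ s := (abs_nonneg _).trans (hX 0 0)
  rw [tinner_eq_sum]
  calc _ ≤ ∑ p : Fin 4, ∑ q : Fin 4, s * t := by
        refine (Finset.abs_sum_le_sum_abs _ _).trans (Finset.sum_le_sum fun p _ => ?_)
        refine (Finset.abs_sum_le_sum_abs _ _).trans (Finset.sum_le_sum fun q _ => ?_)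
        rw [abs_mul]
        exact mul_le_mul (hX p q) (hY p q) (abs_nonneg _) hs
    _ = _ := by simp; ring

theorem mnorm_sq_le_tinner (X : M4) : mnorm X ^ 2 ≤ tinner X X := by
  have h : ∀ p q, X p q ^ 2 ≤ tinner X X := fun p q => by
    rw [tinner_eq_sum]
    refine le_trans ?_ (Finset.single_le_sum (f := fun p => ∑ q, X p q * X p q)
      (fun p _ => Finset.sum_nonneg fun q _ => mul_self_nonneg _) (Finset.mem_univ p))
    refine le_trans (le_of_eq ?_) (Finset.single_le_sum (f := fun q => X p q * X p q)
      (fun q _ => mul_self_nonneg _) (Finset.mem_univ q))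
    ring
  have h0 : 0 ≤ tinner X X := (sq_nonneg _).trans (h 0 0)
  have h1 : mnorm X ≤ Real.sqrt (tinner X X) :=
    mnorm_le_iff.mpr fun p q => Real.abs_le_sqrt (h p q)
  calc _ ≤ Real.sqrt (tinner X X) ^ 2 :=
        pow_le_pow_left₀ ((abs_nonneg _).trans (abs_apply_le_mnorm X 0 0)) h1 2
    _ = _ := Real.sq_sqrt h0

theorem mnorm_Adm_le (i : Fin 2) {r s t : ℝ} (hr : |r| ≤ 1) (hs : |s| ≤ 1) {X : M4}
    (hX : mnorm X ≤ t) : mnorm (Adm (uMat i r s) X) ≤ 16 * t := by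
  have hu : ∀ r s : ℝ, |r| ≤ 1 → |s| ≤ 1 → ∀ p q, |uMat i r s p q| ≤ 1 := by
    intro r s hr hs p q
    have h1 : |s * r| ≤ 1 := by
      rw [abs_mul]
      exact mul_le_one₀ hs (abs_nonneg _) hr
    have h2 : |(r ^ 2 + s ^ 2) / 2| ≤ 1 := by
      have := (sq_le_one_iff_abs_le_one r).mpr hr
      have := (sq_le_one_iff_abs_le_one s).mpr hs
      rw [abs_le]
      constructor <;> nlinarith
    fin_cases i <;> fin_cases p <;> fin_cases q <;> simp [uMat, -abs_mul] <;> assumption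
  rw [mnorm_le_iff] at hX ⊢
  have ht : 0 ≤ t := (abs_nonneg _).trans (hX 0 0)
  intro p q
  unfold Adm
  rw [uMat_inv, Matrix.mul_apply]
  calc _ ≤ ∑ m : Fin 4, 4 * t := by
        refine (Finset.abs_sum_le_sum_abs _ _).trans (Finset.sum_le_sum fun m _ => ?_)
        rw [abs_mul]
        have h1 : |(uMat i r s * X) p m| ≤ 4 * t := by
          rw [Matrix.mul_apply]
          calc _ ≤ ∑ l : Fin 4, t := by
                refine (Finset.abs_sum_le_sum_abs _ _).trans (Finset.sum_le_sum fun l _ => ?_)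
                rw [abs_mul]
                calc _ ≤ 1 * t := mul_le_mul (hu r s hr hs p l) (hX l m) (abs_nonneg _) zero_le_one
                  _ = t := one_mul t
            _ = 4 * t := by simp
        calc _ ≤ (4 * t) * 1 := mul_le_mul h1
              (hu _ _ (by rwa [abs_neg]) (by rwa [abs_neg]) m q) (abs_nonneg _) (by linarith)
          _ = 4 * t := mul_one _
    _ = 16 * t := by simp; ring


theorem rMat_mem (i : Fin 2) (a b c d e f g h k : ℝ) : rMat i a b c d e f g h k ∈ rSpace i := by
  rw [mem_rSpace_iff]
  fin_cases i
  · refine ⟨by simp [rMat, Matrix.trace, Fin.sum_univ_four], ?_⟩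
    simp only [Fin.zero_eta, rMat, Qmat, if_true]
    ext p q
    fin_cases p <;> fin_cases q <;> simp [Matrix.mul_apply, Fin.sum_univ_four, mul_comm]
  · refine ⟨by simp [rMat, Matrix.trace, Fin.sum_univ_four]; ring, ?_⟩
    simp only [Fin.mk_one, rMat, Qmat, one_ne_zero, if_false]
    ext p q
    fin_cases p <;> fin_cases q <;> simp [Matrix.mul_apply, Fin.sum_univ_four]

theorem mem_rUp_of_weight {i : Fin 2} {Y : M4} {μ : ℤ} (hY : Y ∈ rSpace i)
    (h : ∀ p q, ((![1, 0, 0, -1] : Fin 4 → ℝ) p - (![1, 0, 0, -1] : Fin 4 → ℝ) q - μ) * Y p q = 0)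
    (hμ : 0 ≤ μ) : Y ∈ rUp i 0 := by
  refine Submodule.mem_iSup_of_mem μ (Submodule.mem_iSup_of_mem hμ ⟨hY, ?_⟩)
  change aWt * Y - Y * aWt - (μ : ℝ) • Y = 0
  ext p q
  rw [Matrix.sub_apply, Matrix.sub_apply, aWt, Matrix.diagonal_mul, Matrix.mul_diagonal,
    Matrix.smul_apply, Matrix.zero_apply, smul_eq_mul]
  linear_combination h p q

theorem rUp_le_rSpace (i : Fin 2) (lam : ℤ) : rUp i lam ≤ rSpace i :=
  iSup₂_le fun _ _ => inf_le_left

theorem rMat_zero_mem_rUp (a b c d f h : ℝ) : rMat 0 a b c d 0 f 0 h 0 ∈ rUp 0 0 := by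
  have e : rMat 0 a b c d 0 f 0 h 0 =
      rMat 0 a 0 0 0 0 f 0 h 0 + rMat 0 0 b c 0 0 0 0 0 0 + rMat 0 0 0 0 d 0 0 0 0 0 := by
    simp [rMat]
  rw [e]
  refine add_mem (add_mem ?_ ?_) ?_
  · refine mem_rUp_of_weight (μ := 0) (rMat_mem ..) (fun p q => ?_) le_rfl
    fin_cases p <;> fin_cases q <;> simp [rMat]
  · refine mem_rUp_of_weight (μ := 1) (rMat_mem ..) (fun p q => ?_) zero_le_one
    fin_cases p <;> fin_cases q <;> simp [rMat]
  · refine mem_rUp_of_weight (μ := 2) (rMat_mem ..) (fun p q => ?_) zero_le_two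
    fin_cases p <;> fin_cases q <;> simp [rMat]; norm_num

theorem rMat_one_mem_rUp (a b c d f g : ℝ) : rMat 1 a b c d 0 f g 0 0 ∈ rUp 1 0 := by
  have e : rMat 1 a b c d 0 f g 0 0 =
      rMat 1 a 0 0 0 0 f g 0 0 + rMat 1 0 b c 0 0 0 0 0 0 + rMat 1 0 0 0 d 0 0 0 0 0 := by
    simp [rMat]
  rw [e]
  refine add_mem (add_mem ?_ ?_) ?_
  · refine mem_rUp_of_weight (μ := 0) (rMat_mem ..) (fun p q => ?_) le_rfl
    fin_cases p <;> fin_cases q <;> simp [rMat]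
  · refine mem_rUp_of_weight (μ := 1) (rMat_mem ..) (fun p q => ?_) zero_le_one
    fin_cases p <;> fin_cases q <;> simp [rMat]
  · refine mem_rUp_of_weight (μ := 2) (rMat_mem ..) (fun p q => ?_) zero_le_two
    fin_cases p <;> fin_cases q <;> simp [rMat]; norm_num

/-- The coefficients of order at most two only depend on the projection to `rUp i 0`. -/
theorem coef_eq_zero_of_orthogonal {i : Fin 2} {X : M4} (hX : X ∈ rSpace i)
    (h : ∀ Y ∈ rUp i 0, tinner X Y = 0) {a b : Fin 3} (hab : (a : ℕ) + b ≤ 2) :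
    coef i X a b = 0 := by
  obtain ⟨m, b', c, d, e, f, g, l, k, rfl⟩ := exists_rMat_eq hX
  obtain rfl | rfl : i = 0 ∨ i = 1 := by omega
  · have h1 := h _ (rMat_zero_mem_rUp m b' c d f l)
    simp [tinner_eq_sum, rMat, Fin.sum_univ_four] at h1
    obtain rfl : m = 0 := by nlinarith
    obtain rfl : b' = 0 := by nlinarith
    obtain rfl : c = 0 := by nlinarith
    obtain rfl : d = 0 := by nlinarith
    obtain rfl : f = 0 := by nlinarith
    obtain rfl : l = 0 := by nlinarith
    fin_cases a <;> fin_cases b <;> simp at hab <;> simp [coef, rMat]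
  · have h1 := h _ (rMat_one_mem_rUp m b' c d f g)
    simp [tinner_eq_sum, rMat, Fin.sum_univ_four] at h1
    obtain rfl : m = 0 := by nlinarith [mul_self_nonneg (-(2 * m) - f)]
    obtain rfl : b' = 0 := by nlinarith
    obtain rfl : c = 0 := by nlinarith
    obtain rfl : d = 0 := by nlinarith
    obtain rfl : f = 0 := by nlinarith
    obtain rfl : g = 0 := by nlinarith
    fin_cases a <;> fin_cases b <;> simp at hab <;> simp [coef, rMat, Complex.ext_iff]

theorem norm_coef_le {i : Fin 2} {X : M4} {t : ℝ} (hX : mnorm X ≤ t) (a b : Fin 3) :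
    ‖coef i X a b‖ ≤ 4 * t := by
  rw [mnorm_le_iff] at hX
  have ht : 0 ≤ t := (abs_nonneg _).trans (hX 0 0)
  refine (Complex.norm_le_abs_re_add_abs_im _).trans ?_
  obtain rfl | rfl : i = 0 ∨ i = 1 := by omega
  · have h1 : ∀ u : ℝ, |u| ≤ t → |u| ≤ 4 * t := fun u h => by linarith
    have h2 : ∀ u : ℝ, |u| ≤ t → 2 * |u| ≤ 4 * t := fun u h => by linarith
    have h4 : ∀ u : ℝ, |u| ≤ t → 4 * |u| ≤ 4 * t := fun u h => by linarith
    fin_cases a <;> fin_cases b <;> simp [coef, abs_mul, h1, h2, h4, hX]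
  · have h1 : ∀ u : ℝ, |u| ≤ t → |u| ≤ 4 * t := fun u h => by linarith
    have h2 : ∀ u : ℝ, |u| ≤ t → 2 * |u| ≤ 4 * t := fun u h => by linarith
    have h3 : ∀ u v : ℝ, |u| ≤ t → |v| ≤ t → |u| + |v| ≤ 4 * t := fun u v hu hv => by linarith
    have h4 : ∀ u v : ℝ, |u| ≤ t → |v| ≤ t → |u| / 2 + |v| / 2 ≤ 4 * t := fun u v hu hv => by
      linarith
    have h5 : ∀ u v w : ℝ, |u| ≤ t → |v| ≤ t → |w| ≤ t → |u - v| / 4 + |w| / 2 ≤ 4 * t :=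
      fun u v w hu hv hw => by linarith [abs_sub u v]
    have h6 : ∀ u : ℝ, |u| ≤ t → |u| / 4 ≤ 4 * t := fun u h => by linarith
    fin_cases a <;> fin_cases b <;>
      simp [coef, abs_mul, abs_div, h1, h2, h3, h4, h5, h6, hX]

/-- An element of `rSpace i` is controlled by its coefficients. -/
theorem mnorm_le_of_norm_coef_le {i : Fin 2} {X : M4} (hX : X ∈ rSpace i) {t : ℝ}
    (h : ∀ a b, ‖coef i X a b‖ ≤ t) : mnorm X ≤ 4 * t := by
  obtain ⟨a, b, c, d, e, f, g, l, k, rfl⟩ := exists_rMat_eq hX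
  have hre : ∀ a b, |(coef i _ a b).re| ≤ t := fun a b =>
    (Complex.abs_re_le_norm _).trans (h a b)
  have him : ∀ a b, |(coef i _ a b).im| ≤ t := fun a b =>
    (Complex.abs_im_le_norm _).trans (h a b)
  have ht : 0 ≤ t := (norm_nonneg _).trans (h 0 0)
  rw [mnorm_le_iff]
  have r00 := hre 0 0
  have r01 := hre 0 1
  have r11 := hre 1 1
  have r12 := hre 1 2
  have r22 := hre 2 2
  have r02 := hre 0 2
  obtain rfl | rfl : i = 0 ∨ i = 1 := by omega
  · have r10 := hre 1 0
    have r20 := hre 2 0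
    have r21 := hre 2 1
    simp [coef, rMat, abs_mul] at r00 r01 r02 r10 r11 r12 r20 r21 r22
    clear h hre him
    have ha : |a| ≤ 4 * t := by linarith
    have hb : |b| ≤ 4 * t := by linarith
    have hc : |c| ≤ 4 * t := by linarith
    have hd : |d| ≤ 4 * t := by linarith
    have he : |e| ≤ 4 * t := by linarith
    have hf : |f| ≤ 4 * t := by linarith
    have hg : |g| ≤ 4 * t := by linarith
    have hl : |l| ≤ 4 * t := by linarith
    have hk : |k| ≤ 4 * t := by linarith
    clear r00 r01 r02 r10 r11 r12 r20 r21 r22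
    intro p q
    fin_cases p <;> fin_cases q <;> simp [rMat] <;> assumption
  · have i01 := him 0 1
    have i02 := him 0 2
    have i12 := him 1 2
    simp [coef, rMat, abs_mul, abs_div] at r00 r01 r02 r11 r12 r22 i01 i02 i12
    clear h hre him
    have ha : |a| ≤ 4 * t := by linarith
    have hb : |b| ≤ 4 * t := by linarith
    have hc : |c| ≤ 4 * t := by linarith
    have hd : |d| ≤ 4 * t := by linarith
    have he : |e| ≤ 4 * t := by linarith
    have hg : |g| ≤ 4 * t := by linarith
    have hl : |l| ≤ 4 * t := by linarith
    have hk : |k| ≤ 4 * t := by linarith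
    have r02' : |-(2 * a) - f - f| ≤ 4 * t := by linarith
    rw [abs_le] at r02'
    have ra := abs_le.mp (show |a| ≤ t / 2 by linarith)
    have hf : |f| ≤ 4 * t := abs_le.mpr ⟨by linarith, by linarith⟩
    have hm : |-(2 * a) - f| ≤ 4 * t := abs_le.mpr ⟨by linarith, by linarith⟩
    clear r00 r01 r02 r11 r12 r22 i01 i02 i12 ra r02'
    intro p q
    fin_cases p <;> fin_cases q <;> simp [rMat] <;> assumption

theorem card_image_le_mul_of_approxDet {ι α β : Type*} [DecidableEq α] [DecidableEq β] {s : Finset ι} {K : ℝ} {X : ι → α}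
    {Y : ι → β} (h : ApproxDet s K X Y) :
    ((s.image Y).card : ℝ) ≤ K * (s.image X).card := by
  have hsub : s.image Y ⊆ (s.image X).biUnion fun v => (s.filter fun b => X b = v).image Y := by
    intro y hy
    obtain ⟨b, hb, rfl⟩ := Finset.mem_image.mp hy
    exact Finset.mem_biUnion.mpr ⟨X b, Finset.mem_image_of_mem X hb,
      Finset.mem_image_of_mem Y (Finset.mem_filter.mpr ⟨hb, rfl⟩)⟩
  calc ((s.image Y).card : ℝ)
      ≤ ∑ v ∈ s.image X, (((s.filter fun b => X b = v).image Y).card : ℝ) := by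
        exact_mod_cast (Finset.card_le_card hsub).trans Finset.card_biUnion_le
    _ ≤ ∑ v ∈ s.image X, K := by
        refine Finset.sum_le_sum fun v hv => ?_
        obtain ⟨b, hb, rfl⟩ := Finset.mem_image.mp hv
        exact le_trans (le_of_eq (by congr!)) (h b hb)
    _ = _ := by rw [Finset.sum_const, nsmul_eq_mul, mul_comm]

theorem finite_image_gridVec {ι κ : Type*} [Finite κ] {A : Set ι} {G : ι → κ → ℂ} {δ B : ℝ}
    (hδ : 0 < δ) (hB : ∀ x ∈ A, ∀ k, ‖G x k‖ ≤ B) : ((fun x => gridVec δ (G x)) '' A).Finite := by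
  have h : ∀ a : ℝ, |a| ≤ B → ⌊a / δ⌋ ∈ Set.Icc ⌊-B / δ⌋ ⌊B / δ⌋ := fun a ha => by
    obtain ⟨h1, h2⟩ := abs_le.mp ha
    exact ⟨Int.floor_le_floor (div_le_div_of_nonneg_right h1 hδ.le),
      Int.floor_le_floor (div_le_div_of_nonneg_right h2 hδ.le)⟩
  refine Set.Finite.subset (Set.Finite.pi' fun _ : κ =>
    (Set.finite_Icc ⌊-B / δ⌋ ⌊B / δ⌋).prod (Set.finite_Icc ⌊-B / δ⌋ ⌊B / δ⌋)) ?_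
  rintro _ ⟨x, hx, rfl⟩ k
  exact ⟨h _ ((Complex.abs_re_le_norm _).trans (hB x hx k)),
    h _ ((Complex.abs_im_le_norm _).trans (hB x hx k))⟩

/-- A set with bounded coordinates has a finite set of representatives for its grid cells. -/
theorem exists_finset_gridVec {ι κ : Type*} [Finite κ] {A : Set ι} {G : ι → κ → ℂ} {δ B : ℝ}
    (hδ : 0 < δ) (hB : ∀ x ∈ A, ∀ k, ‖G x k‖ ≤ B) :
    ∃ T : Finset ι, (T : Set ι) ⊆ A ∧ Set.InjOn (fun x => gridVec δ (G x)) T ∧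
      ∀ x ∈ A, ∃ y ∈ T, gridVec δ (G y) = gridVec δ (G x) := by
  obtain ⟨T, hTA, hT⟩ := Set.exists_subset_bijOn A (fun x => gridVec δ (G x))
  have hfin : T.Finite := Set.Finite.of_finite_image
    (hT.image_eq ▸ finite_image_gridVec hδ hB) hT.injOn
  refine ⟨hfin.toFinset, by simpa using hTA, by simpa using hT.injOn, fun x hx => ?_⟩
  obtain ⟨y, hy, e⟩ := hT.surjOn ⟨x, hx, rfl⟩
  exact ⟨y, by simpa using hy, e⟩

theorem mnorm_sub_le {X Y Z : M4} {s t : ℝ} (hX : mnorm (X - Z) ≤ s) (hY : mnorm (Y - Z) ≤ t) :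
    mnorm (X - Y) ≤ s + t := by
  rw [mnorm_le_iff] at hX hY ⊢
  intro p q
  have h1 := hX p q
  have h2 := hY p q
  rw [Matrix.sub_apply] at h1 h2 ⊢
  rw [abs_sub_comm] at h2
  calc _ = |(X p q - Z p q) + (Z p q - Y p q)| := by ring_nf
    _ ≤ _ := (abs_add_le _ _).trans (add_le_add h1 h2)

theorem covNum_le {δ : ℝ} {A : Set M4} {t : Finset M4} (h : ∀ x ∈ A, ∃ c ∈ t, mnorm (x - c) ≤ δ) :
    covNum δ A ≤ t.card := by
  refine Nat.sInf_le ⟨t, rfl, fun x hx => ?_⟩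
  obtain ⟨c, hc, hxc⟩ := h x hx
  exact Set.mem_biUnion hc hxc

theorem exists_cover {δ B : ℝ} (hδ : 0 < δ) {A : Set M4} (hA : ∀ x ∈ A, mnorm x ≤ B) :
    ∃ t : Finset M4, t.card = covNum δ A ∧ ∀ x ∈ A, ∃ c ∈ t, mnorm (x - c) ≤ δ := by
  have hne : {n : ℕ | ∃ t : Finset M4, t.card = n ∧
      A ⊆ ⋃ c ∈ t, {y : M4 | mnorm (y - c) ≤ δ}}.Nonempty := by
    obtain ⟨T, -, -, hT⟩ := exists_finset_gridVec (A := A)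
      (G := fun (x : M4) (k : Fin 4 × Fin 4) => (x k.1 k.2 : ℂ)) (half_pos hδ) (B := B)
      fun x hx k => by
        rw [Complex.norm_real]
        exact mnorm_le_iff.mp (hA x hx) _ _
    refine ⟨T.card, T, rfl, fun x hx => ?_⟩
    obtain ⟨y, hy, e⟩ := hT x hx
    refine Set.mem_biUnion hy (mnorm_le_iff.mpr fun p q => ?_)
    have h := norm_sub_le_of_gridIdx_eq (half_pos hδ) (congrFun e (p, q)).symm
    rw [← Complex.ofReal_sub, Complex.norm_real, Real.norm_eq_abs] at h
    rw [Matrix.sub_apply]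
    linarith
  obtain ⟨t, h1, h2⟩ := Nat.sInf_mem hne
  refine ⟨t, h1, fun x hx => ?_⟩
  obtain ⟨c, hc, h⟩ := Set.mem_iUnion₂.mp (h2 hx)
  exact ⟨c, hc, h⟩

/-- Quantities that vary slowly along `f` occupy few grid cells compared to the covering number. -/
theorem card_image_gridVec_le_mul_covNum {ι κ : Type*} [Fintype κ] {s : Finset ι} {f : ι → M4}
    {S : Set M4} {G : ι → κ → ℂ} {δ δ' Λ B : ℝ} (hδ : 0 < δ) (hδ' : 0 < δ') (hΛ : 1 ≤ Λ)
    (hS : ∀ y ∈ S, mnorm y ≤ B) (hf : ∀ x ∈ s, f x ∈ S)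
    (h : ∀ x ∈ s, ∀ y ∈ s, mnorm (f x - f y) ≤ 2 * δ → ∀ k, ‖G x k - G y k‖ ≤ Λ * δ') :
    ((s.image fun x => gridVec δ' (G x)).card : ℝ) ≤
      (5 * Λ) ^ (2 * Fintype.card κ) * covNum δ S := by
  obtain ⟨t, ht, hc⟩ := exists_cover hδ hS
  choose! c hct hcd using hc
  have hK : ApproxDet s ((5 * Λ) ^ (2 * Fintype.card κ)) (fun x => c (f x))
      fun x => gridVec δ' (G x) := by
    refine approxDet_gridVec hδ' hΛ fun x hx y hy e k => h x hx y hy ?_ k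
    have h1 := hcd _ (hf x hx)
    have h2 := hcd _ (hf y hy)
    rw [← show c (f x) = c (f y) from e] at h2
    exact (mnorm_sub_le h1 h2).trans (two_mul δ).ge
  refine (card_image_le_mul_of_approxDet hK).trans ?_
  rw [← ht]
  gcongr
  exact Finset.image_subset_iff.mpr fun x hx => hct _ (hf x hx)

theorem Adm_sub (g X Y : M4) : Adm g (X - Y) = Adm g X - Adm g Y := by
  simp [Adm, mul_sub, sub_mul]

/-- The coefficients as a single vector. -/
noncomputable def coefVec (i : Fin 2) (X : M4) : Fin 3 × Fin 3 → ℂ := fun k => coef i X k.1 k.2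

theorem mnorm_sub_le_of_gridVec_eq {i : Fin 2} {X Y : M4} {δ : ℝ} (hδ : 0 < δ)
    (hX : X ∈ rSpace i) (hY : Y ∈ rSpace i)
    (h : gridVec (δ / 8) (coefVec i X) = gridVec (δ / 8) (coefVec i Y)) : mnorm (X - Y) ≤ δ := by
  refine (mnorm_le_of_norm_coef_le (sub_mem hX hY) (t := 2 * (δ / 8)) fun a b => ?_).trans
    (by linarith)
  rw [coef_sub]
  exact norm_sub_le_of_gridIdx_eq (by linarith) (congrFun h (a, b))

theorem mnorm_proj_le {i : Fin 2} {π : M4 → M4} (hπ : ∀ X ∈ rSpace i, π X ∈ rUp i 0 ∧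
    ∀ Y ∈ rUp i 0, tinner (X - π X) Y = 0) {X : M4} (hX : X ∈ rSpace i) {t : ℝ}
    (ht : mnorm X ≤ t) : mnorm (π X) ≤ 16 * t := by
  obtain ⟨h1, h2⟩ := hπ X hX
  have h3 := h2 _ h1
  rw [tinner_sub_left, sub_eq_zero] at h3
  have h4 := mnorm_sq_le_tinner (π X)
  rw [← h3] at h4
  have h5 := (le_abs_self _).trans (abs_tinner_le ht (le_refl (mnorm (π X))))
  have ht0 : 0 ≤ t := (abs_nonneg _).trans ((abs_apply_le_mnorm X 0 0).trans ht)
  by_contra! hlt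
  nlinarith

theorem coef_proj {i : Fin 2} {π : M4 → M4} (hπ : ∀ X ∈ rSpace i, π X ∈ rUp i 0 ∧
    ∀ Y ∈ rUp i 0, tinner (X - π X) Y = 0) {X : M4} (hX : X ∈ rSpace i) {a b : Fin 3}
    (hab : (a : ℕ) + b ≤ 2) : coef i (π X) a b = coef i X a b := by
  obtain ⟨h1, h2⟩ := hπ X hX
  have h := coef_eq_zero_of_orthogonal (sub_mem hX (rUp_le_rSpace i 0 h1)) h2 hab
  rw [coef_sub] at h
  exact (sub_eq_zero.mp h).symm

/-- The grid cell of the jet of the polynomial attached to `X` at the point attached to `p`. -/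
noncomputable def jetCell (i : Fin 2) (δ : ℝ) (p : ℝ × ℝ) (X : M4) : Fin 3 × Fin 3 → ℤ × ℤ :=
  gridVec δ (jet (ptX i (p.1 : ℂ) p.2) (ptY i (p.1 : ℂ) p.2) (coef i X))

theorem norm_jet_sub_le {i : Fin 2} {π : M4 → M4} (hπ : ∀ X ∈ rSpace i, π X ∈ rUp i 0 ∧
    ∀ Y ∈ rUp i 0, tinner (X - π X) Y = 0) {p : ℝ × ℝ} (hp : p ∈ uSq) {δ : ℝ} (hδ : 0 < δ)
    {X Y X' Y' : M4} (hX : X ∈ rSpace i) (hY : Y ∈ rSpace i) (hX' : X' ∈ rSpace i)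
    (hY' : Y' ∈ rSpace i) (hXX' : mnorm (X - X') ≤ δ) (hYY' : mnorm (Y - Y') ≤ δ)
    (h : mnorm (π (Adm (uMat i p.1 p.2) X') - π (Adm (uMat i p.1 p.2) Y')) ≤ 2 * δ)
    (k : Fin 3 × Fin 3) :
    ‖jet (ptX i (p.1 : ℂ) p.2) (ptY i (p.1 : ℂ) p.2) (coef i X) k -
      jet (ptX i (p.1 : ℂ) p.2) (ptY i (p.1 : ℂ) p.2) (coef i Y) k‖ ≤ 136 * δ := by
  by_cases hk : (k.1 : ℕ) + k.2 ≤ 2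
  · rw [jet_coef_eq hX _ _ hk, jet_coef_eq hY _ _ hk]
    have hr : |p.1| ≤ 1 := abs_le.mpr hp.1
    have hs : |p.2| ≤ 1 := abs_le.mpr hp.2
    have h1 := norm_coef_le (i := i) (mnorm_Adm_le i hr hs hXX') k.1 k.2
    have h2 := norm_coef_le (i := i) (mnorm_Adm_le i hr hs hYY') k.1 k.2
    have h3 := norm_coef_le (i := i) h k.1 k.2
    rw [Adm_sub, coef_sub, Pi.sub_apply, Pi.sub_apply] at h1 h2
    rw [coef_sub, Pi.sub_apply, Pi.sub_apply, coef_proj hπ (Adm_mem_rSpace _ _ hX') hk,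
      coef_proj hπ (Adm_mem_rSpace _ _ hY') hk] at h3
    rw [norm_sub_rev] at h2
    calc _ = ‖(coef i (Adm (uMat i p.1 p.2) X) k.1 k.2 - coef i (Adm (uMat i p.1 p.2) X') k.1 k.2)
          + (coef i (Adm (uMat i p.1 p.2) X') k.1 k.2 - coef i (Adm (uMat i p.1 p.2) Y') k.1 k.2)
          + (coef i (Adm (uMat i p.1 p.2) Y') k.1 k.2 - coef i (Adm (uMat i p.1 p.2) Y) k.1 k.2)‖ := by
            congr 1; ring
      _ ≤ _ := norm_add₃_le
      _ ≤ _ := by linarith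
  · simp only [jet, if_neg hk, sub_zero, norm_zero]
    linarith

/-- A bounded subset of `rSpace i` can be replaced by a finite separated subset. -/
theorem exists_discretization (i : Fin 2) {δ : ℝ} (hδ : 0 < δ) {A : Set M4}
    (hA : A ⊆ {X : M4 | X ∈ rSpace i ∧ mnorm X ≤ 1}) :
    ∃ T : Finset M4, covNum δ A ≤ T.card ∧ (T.card : ℝ) ≤ 320 ^ 18 * covNum δ A ∧
      (∀ s ⊆ T, ∀ X ∈ s, ∀ ρ : ℝ, 1 ≤ ρ →
        ((s.filter fun Y => ∀ a b, ‖coef i Y a b - coef i X a b‖ ≤ ρ * δ).card : ℝ) ≤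
          (80 * ρ) ^ 18) ∧
      ∀ π : M4 → M4, (∀ X ∈ rSpace i, π X ∈ rUp i 0 ∧ ∀ Y ∈ rUp i 0, tinner (X - π X) Y = 0) →
        ∀ p ∈ uSq, ∀ A' ⊆ A, ∃ T' ⊆ T, covNum δ A' ≤ T'.card ∧
          ((T'.image (jetCell i δ p)).card : ℝ) ≤
            680 ^ 18 * covNum δ (π '' ((fun X => Adm (uMat i p.1 p.2) X) '' A')) := by
  have hδ' : 0 < δ / 8 := by linarith
  obtain ⟨T, hTA, hinj, hT⟩ := exists_finset_gridVec (A := A) (G := coefVec i) (B := 4 * 1) hδ'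
    fun X hX k => norm_coef_le (hA hX).2 k.1 k.2
  refine ⟨T, ?_, ?_, ?_, ?_⟩
  · refine covNum_le fun X hX => ?_
    obtain ⟨Y, hY, e⟩ := hT X hX
    exact ⟨Y, hY, mnorm_sub_le_of_gridVec_eq hδ (hA hX).1 (hA (hTA hY)).1 e.symm⟩
  · have h := card_image_gridVec_le_mul_covNum (s := T) (f := id) (S := A) (G := coefVec i)
      (Λ := 64) hδ hδ' (by norm_num) (fun X hX => (hA hX).2) (fun X hX => hTA hX) ?_
    · rw [Finset.card_image_of_injOn hinj] at h
      simpa using h.trans_eq (by norm_num)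
    · intro X hX Y hY h k
      have h1 := norm_coef_le (i := i) h k.1 k.2
      rw [id, id, coef_sub] at h1
      exact h1.trans (by linarith)
  · intro s hs X hX ρ hρ
    have h := card_image_le_mul_of_approxDet (approxDet_gridVec
      (s := s.filter fun Y => ∀ a b, ‖coef i Y a b - coef i X a b‖ ≤ ρ * δ)
      (X := fun _ => ()) (G := coefVec i) (Λ := 16 * ρ) hδ' (by linarith) ?_)
    · rw [Finset.card_image_of_injOn (hinj.mono fun Y hY => hs (Finset.mem_filter.mp hY).1)] at h
      refine h.trans ?_
      have h1 : (((s.filter fun Y => ∀ a b, ‖coef i Y a b - coef i X a b‖ ≤ ρ * δ).image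
          fun _ => ()).card : ℝ) ≤ 1 := by exact_mod_cast Finset.card_le_one_of_subsingleton _
      calc _ ≤ (5 * (16 * ρ)) ^ (2 * Fintype.card (Fin 3 × Fin 3)) * (1 : ℝ) := by gcongr
        _ = _ := by simp; ring
    · intro Y hY Z hZ _ k
      have h1 := (Finset.mem_filter.mp hY).2 k.1 k.2
      have h2 := (Finset.mem_filter.mp hZ).2 k.1 k.2
      rw [norm_sub_rev] at h2
      have h3 := norm_add_le (coef i Y k.1 k.2 - coef i X k.1 k.2)
        (coef i X k.1 k.2 - coef i Z k.1 k.2)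
      rw [sub_add_sub_cancel] at h3
      refine h3.trans ?_
      linarith
  · intro π hπ p hp A' hA'
    let T' := T.filter fun X => ∃ Y ∈ A', gridVec (δ / 8) (coefVec i Y) =
      gridVec (δ / 8) (coefVec i X)
    have hT' : ∀ X ∈ T', ∃ Y ∈ A', mnorm (X - Y) ≤ δ := fun X hX => by
      obtain ⟨hXT, Y, hY, e⟩ := Finset.mem_filter.mp hX
      exact ⟨Y, hY, mnorm_sub_le_of_gridVec_eq hδ (hA (hTA hXT)).1 (hA (hA' hY)).1 e.symm⟩
    choose! f hfA' hf using hT'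
    refine ⟨T', Finset.filter_subset _ _, ?_, ?_⟩
    · refine covNum_le fun X hX => ?_
      obtain ⟨Y, hY, e⟩ := hT X (hA' hX)
      exact ⟨Y, Finset.mem_filter.mpr ⟨hY, X, hX, e.symm⟩,
        mnorm_sub_le_of_gridVec_eq hδ (hA (hA' hX)).1 (hA (hTA hY)).1 e.symm⟩
    · have hr : |p.1| ≤ 1 := abs_le.mpr hp.1
      have hs : |p.2| ≤ 1 := abs_le.mpr hp.2
      refine (card_image_gridVec_le_mul_covNum (s := T')
        (f := fun X => π (Adm (uMat i p.1 p.2) (f X)))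
        (S := π '' ((fun X => Adm (uMat i p.1 p.2) X) '' A'))
        (G := fun X => jet (ptX i (p.1 : ℂ) p.2) (ptY i (p.1 : ℂ) p.2) (coef i X))
        (Λ := 136) (B := 16 * (16 * 1)) hδ hδ (by norm_num) ?_ ?_ ?_).trans_eq (by norm_num)
      · rintro _ ⟨_, ⟨X, hX, rfl⟩, rfl⟩
        exact mnorm_proj_le hπ (Adm_mem_rSpace _ _ (hA (hA' hX)).1)
          (mnorm_Adm_le i hr hs (hA (hA' hX)).2)
      · exact fun X hX => ⟨_, ⟨_, hfA' X hX, rfl⟩, rfl⟩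
      · have hm : ∀ X ∈ T', X ∈ rSpace i := fun X hX => (hA (hTA (Finset.mem_filter.mp hX).1)).1
        exact fun X hX Y hY h k => norm_jet_sub_le hπ hp hδ (hm X hX) (hm Y hY)
          (hA (hA' (hfA' X hX))).1 (hA (hA' (hfA' Y hY))).1 (hf X hX) (hf Y hY) h k

/-- A predicate depending on finitely many discrete measurable quantities has a measurable
witness. -/
theorem exists_measurable_witness {U ι γ β : Type*} [MeasurableSpace U] [Finite ι]
    [Countable γ] [MeasurableSpace γ] [MeasurableSingletonClass γ] [Inhabited β] {W : U → ι → γ}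
    (hW : ∀ x, Measurable fun u => W u x) (P : β → (ι → γ) → Prop) :
    MeasurableSet {u | ∃ S, P S (W u)} ∧ ∃ G : U → β, (∀ u, (∃ S, P S (W u)) → P (G u) (W u)) ∧
      ∀ Q : β → Prop, MeasurableSet {u | Q (G u)} := by
  have hW' : Measurable W := measurable_pi_iff.mpr hW
  have hd : ∀ E : Set (ι → γ), MeasurableSet E := fun E => E.to_countable.measurableSet
  refine ⟨hW' (hd {w | ∃ S, P S w}), fun u => Classical.epsilon fun S => P S (W u),
    fun u hu => Classical.epsilon_spec hu, fun Q => ?_⟩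
  exact hW' (hd {w | Q (Classical.epsilon fun S => P S w)})

theorem measurable_gridVec_jet (i : Fin 2) (δ : ℝ) (D : Fin 3 → Fin 3 → ℂ) :
    Measurable fun p : ℝ × ℝ => gridVec δ (jet (ptX i (p.1 : ℂ) p.2) (ptY i (p.1 : ℂ) p.2) D) := by
  refine measurable_pi_iff.mpr fun k => ?_
  have hc : Continuous fun p : ℝ × ℝ => jet (ptX i (p.1 : ℂ) p.2) (ptY i (p.1 : ℂ) p.2) D k := by
    have hx : Continuous fun p : ℝ × ℝ => ptX i (p.1 : ℂ) (p.2 : ℂ) := by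
      unfold ptX; split_ifs <;> fun_prop
    have hy : Continuous fun p : ℝ × ℝ => ptY i (p.1 : ℂ) (p.2 : ℂ) := by
      unfold ptY; split_ifs <;> fun_prop
    have hv : ∀ a b, Continuous fun x : ℂ => jetVec x a b := fun a b => by
      fin_cases a <;> fin_cases b <;> simp [jetVec] <;> fun_prop
    have hvx : ∀ a b, Continuous fun p : ℝ × ℝ => jetVec (ptX i (p.1 : ℂ) (p.2 : ℂ)) a b :=
      fun a b => (hv a b).comp hx
    have hvy : ∀ a b, Continuous fun p : ℝ × ℝ => jetVec (ptY i (p.1 : ℂ) (p.2 : ℂ)) a b :=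
      fun a b => (hv a b).comp hy
    unfold jet tensorFun
    split_ifs <;> fun_prop
  have hr := Complex.continuous_re.comp hc
  have hi := Complex.continuous_im.comp hc
  exact ((hr.measurable.div_const δ).floor).prodMk ((hi.measurable.div_const δ).floor)

/-- The parameters at which a large part of the family `F` occupies at most `n` jet cells. -/
def smallImageSet {ι : Type*} [Fintype ι] (i : Fin 2) (F : ι → Fin 3 → Fin 3 → ℂ) (δ θ n : ℝ) :
    Set (ℝ × ℝ) :=
  {p ∈ uSq | ∃ S : Finset ι, θ * Fintype.card ι ≤ S.card ∧
    ((S.image fun x => gridVec δ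
      (jet (ptX i (p.1 : ℂ) p.2) (ptY i (p.1 : ℂ) p.2) (F x))).card : ℝ) ≤ n}

theorem volume_uSq_lt_top : volume uSq < ⊤ := by
  rw [uSq, Measure.volume_eq_prod, Measure.prod_prod]
  exact ENNReal.mul_lt_top (by simp) (by simp)

theorem exists_log_card_le_of_volume_smallImageSet (i : Fin 2) : ∃ C c : ℝ, 0 < C ∧ 0 < c ∧
    ∀ {ι : Type} [Fintype ι] [Nonempty ι] {F : ι → Fin 3 → Fin 3 → ℂ} {δ θ n κ : ℝ}, 0 < δ →
      0 < θ → 0 < κ → κ ≤ 1 / 80 →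
      (∀ X, ∀ ρ : ℝ, 1 ≤ ρ → ((Finset.univ.filter fun Y =>
        ∀ a b, ‖F Y a b - F X a b‖ ≤ ρ * δ).card : ℝ) ≤ (80 * ρ) ^ 18) →
      C * κ ^ c < θ ^ 8 / 2 * (volume (smallImageSet i F δ θ n)).toReal ^ 8 →
      8 * Real.log (θ ^ 8 / 2 * Fintype.card ι) ≤ 12 * Real.log n + 40 * Real.log (κ⁻¹ ^ 2000) := by
  obtain ⟨C, c, hC, hc, hbad⟩ := exists_volume_not_genPos_le i
  refine ⟨C, c, hC, hc, fun {ι} _ _ {F δ θ n κ} hδ hθ hκ hκ' hsep hV => ?_⟩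
  obtain ⟨hmeas, G, hG, hGm⟩ := exists_measurable_witness
    (W := fun (p : ℝ × ℝ) (x : ι) => gridVec δ
      (jet (ptX i (p.1 : ℂ) p.2) (ptY i (p.1 : ℂ) p.2) (F x)))
    (fun x => measurable_gridVec_jet i δ (F x))
    (fun (S : Finset ι) w => θ * Fintype.card ι ≤ S.card ∧ ((S.image w).card : ℝ) ≤ n)
  have huSq : MeasurableSet uSq := measurableSet_Icc.prod measurableSet_Icc
  have hFm : MeasurableSet (smallImageSet i F δ θ n) := huSq.inter hmeas
  obtain ⟨v, hvF, hvB, hcard⟩ := exists_tuple_card_inter_ge (T := (Finset.univ : Finset ι))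
    Finset.univ_nonempty hFm
    ((measure_mono Set.inter_subset_left).trans_lt volume_uSq_lt_top).ne
    G (fun x _ => hFm.inter (hGm fun S => x ∈ S)) hθ
    (fun u hu => by simpa using (hG u hu.2).1)
    ((hbad κ hκ (by linarith)).trans_lt ((ENNReal.ofReal_lt_ofReal_iff
      ((mul_pos hC (Real.rpow_pos_of_pos hκ c)).trans hV)).mpr hV))
  set s : Finset ι := Finset.univ.filter fun x => ∀ j, x ∈ G (v j) with hs
  have hg := not_not.mp fun hg => hvB ⟨fun j => ⟨abs_le.mpr (hvF j).1.1, abs_le.mpr (hvF j).1.2⟩, hg⟩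
  have hpos : 0 < θ ^ 8 / 2 * (Fintype.card ι : ℝ) := by
    have : (0 : ℝ) < Fintype.card ι := by exact_mod_cast Fintype.card_pos
    positivity
  rw [Finset.card_univ] at hcard
  have hs0 : (0 : ℝ) < s.card := hpos.trans_le hcard
  have himg : ∀ j, ((s.image fun x => gridVec δ (jet (ptX i ((v j).1 : ℂ) (v j).2)
      (ptY i ((v j).1 : ℂ) (v j).2) (F x))).card : ℝ) ≤ n := fun j => by
    refine le_trans ?_ (hG (v j) (hvF j).2).2
    exact_mod_cast Finset.card_le_card (Finset.image_subset_image fun x hx =>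
      (show ∀ j, x ∈ G (v j) by simpa [hs] using hx) j)
  have h80 : (80 : ℝ) ≤ κ⁻¹ := by
    rw [le_inv_comm₀ (by norm_num) hκ]
    linarith
  have h := log_card_le_of_genPos (Finset.card_pos.mp (by exact_mod_cast hs0)) hg hδ
    (fun x _ ρ hρ => ?_) (himg 0) (himg 1) fun j => himg (Fin.natAdd 2 j)
  · have h2 := Real.log_le_log hpos hcard
    linarith
  · calc _ ≤ ((Finset.univ.filter fun Y => ∀ a b, ‖F Y a b - F x a b‖ ≤ ρ * δ).card : ℝ) := by
          exact_mod_cast Finset.card_le_card (Finset.filter_subset_filter _ (Finset.subset_univ s))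
      _ ≤ (80 * ρ) ^ 18 := hsep x ρ hρ
      _ ≤ _ := by gcongr

theorem exists_exponents {C c K : ℝ} (hC : 0 < C) (hc : 0 < c) (hK : 1 ≤ K) :
    ∃ M m η : ℝ, 1 ≤ M ∧ 0 < η ∧ η < 1 ∧ ∀ τ : ℝ, 0 < τ → τ ≤ η →
      τ ^ m ≤ 1 / 80 ∧ C * (τ ^ m) ^ c < (τ / K) ^ 8 / 2 * τ ^ 8 ∧ ∀ N : ℝ, 0 < N →
        12 * Real.log (K * (τ ^ M * N ^ ((2 : ℝ) / 3))) + 40 * Real.log ((τ ^ m)⁻¹ ^ 2000) <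
          8 * Real.log ((τ / K) ^ 8 / 2 * N) := by
  set m := max 1 (17 / c)
  have hm : 1 ≤ m := le_max_left _ _
  have hmc : 17 ≤ m * c := (div_le_iff₀ hc).mp (le_max_right _ _)
  have hK0 : 0 < K := by linarith
  refine ⟨(148 + 80000 * m) / 12, m, min (1 / 80) (min (1 / (3 * K)) (1 / (4 * C * K ^ 8))),
    by linarith, by positivity, (min_le_left _ _).trans_lt (by norm_num), fun τ hτ h => ?_⟩
  have h1 : τ ≤ 1 / 80 := h.trans (min_le_left _ _)
  have h2 : τ ≤ 1 / (3 * K) := h.trans ((min_le_right _ _).trans (min_le_left _ _))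
  have h3 : τ ≤ 1 / (4 * C * K ^ 8) := h.trans ((min_le_right _ _).trans (min_le_right _ _))
  have hτ1 : τ ≤ 1 := by linarith
  refine ⟨?_, ?_, fun N hN => ?_⟩
  · calc τ ^ m ≤ τ ^ (1 : ℝ) := Real.rpow_le_rpow_of_exponent_ge hτ hτ1 hm
      _ ≤ _ := by rwa [Real.rpow_one]
  · have h4 : (τ ^ m) ^ c ≤ τ ^ 17 := by
      rw [← Real.rpow_mul hτ.le, ← Real.rpow_natCast]
      exact Real.rpow_le_rpow_of_exponent_ge hτ hτ1 (by exact_mod_cast hmc)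
    rw [le_div_iff₀ (by positivity)] at h3
    have h5 : (τ / K) ^ 8 / 2 * τ ^ 8 = τ ^ 16 / (2 * K ^ 8) := by field_simp
    rw [h5, lt_div_iff₀ (by positivity)]
    have h6 : 0 < τ ^ 16 := pow_pos hτ 16
    calc C * (τ ^ m) ^ c * (2 * K ^ 8) ≤ C * τ ^ 17 * (2 * K ^ 8) := by gcongr
      _ = τ ^ 16 * (τ * (4 * C * K ^ 8)) / 2 := by ring
      _ ≤ τ ^ 16 * 1 / 2 := by gcongr
      _ < τ ^ 16 := by linarith
  · have hlK : 0 ≤ Real.log K := Real.log_nonneg hK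
    have hl : Real.log τ ≤ -(1 + Real.log K) := by
      rw [← Real.log_exp (-(1 + Real.log K))]
      refine Real.log_le_log hτ (h2.trans ?_)
      rw [Real.exp_neg, Real.exp_add, Real.exp_log hK0, one_div]
      gcongr
      exact Real.exp_one_lt_d9.le.trans (by norm_num)
    have hl2 : Real.log 2 < 1 := Real.log_two_lt_d9.trans (by norm_num)
    rw [Real.log_mul hK0.ne' (by positivity), Real.log_mul (by positivity) (by positivity),
      Real.log_rpow hτ, Real.log_rpow hN, Real.log_pow, Real.log_inv, Real.log_rpow hτ,
      Real.log_mul (by positivity) hN.ne', Real.log_div (by positivity) two_ne_zero, Real.log_pow,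
      Real.log_div hτ.ne' hK0.ne']
    push_cast
    linarith

/-- subcritical estimate for the projections π^{(0)}_u, dim 𝔯ᵢ^{(0)} = 6. -/
theorem stmt7 (i : Fin 2) :
    ∃ M ε₀ : ℝ, 1 ≤ M ∧ 0 < ε₀ ∧
    ∃ δ₁ : ℝ → ℝ,
      (∀ ε : ℝ, 0 < ε → ε < ε₀ → δ₁ ε ∈ Set.Ioo (0:ℝ) 1) ∧
      ∀ ε : ℝ, 0 < ε → ε < ε₀ →
      ∀ δ : ℝ, 0 < δ → δ ≤ δ₁ ε →
      ∀ A : Set M4, A ⊆ {X : M4 | X ∈ rSpace i ∧ mnorm X ≤ 1} →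
      ∀ π : M4 → M4,
        (∀ X ∈ rSpace i, π X ∈ rUp i 0 ∧ ∀ Y ∈ rUp i 0, tinner (X - π X) Y = 0) →
        mU {p ∈ uSq | ∃ A' ⊆ A,
            δ ^ ε * (covNum δ A : ℝ) ≤ (covNum δ A' : ℝ) ∧
            ((covNum δ (π '' ((fun X => Adm (uMat i p.1 p.2) X) '' A')) : ℝ) <
              δ ^ (M * ε) * (covNum δ A : ℝ) ^ ((2:ℝ)/3))}
          ≤ ENNReal.ofReal (δ ^ ε) := by
  obtain ⟨C, c, hC, hc, hlog⟩ := exists_log_card_le_of_volume_smallImageSet i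
  obtain ⟨M, m, η, hM, hη, hη1, hexp⟩ := exists_exponents (K := 680 ^ 18) hC hc (by norm_num)
  refine ⟨M, 1, hM, one_pos, fun ε => η ^ ε⁻¹, fun ε hε _ =>
    ⟨Real.rpow_pos_of_pos hη _, Real.rpow_lt_one hη.le hη1 (inv_pos.mpr hε)⟩,
    fun ε hε _ δ hδ hδη A hA π hπ => ?_⟩
  obtain ⟨T, hAT, hTA, hsep, hproj⟩ := exists_discretization i hδ hA
  have hτη : δ ^ ε ≤ η := by
    calc δ ^ ε ≤ (η ^ ε⁻¹) ^ ε := Real.rpow_le_rpow hδ.le hδη hε.le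
      _ = η := by rw [← Real.rpow_mul hη.le, inv_mul_cancel₀ hε.ne', Real.rpow_one]
  have hδM : δ ^ (M * ε) = (δ ^ ε) ^ M := by rw [← Real.rpow_mul hδ.le, mul_comm]
  rw [hδM]
  have hτ : 0 < δ ^ ε := Real.rpow_pos_of_pos hδ ε
  generalize δ ^ ε = τ at hτη hτ ⊢
  obtain ⟨hκ, hV, hN⟩ := hexp τ hτ hτη
  obtain rfl | hT := T.eq_empty_or_nonempty
  · have h0 : covNum δ A = 0 := by simpa using hAT
    have he : {p ∈ uSq | ∃ A' ⊆ A, τ * (covNum δ A : ℝ) ≤ (covNum δ A' : ℝ) ∧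
        ((covNum δ (π '' ((fun X => Adm (uMat i p.1 p.2) X) '' A')) : ℝ) <
          τ ^ M * (covNum δ A : ℝ) ^ ((2 : ℝ) / 3))} = ∅ := by
      refine Set.eq_empty_of_forall_notMem fun p hp => ?_
      obtain ⟨-, A', -, -, h⟩ := hp
      rw [h0, Nat.cast_zero, Real.zero_rpow (by norm_num), mul_zero] at h
      exact absurd h (Nat.cast_nonneg _).not_gt
    rw [he, mU, measure_empty, ENNReal.zero_div]
    exact zero_le
  have : Nonempty T := hT.coe_sort
  have hT0 : (0 : ℝ) < T.card := by exact_mod_cast hT.card_pos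
  set F : T → Fin 3 → Fin 3 → ℂ := fun X => coef i X with hF
  set n : ℝ := 680 ^ 18 * (τ ^ M * (T.card : ℝ) ^ ((2 : ℝ) / 3)) with hn
  have hsub : {p ∈ uSq | ∃ A' ⊆ A, τ * (covNum δ A : ℝ) ≤ (covNum δ A' : ℝ) ∧
        ((covNum δ (π '' ((fun X => Adm (uMat i p.1 p.2) X) '' A')) : ℝ) <
          τ ^ M * (covNum δ A : ℝ) ^ ((2 : ℝ) / 3))} ⊆
      smallImageSet i F δ (τ / 680 ^ 18) n := by
    rintro p ⟨hp, A', hA', h1, h2⟩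
    obtain ⟨T', hT', h3, h4⟩ := hproj π hπ p hp A' hA'
    have hmap : (T'.subtype (· ∈ T)).map (Function.Embedding.subtype _) = T' :=
      Finset.subtype_map_of_mem hT'
    refine ⟨hp, T'.subtype (· ∈ T), ?_, ?_⟩
    · rw [← Finset.card_map (Function.Embedding.subtype (· ∈ T)), hmap, Fintype.card_coe]
      calc τ / 680 ^ 18 * T.card ≤ τ / 680 ^ 18 * (320 ^ 18 * covNum δ A) := by gcongr
        _ = (320 / 680) ^ 18 * (τ * covNum δ A) := by ring
        _ ≤ 1 * (τ * covNum δ A) := by gcongr; norm_num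
        _ ≤ T'.card := by rw [one_mul]; exact h1.trans (by exact_mod_cast h3)
    · have him : ((T'.subtype (· ∈ T)).image fun X => gridVec δ
          (jet (ptX i (p.1 : ℂ) p.2) (ptY i (p.1 : ℂ) p.2) (F X))) = T'.image (jetCell i δ p) := by
        conv_rhs => rw [← hmap]
        rw [Finset.map_eq_image, Finset.image_image]
        rfl
      refine le_trans (le_of_eq (by rw [← him])) (h4.trans ?_)
      rw [hn]
      have hA0 : (covNum δ A : ℝ) ≤ T.card := by exact_mod_cast hAT
      gcongr
      refine h2.le.trans ?_
      gcongr
  by_contra! hlt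
  have hvol : ENNReal.ofReal τ ≤ volume (smallImageSet i F δ (τ / 680 ^ 18) n) := by
    refine le_trans hlt.le (le_trans ?_ (measure_mono hsub))
    rw [mU]
    exact ENNReal.div_le_of_le_mul (le_mul_of_one_le_right zero_le (by norm_num))
  have hfin : volume (smallImageSet i F δ (τ / 680 ^ 18) n) ≠ ⊤ :=
    ((measure_mono Set.inter_subset_left).trans_lt volume_uSq_lt_top).ne
  have hvol' := (ENNReal.ofReal_le_iff_le_toReal hfin).mp hvol
  have h := hlog (F := F) (n := n) (θ := τ / 680 ^ 18) hδ (by positivity)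
    (Real.rpow_pos_of_pos hτ m) hκ ?_ (hV.trans_le (by gcongr))
  · rw [Fintype.card_coe] at h
    exact absurd h (hN _ hT0).not_ge
  · intro X ρ hρ
    refine le_trans (le_of_eq ?_) (hsep T subset_rfl X X.2 ρ hρ)
    rw [← Finset.card_map (Function.Embedding.subtype (· ∈ T))]
    congr 2
    ext Y
    simp [hF, and_comm]
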